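/- There exists a 4-sparse Steiner triple system of order v if and only if v ≡ 1 or 3 (mod 6) and v ≠ 7, 13. -/

import Mathlib

open Finset

/-- `B` is a Steiner triple system on `V`: a collection of 3-element subsets such that
every pair of distinct points lies in exactly one triple. -/
def IsSTS {V : Type*} [DecidableEq V] (B : Finset (Finset V)) : Prop :=
  (∀ T ∈ B, T.card = 3) ∧ ∀ x y : V, x ≠ y → ∃! T, T ∈ B ∧ x ∈ T ∧ y ∈ T

/-- A `(k, l)`-configuration of triples: `l` triples whose union contains exactly
`k` points. -/
def IsTripleConfiguration {V : Type*} [DecidableEq V] (k l : ℕ)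
    (D : Finset (Finset V)) : Prop :=
  D.card = l ∧ (∀ T ∈ D, T.card = 3) ∧ (D.sup id).card = k

/-- An STS is `r`-sparse if it contains no `(j+2, j)`-configuration for `2 ≤ j ≤ r`. -/
def STSSparse {V : Type*} [DecidableEq V] (r : ℕ) (B : Finset (Finset V)) : Prop :=
  ∀ j, 2 ≤ j → j ≤ r → ∀ D ⊆ B, ¬ IsTripleConfiguration (j + 2) j D


/-! ### Abstract form -/

/-- An anti-Pasch Steiner triple system given by its collinearity relation. -/
structure APR {V : Type*} (R : V → V → V → Prop) : Prop where
  s12 : ∀ x y z, R x y z → R y x z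
  s23 : ∀ x y z, R x y z → R x z y
  ne : ∀ x y z, R x y z → x ≠ y
  ex : ∀ x y, x ≠ y → ∃ z, R x y z
  uq : ∀ x y z w, R x y z → R x y w → z = w
  np : ∀ a b c d e f, R a b e → R c d e → R a c f → R b d f → a = d

def APS (V : Type*) : Prop := ∃ R : V → V → V → Prop, APR R

theorem APS.equiv {V W : Type*} (e : V ≃ W) (h : APS V) : APS W := by
  obtain ⟨R, hR⟩ := h
  refine ⟨fun x y z => R (e.symm x) (e.symm y) (e.symm z), ?_, ?_, ?_, ?_, ?_, ?_⟩
  · intro x y z h; exact hR.s12 _ _ _ h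
  · intro x y z h; exact hR.s23 _ _ _ h
  · intro x y z h hxy; exact hR.ne _ _ _ h (by rw [hxy])
  · intro x y h
    obtain ⟨z, hz⟩ := hR.ex (e.symm x) (e.symm y) (fun h' => h (e.symm.injective h'))
    exact ⟨e z, by simpa using hz⟩
  · intro x y z w h1 h2; exact e.symm.injective (hR.uq _ _ _ _ h1 h2)
  · intro a b c d e' f h1 h2 h3 h4; exact e.symm.injective (hR.np _ _ _ _ _ _ h1 h2 h3 h4)

theorem sts_inter {V : Type*} [DecidableEq V] {B : Finset (Finset V)} (hB : IsSTS B)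
    {S T : Finset V} (hS : S ∈ B) (hT : T ∈ B) (hne : S ≠ T) : (S ∩ T).card ≤ 1 := by
  rw [Finset.card_le_one]
  intro a ha b hb
  by_contra hab
  simp only [mem_inter] at ha hb
  obtain ⟨U, -, hU⟩ := hB.2 a b hab
  exact hne ((hU S ⟨hS, ha.1, hb.1⟩).trans (hU T ⟨hT, ha.2, hb.2⟩).symm)

theorem sts_two {V : Type*} [DecidableEq V] {B : Finset (Finset V)} (hB : IsSTS B)
    {S T : Finset V} (hS : S ∈ B) (hT : T ∈ B) (hne : S ≠ T) : 5 ≤ (S ∪ T).card := by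
  have h1 := Finset.card_union_add_card_inter S T
  have h2 := sts_inter hB hS hT hne
  have h3 := hB.1 S hS
  have h4 := hB.1 T hT
  omega

/-- Three distinct blocks cover at least six points; if exactly six then they pairwise meet. -/
theorem sts_three {V : Type*} [DecidableEq V] {B : Finset (Finset V)} (hB : IsSTS B)
    {S T U : Finset V} (hS : S ∈ B) (hT : T ∈ B) (hU : U ∈ B) (h1 : S ≠ T) (h2 : S ≠ U)
    (h3 : T ≠ U) : 6 ≤ (S ∪ T ∪ U).card ∧ ((S ∪ T ∪ U).card ≤ 6 → (S ∩ T).card = 1 ∧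
      ∀ x, x ∈ S → x ∈ T → x ∉ U) := by
  have e1 := Finset.card_union_add_card_inter S T
  have e2 := Finset.card_union_add_card_inter (S ∪ T) U
  have i1 := sts_inter hB hS hT h1
  have i2 := sts_inter hB hS hU h2
  have i3 := sts_inter hB hT hU h3
  have c1 := hB.1 S hS
  have c2 := hB.1 T hT
  have c3 := hB.1 U hU
  have e3 : (S ∪ T) ∩ U = (S ∩ U) ∪ (T ∩ U) := Finset.union_inter_distrib_right _ _ _
  have e4 := Finset.card_union_add_card_inter (S ∩ U) (T ∩ U)
  rw [e3] at e2
  refine ⟨by omega, fun h => ⟨by omega, ?_⟩⟩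
  intro x hxS hxT hxU
  have : 0 < ((S ∩ U) ∩ (T ∩ U)).card := Finset.card_pos.2 ⟨x, by simp [hxS, hxT, hxU]⟩
  omega

theorem APR.exists_finset {V : Type*} [Fintype V] [DecidableEq V] {R : V → V → V → Prop}
    (h : APR R) : ∃ B : Finset (Finset V), IsSTS B ∧ STSSparse 4 B := by
  classical
  have s12 := h.s12
  have s23 := h.s23
  let B : Finset (Finset V) := univ.filter (fun T => ∃ x y z, R x y z ∧ T = {x, y, z})
  have memB : ∀ T, T ∈ B ↔ ∃ x y z, R x y z ∧ T = {x, y, z} := by intro T; simp [B]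
  have distinct : ∀ x y z, R x y z → x ≠ y ∧ x ≠ z ∧ y ≠ z := fun x y z hr =>
    ⟨h.ne _ _ _ hr, h.ne _ _ _ (s23 _ _ _ hr), h.ne _ _ _ (s23 _ _ _ (s12 _ _ _ hr))⟩
  have pts : ∀ T ∈ B, ∀ x ∈ T, ∀ y ∈ T, x ≠ y → ∃ z, R x y z ∧ T = {x, y, z} := by
    intro T hT x hx y hy hxy
    obtain ⟨a, b, c, hr, rfl⟩ := (memB T).1 hT
    have r1 := s12 _ _ _ hr
    have r2 := s23 _ _ _ hr
    have r3 := s23 _ _ _ r1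
    have r4 := s12 _ _ _ r2
    have r5 := s23 _ _ _ r4
    simp only [mem_insert, mem_singleton] at hx hy
    rcases hx with rfl | rfl | rfl <;> rcases hy with rfl | rfl | rfl <;>
      first
      | exact absurd rfl hxy
      | exact ⟨_, hr, rfl⟩
      | exact ⟨_, r1, by ext; simp; tauto⟩
      | exact ⟨_, r2, by ext; simp; tauto⟩
      | exact ⟨_, r3, by ext; simp; tauto⟩
      | exact ⟨_, r4, by ext; simp; tauto⟩
      | exact ⟨_, r5, by ext; simp; tauto⟩
  have hB : IsSTS B := by
    constructor
    · intro T hT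
      obtain ⟨x, y, z, hr, rfl⟩ := (memB T).1 hT
      obtain ⟨d1, d2, d3⟩ := distinct _ _ _ hr
      simp [Finset.card_eq_three]
      exact ⟨x, y, d1, z, d2, d3, rfl⟩
    · intro x y hxy
      obtain ⟨z, hz⟩ := h.ex x y hxy
      refine ⟨{x, y, z}, ⟨(memB _).2 ⟨x, y, z, hz, rfl⟩, by simp, by simp⟩, ?_⟩
      rintro T ⟨hT, hx, hy⟩
      obtain ⟨w, hw, rfl⟩ := pts T hT x hx y hy hxy
      rw [h.uq _ _ _ _ hz hw]
  refine ⟨B, hB, ?_⟩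
  rintro j hj2 hj4 D hD ⟨hc, -, hk⟩
  have hj : j = 2 ∨ j = 3 ∨ j = 4 := by omega
  rcases hj with rfl | rfl | rfl
  · obtain ⟨S, T, hne, rfl⟩ := Finset.card_eq_two.1 hc
    have := sts_two hB (hD (by simp : S ∈ _)) (hD (by simp : T ∈ _)) hne
    simp at hk
    omega
  · obtain ⟨S, T, U, h1, h2, h3, rfl⟩ := Finset.card_eq_three.1 hc
    have := (sts_three hB (hD (by simp : S ∈ _)) (hD (by simp : T ∈ _))
      (hD (by simp : U ∈ _)) h1 h2 h3).1
    simp [← Finset.union_assoc] at hk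
    omega
  · obtain ⟨T4, D', hnot, rfl, hc'⟩ := Finset.card_eq_succ.1 hc
    obtain ⟨T1, T2, T3, n12, n13, n23, rfl⟩ := Finset.card_eq_three.1 hc'
    simp only [mem_insert, mem_singleton, not_or] at hnot
    obtain ⟨n41, n42, n43⟩ := hnot
    have b1 : T1 ∈ B := hD (by simp)
    have b2 : T2 ∈ B := hD (by simp)
    have b3 : T3 ∈ B := hD (by simp)
    have b4 : T4 ∈ B := hD (by simp)
    simp only [sup_insert, id, sup_singleton, sup_eq_union] at hk
    have key : ∀ S ∈ B, ∀ T ∈ B, ∀ U ∈ B, S ≠ T → S ≠ U → T ≠ U →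
        S ∪ T ∪ U ⊆ T4 ∪ (T1 ∪ (T2 ∪ T3)) → (S ∩ T).card = 1 ∧
      ∀ x, x ∈ S → x ∈ T → x ∉ U := by
      intro S hS T hT U hU h1 h2 h3 hsub
      have := Finset.card_le_card hsub
      exact (sts_three hB hS hT hU h1 h2 h3).2 (by omega)
    have k123 := key T1 b1 T2 b2 T3 b3 n12 n13 n23 (by intro x; simp; tauto)
    have k134 := key T1 b1 T3 b3 T4 b4 n13 (Ne.symm n41) (Ne.symm n43) (by intro x; simp; tauto)
    have k142 := key T1 b1 T4 b4 T2 b2 (Ne.symm n41) n12 n42 (by intro x; simp; tauto)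
    have k231 := key T2 b2 T3 b3 T1 b1 n23 (Ne.symm n12) (Ne.symm n13) (by intro x; simp; tauto)
    have k243 := key T2 b2 T4 b4 T3 b3 (Ne.symm n42) n23 n43 (by intro x; simp; tauto)
    have k341 := key T3 b3 T4 b4 T1 b1 (Ne.symm n43) (Ne.symm n13) n41 (by intro x; simp; tauto)
    have k342 := key T3 b3 T4 b4 T2 b2 (Ne.symm n43) (Ne.symm n23) n42 (by intro x; simp; tauto)
    have pick : ∀ {S T : Finset V}, (S ∩ T).card = 1 → ∃ x, x ∈ S ∧ x ∈ T := by
      intro S T hh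
      obtain ⟨x, hx⟩ := Finset.card_eq_one.1 hh
      have : x ∈ S ∩ T := by simp [hx]
      exact ⟨x, mem_inter.1 this⟩
    obtain ⟨e, e1, e2⟩ := pick k123.1
    obtain ⟨a, a1, a3⟩ := pick k134.1
    obtain ⟨b, hb1, hb4⟩ := pick k142.1
    obtain ⟨c, c2, c3⟩ := pick k231.1
    obtain ⟨d, d2, d4⟩ := pick k243.1
    obtain ⟨f, f3, f4⟩ := pick k341.1
    have e3 := k123.2 e e1 e2
    have e4 : e ∉ T4 := fun hh => k142.2 e e1 hh e2
    have a4 := k134.2 a a1 a3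
    have a2 : a ∉ T2 := fun hh => k123.2 a a1 hh a3
    have c4 : c ∉ T4 := fun hh => k243.2 c c2 hh c3
    have c1 := k231.2 c c2 c3
    have d1 : d ∉ T1 := fun hh => k142.2 d hh d4 d2
    have hb3 : b ∉ T3 := fun hh => k134.2 b hb1 hh hb4
    have line : ∀ T ∈ B, ∀ x ∈ T, ∀ y ∈ T, ∀ z ∈ T, x ≠ y → x ≠ z → y ≠ z → R x y z := by
      intro T hT x hx y hy z hz h1 h2 h3
      obtain ⟨w, hw, rfl⟩ := pts T hT x hx y hy h1
      simp only [mem_insert, mem_singleton] at hz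
      rcases hz with rfl | rfl | rfl
      · exact absurd rfl h2
      · exact absurd rfl h3
      · exact hw
    have had := h.np a b c d e f
      (line T1 b1 a a1 b hb1 e e1 (by rintro rfl; exact a4 hb4) (by rintro rfl; exact a2 e2)
        (by rintro rfl; exact e4 hb4))
      (line T2 b2 c c2 d d2 e e2 (by rintro rfl; exact c4 d4) (by rintro rfl; exact c1 e1)
        (by rintro rfl; exact d1 e1))
      (line T3 b3 a a3 c c3 f f3 (by rintro rfl; exact a2 c2) (by rintro rfl; exact a4 f4)
        (by rintro rfl; exact c4 f4))
      (line T4 b4 b hb4 d d4 f f4 (by rintro rfl; exact d1 hb1) (by rintro rfl; exact hb3 f3)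
        (by rintro rfl; exact k342.2 d f3 f4 d2))
    subst had
    exact a2 d2

theorem STS.toAPS {V : Type*} [DecidableEq V] {B : Finset (Finset V)} (hB : IsSTS B)
    (hs : STSSparse 4 B) : APS V := by
  have perm1 : ∀ x y z : V, ({x, y, z} : Finset V) = {y, x, z} := by
    intro x y z; ext; simp; tauto
  have perm2 : ∀ x y z : V, ({x, y, z} : Finset V) = {x, z, y} := by
    intro x y z; ext; simp; tauto
  have uq : ∀ x y : V, x ≠ y → ∀ S ∈ B, ∀ T ∈ B, x ∈ S → y ∈ S → x ∈ T → y ∈ T → S = T := by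
    intro x y hxy S hS T hT h1 h2 h3 h4
    obtain ⟨U, -, hU⟩ := hB.2 x y hxy
    exact (hU S ⟨hS, h1, h2⟩).trans (hU T ⟨hT, h3, h4⟩).symm
  refine ⟨fun x y z => x ≠ y ∧ y ≠ z ∧ x ≠ z ∧ ({x, y, z} : Finset V) ∈ B, ?_, ?_, ?_, ?_, ?_, ?_⟩
  · rintro x y z ⟨h1, h2, h3, h4⟩
    exact ⟨h1.symm, h3, h2, by rwa [← perm1]⟩
  · rintro x y z ⟨h1, h2, h3, h4⟩
    exact ⟨h3, h2.symm, h1, by rwa [← perm2]⟩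
  · rintro x y z ⟨h1, h2, h3, h4⟩
    exact h1
  · intro x y hxy
    obtain ⟨T, ⟨hT, hx, hy⟩, -⟩ := hB.2 x y hxy
    have hc : ((T.erase x).erase y).card = 1 := by
      rw [Finset.card_erase_of_mem (by simp [hy, hxy.symm]), Finset.card_erase_of_mem hx, hB.1 T hT]
    obtain ⟨z, hz⟩ := Finset.card_eq_one.1 hc
    have hz' : z ∈ (T.erase x).erase y := by simp [hz]
    simp only [mem_erase] at hz'
    refine ⟨z, hxy, hz'.1.symm, hz'.2.1.symm, ?_⟩
    have : ({x, y, z} : Finset V) = T := by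
      rw [← Finset.insert_erase hx, ← Finset.insert_erase (by simp [hy, hxy.symm] : y ∈ T.erase x),
        hz]
    rwa [this]
  · rintro x y z w ⟨h1, h2, h3, h4⟩ ⟨g1, g2, g3, g4⟩
    have := uq x y h1 _ h4 _ g4 (by simp) (by simp) (by simp) (by simp)
    have hz : z ∈ ({x, y, w} : Finset V) := by rw [← this]; simp
    simp only [mem_insert, mem_singleton] at hz
    rcases hz with rfl | rfl | rfl
    · exact absurd rfl h3
    · exact absurd rfl h2
    · rfl
  · rintro a b c d e f ⟨ab, be, ae, h1⟩ ⟨cd, de, ce, h2⟩ ⟨ac, cf, af, h3⟩ ⟨bd, df, bf, h4⟩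
    by_contra had
    have bc : b ≠ c := by
      rintro rfl
      have := uq b e be _ h1 _ h2 (by simp) (by simp) (by simp) (by simp)
      have hz : a ∈ ({b, d, e} : Finset V) := by rw [← this]; simp
      simp only [mem_insert, mem_singleton] at hz
      tauto
    have ef : e ≠ f := by
      rintro rfl
      have := uq a e ae _ h1 _ h3 (by simp) (by simp) (by simp) (by simp)
      have hz : b ∈ ({a, c, e} : Finset V) := by rw [← this]; simp
      simp only [mem_insert, mem_singleton] at hz
      rcases hz with h | h | h
      · exact ab h.symm
      · exact bc h
      · exact be h
    have mem_of : ∀ {S T : Finset V} (x : V), x ∈ S → x ∉ T → S ≠ T := by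
      rintro S T x h h' rfl; exact h' h
    apply hs 4 (by norm_num) le_rfl
      {({a, b, e} : Finset V), {c, d, e}, {a, c, f}, {b, d, f}}
    · intro T; simp only [mem_insert, mem_singleton]
      rintro (rfl | rfl | rfl | rfl) <;> assumption
    · refine ⟨?_, ?_, ?_⟩
      · rw [Finset.card_insert_of_notMem, Finset.card_insert_of_notMem, Finset.card_pair]
        · exact mem_of a (by simp) (by simp; tauto)
        · simp only [mem_insert, mem_singleton, not_or]
          exact ⟨mem_of e (by simp) (by simp; tauto), mem_of c (by simp) (by simp; tauto)⟩
        · simp only [mem_insert, mem_singleton, not_or]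
          exact ⟨mem_of a (by simp) (by simp; tauto), mem_of b (by simp) (by simp; tauto),
            mem_of a (by simp) (by simp; tauto)⟩
      · intro T; simp only [mem_insert, mem_singleton]
        rintro (rfl | rfl | rfl | rfl) <;> exact hB.1 _ (by assumption)
      · have : ({({a, b, e} : Finset V), {c, d, e}, {a, c, f}, {b, d, f}} :
            Finset (Finset V)).sup id = {a, b, c, d, e, f} := by
          ext x; simp; tauto
        rw [this]
        rw [Finset.card_insert_of_notMem, Finset.card_insert_of_notMem,
          Finset.card_insert_of_notMem, Finset.card_insert_of_notMem, Finset.card_pair ef] <;>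
          simp only [mem_insert, mem_singleton, not_or]
        · exact ⟨de, df⟩
        · exact ⟨cd, ce, cf⟩
        · exact ⟨bc, bd, be, bf⟩
        · exact ⟨ab, ac, had, ae, af⟩

/-- The number of points of a Steiner triple system. -/
theorem sts_mod {v : ℕ} (hv : 0 < v) {B : Finset (Finset (Fin v))} (hB : IsSTS B) :
    v % 6 = 1 ∨ v % 6 = 3 := by
  have h1 : v * v - v = 6 * B.card := by
    have e : (univ : Finset (Fin v)).offDiag = B.biUnion (fun T => T.offDiag) := by
      ext ⟨x, y⟩
      simp only [mem_offDiag, mem_univ, true_and, mem_biUnion]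
      constructor
      · intro h
        obtain ⟨T, ⟨hT, hx, hy⟩, -⟩ := hB.2 x y h
        exact ⟨T, hT, hx, hy, h⟩
      · rintro ⟨T, -, -, -, h⟩; exact h
    have e2 := congrArg Finset.card e
    rw [Finset.offDiag_card, Finset.card_biUnion] at e2
    · simp only [Finset.card_univ, Fintype.card_fin] at e2
      rw [e2, Finset.sum_congr rfl (g := fun _ => 6), Finset.sum_const]
      · simp [mul_comm]
      · intro T hT
        rw [Finset.offDiag_card, hB.1 T hT]
    · intro S hS T hT hne
      rw [Function.onFun, Finset.disjoint_left]
      rintro ⟨x, y⟩ hx hy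
      simp only [mem_offDiag] at hx hy
      obtain ⟨U, -, hU⟩ := hB.2 x y hx.2.2
      exact hne ((hU S ⟨hS, hx.1, hx.2.1⟩).trans (hU T ⟨hT, hy.1, hy.2.1⟩).symm)
  have h2 : ∃ r, v - 1 = 2 * r := by
    let x : Fin v := ⟨0, hv⟩
    refine ⟨(B.filter (fun T => x ∈ T)).card, ?_⟩
    have e : (univ : Finset (Fin v)).erase x =
        (B.filter (fun T => x ∈ T)).biUnion (fun T => T.erase x) := by
      ext y
      simp only [mem_erase, mem_univ, and_true, mem_biUnion, mem_filter]
      constructor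
      · intro h
        obtain ⟨T, ⟨hT, hx, hy⟩, -⟩ := hB.2 x y (Ne.symm h)
        exact ⟨T, ⟨hT, hx⟩, h, hy⟩
      · rintro ⟨T, -, h, -⟩; exact h
    have e2 := congrArg Finset.card e
    rw [Finset.card_erase_of_mem (mem_univ _), Finset.card_biUnion] at e2
    · simp only [Finset.card_univ, Fintype.card_fin] at e2
      rw [e2, Finset.sum_congr rfl (g := fun _ => 2), Finset.sum_const]
      · simp [mul_comm]
      · intro T hT
        rw [mem_filter] at hT
        rw [Finset.card_erase_of_mem hT.2, hB.1 T hT.1]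
    · intro S hS T hT hne
      rw [Function.onFun, Finset.disjoint_left]
      intro y hy hy'
      simp only [mem_erase, mem_coe, mem_filter] at hy hy' hS hT
      obtain ⟨U, -, hU⟩ := hB.2 x y (Ne.symm hy.1)
      exact hne ((hU S ⟨hS.1, hS.2, hy.2⟩).trans (hU T ⟨hT.1, hT.2, hy'.2⟩).symm)
  obtain ⟨r, hr⟩ := h2
  have hv2 : v = 2 * r + 1 := by omega
  have h3 : 2 * r * (2 * r + 1) = 6 * B.card := by
    rw [← h1, hv2]
    have : (2 * r + 1) * (2 * r + 1) = 2 * r * (2 * r + 1) + (2 * r + 1) := by ring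
    omega
  have h4 : r % 3 = 0 ∨ r % 3 = 1 := by
    have h5 : (2 * r * (2 * r + 1)) % 3 = 0 := by omega
    rw [Nat.mul_mod, Nat.mul_mod 2 r, Nat.add_mod, Nat.mul_mod 2 r] at h5
    have : r % 3 < 3 := Nat.mod_lt _ (by norm_num)
    interval_cases hr3 : r % 3 <;> simp_all
  omega


/-! ### Direct products -/

theorem APR.np' {V : Type*} {R : V → V → V → Prop} (h : APR R) (a b c d e f : V)
    (h1 : R a b e ∨ (a = b ∧ b = e)) (h2 : R c d e ∨ (c = d ∧ d = e))
    (h3 : R a c f ∨ (a = c ∧ c = f)) (h4 : R b d f ∨ (b = d ∧ d = f)) : a = d := by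
  have s12 := h.s12
  have s23 := h.s23
  have ne := h.ne
  have uq := h.uq
  have np := h.np
  rcases h1 with h1 | ⟨h1, h1'⟩ <;> rcases h2 with h2 | ⟨h2, h2'⟩ <;>
    rcases h3 with h3 | ⟨h3, h3'⟩ <;> rcases h4 with h4 | ⟨h4, h4'⟩ <;> grind

theorem APS.prod {V W : Type*} (hV : APS V) (hW : APS W) : APS (V × W) := by
  obtain ⟨R, h⟩ := hV
  obtain ⟨S, k⟩ := hW
  refine ⟨fun p q r => p ≠ q ∧ (R p.1 q.1 r.1 ∨ (p.1 = q.1 ∧ q.1 = r.1)) ∧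
    (S p.2 q.2 r.2 ∨ (p.2 = q.2 ∧ q.2 = r.2)), ?_, ?_, ?_, ?_, ?_, ?_⟩
  · rintro ⟨x, a⟩ ⟨y, b⟩ ⟨z, c⟩ ⟨h1, h2, h3⟩
    have := h.s12 x y z
    have := k.s12 a b c
    grind
  · rintro ⟨x, a⟩ ⟨y, b⟩ ⟨z, c⟩ ⟨h1, h2, h3⟩
    have := h.s23 x y z
    have := k.s23 a b c
    have := h.ne x z y
    have := k.ne a c b
    grind
  · rintro ⟨x, a⟩ ⟨y, b⟩ ⟨z, c⟩ ⟨h1, h2, h3⟩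
    exact h1
  · rintro ⟨x, a⟩ ⟨y, b⟩ hne
    have e1 : ∃ z, R x y z ∨ (x = y ∧ y = z) := by
      by_cases hxy : x = y
      · exact ⟨x, Or.inr ⟨hxy, hxy.symm⟩⟩
      · obtain ⟨z, hz⟩ := h.ex x y hxy
        exact ⟨z, Or.inl hz⟩
    have e2 : ∃ z, S a b z ∨ (a = b ∧ b = z) := by
      by_cases hxy : a = b
      · exact ⟨a, Or.inr ⟨hxy, hxy.symm⟩⟩
      · obtain ⟨z, hz⟩ := k.ex a b hxy
        exact ⟨z, Or.inl hz⟩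
    obtain ⟨z, hz⟩ := e1
    obtain ⟨c, hc⟩ := e2
    exact ⟨(z, c), hne, hz, hc⟩
  · rintro ⟨x, a⟩ ⟨y, b⟩ ⟨z, c⟩ ⟨w, d⟩ ⟨h1, h2, h3⟩ ⟨g1, g2, g3⟩
    have := h.uq x y z w
    have := k.uq a b c d
    have := h.ne x y
    have := k.ne a b
    grind
  · rintro ⟨a, a'⟩ ⟨b, b'⟩ ⟨c, c'⟩ ⟨d, d'⟩ ⟨e, e'⟩ ⟨f, f'⟩ ⟨-, h1, g1⟩ ⟨-, h2, g2⟩ ⟨-, h3, g3⟩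
      ⟨-, h4, g4⟩
    exact Prod.ext (h.np' a b c d e f h1 h2 h3 h4) (k.np' a' b' c' d' e' f' g1 g2 g3 g4)

/-! ### Cyclic systems -/

/-- Evaluate a natural number before passing it on. -/
def force {α : Type} (x : ℕ) (k : ℕ → α) : α :=
  Nat.rec (k 0) (fun n _ => k (n + 1)) x

theorem force_eq {α : Type} (x : ℕ) (k : ℕ → α) : force x k = k x := by
  cases x <;> rfl

/-- Entry number `d` of a table packed into a natural number. -/
def tget (T d : ℕ) : ℕ := T / 2 ^ (11 * d) % 2048

/-- `∀ d < k, p d`. -/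
def allB (p : ℕ → Bool) (k : ℕ) : Bool :=
  Nat.rec true (fun n ih => bif p n then ih else false) k

theorem allB_spec {p : ℕ → Bool} {k : ℕ} (h : allB p k = true) : ∀ d < k, p d = true := by
  induction k with
  | zero => intro d hd; omega
  | succ n ih =>
    intro d hd
    have h' : (bif p n then allB p n else false) = true := h
    cases hp : p n with
    | false => simp [hp] at h'
    | true =>
      simp [hp] at h'
      rcases Nat.lt_succ_iff_lt_or_eq.1 hd with h1 | rfl
      · exact ih h' d h1
      · exact hp

def cycChk1 (v h T d : ℕ) : Bool :=
  force (tget T d) fun e =>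
    Nat.ble (e + 1) v && (Nat.beq (tget T (v - d)) ((e + v - d) % v) || Nat.beq d 0) &&
    Nat.beq (tget T e) d && Nat.beq (tget T (h * d % v)) (h * e % v)

def cycChk2 (v T b e c : ℕ) : Bool :=
  force ((c + tget T ((e + v - c) % v)) % v) fun d =>
    Nat.beq d 0 || Nat.beq c e ||
      !(Nat.beq ((b + tget T ((d + v - b) % v)) % v) (tget T c))

def cycOrb (v h T : ℕ) : ℕ → ℕ → ℕ → ℕ
  | 0, _, m => m
  | k + 1, x, m =>
    force (tget T x) fun e => force (tget T (v - x)) fun e' => force (tget T (v - e)) fun e'' =>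
      force (h * x % v) fun x' =>
        force (m ||| 2 ^ x ||| 2 ^ e ||| 2 ^ (v - x) ||| 2 ^ e' ||| 2 ^ (v - e) ||| 2 ^ e'') fun m' =>
          cycOrb v h T k x' m'

def cycMask (v h o T : ℕ) : List ℕ → ℕ → ℕ
  | [], m => m
  | b :: l, m => force (cycOrb v h T o b m) fun m' => cycMask v h o T l m'

def cycChk (v h o T : ℕ) (reps : List ℕ) : Bool :=
  Nat.ble 2 v && Nat.beq (Nat.gcd h v) 1 && Nat.beq (tget T 0) 0 && allB (cycChk1 v h T) v &&
  reps.all (fun b => Nat.ble 1 b && Nat.ble (b + 1) v &&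
    force (tget T b) fun e => allB (cycChk2 v T b e) v) &&
  Nat.beq (cycMask v h o T reps 1) (2 ^ v - 1)

/-- Add the six table entries of a base block. -/
def cycPut (v d x T : ℕ) : ℕ :=
  let p := fun (i j : ℕ) => j * 2 ^ (11 * i)
  T + p d x + p x d + p (v - d) ((x + v - d) % v) + p ((x + v - d) % v) (v - d) +
    p (v - x) ((d + v - x) % v) + p ((d + v - x) % v) (v - x)

def cycTabO (v h : ℕ) : ℕ → ℕ → ℕ → ℕ → ℕ
  | 0, _, _, T => T
  | k + 1, d, x, T => force (cycPut v d x T) fun T' => force (h * d % v) fun d' =>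
      force (h * x % v) fun x' => cycTabO v h k d' x' T'

/-- Blocks are triples `d, x, k` where `k` is the length of the orbit under multiplication. -/
def cycTab (v h : ℕ) : List (ℕ × ℕ × ℕ) → ℕ → ℕ
  | [], T => T
  | (d, x, k) :: l, T => force (cycTabO v h k d x T) fun T' => cycTab v h l T'

def cycT0 (v : ℕ) : ℕ :=
  bif Nat.beq (v % 6) 3 then (2 * (v / 3)) * 2 ^ (11 * (v / 3)) +
    (v / 3) * 2 ^ (11 * (2 * (v / 3))) else 0

def cycFull (v h o : ℕ) (bl : List (ℕ × ℕ × ℕ)) : Bool :=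
  force (cycTab v h bl (cycT0 v)) fun T =>
    cycChk v h o T (bif Nat.beq (v % 6) 3 then v / 3 :: bl.map Prod.fst else bl.map Prod.fst)

/-- No Pasch configuration contains the block through `0` and `b`. -/
def PF {v : ℕ} (f : ZMod v → ZMod v) (b : ZMod v) : Prop :=
  ∀ c d, c ≠ f b → d = c + f (f b - c) → c ≠ 0 → d ≠ 0 → b + f (d - b) ≠ f c

theorem cyc_aps_aux {v : ℕ} (f : ZMod v → ZMod v) (f0 : f 0 = 0)
    (f1 : ∀ d, f (-d) = f d - d) (f2 : ∀ d, f (f d) = d)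
    (np : ∀ b, b ≠ 0 → PF f b) : APS (ZMod v) := by
  have f3 : ∀ d, f d = 0 → d = 0 := by
    intro d hd
    have := f2 d
    rw [hd, f0] at this
    exact this.symm
  refine ⟨fun x y z => x ≠ y ∧ z = x + f (y - x), ?_, ?_, ?_, ?_, ?_, ?_⟩
  · rintro x y z ⟨h1, h2⟩
    refine ⟨h1.symm, ?_⟩
    rw [h2, ← neg_sub y x, f1]; ring
  · rintro x y z ⟨h1, h2⟩
    have e : z - x = f (y - x) := by rw [h2]; ring
    refine ⟨?_, ?_⟩
    · rintro rfl
      rw [sub_self] at e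
      exact h1 (sub_eq_zero.1 (f3 _ e.symm)).symm
    · rw [e, f2]; ring
  · rintro x y z ⟨h1, h2⟩; exact h1
  · intro x y hxy; exact ⟨_, hxy, rfl⟩
  · rintro x y z w ⟨h1, h2⟩ ⟨h3, h4⟩; rw [h2, h4]
  · rintro a b c d e g ⟨h1, h2⟩ ⟨h3, h4⟩ ⟨h5, h6⟩ ⟨h7, h8⟩
    by_contra had
    refine np (b - a) (sub_ne_zero.2 h1.symm) (c - a) (d - a) ?_ ?_ (sub_ne_zero.2 h5.symm)
      (sub_ne_zero.2 (Ne.symm had)) ?_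
    · intro hh
      have : e - c = 0 := by rw [h2, ← hh]; ring
      have h9 : e - c = f (d - c) := by rw [h4]; ring
      rw [this] at h9
      exact h3 (sub_eq_zero.1 (f3 _ h9.symm)).symm
    · have h9 : e - c = f (d - c) := by rw [h4]; ring
      have : f (b - a) - (c - a) = e - c := by rw [h2]; ring
      rw [this, h9, f2]; ring
    · have : d - a - (b - a) = d - b := by ring
      rw [this]
      have h9 : a + f (c - a) = b + f (d - b) := by rw [← h6, ← h8]
      linear_combination -h9

theorem PF.f {v : ℕ} {f : ZMod v → ZMod v} (f0 : f 0 = 0)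
    (f1 : ∀ d, f (-d) = f d - d) (f2 : ∀ d, f (f d) = d) {b : ZMod v} (h : PF f b) :
    PF f (f b) := by
  intro c d h1 h2 h3 h4 h5
  rw [f2] at h1 h2
  refine h (f c) d ?_ ?_ ?_ h4 ?_
  · intro hh; apply h1; rw [← f2 c, hh, f2]
  · have e1 : f c - f b = f (d - f b) := by rw [← h5]; ring
    have e2 : f (f b - f c) = f (f c - f b) - (f c - f b) := by rw [← f1]; congr 1; ring
    rw [e2, e1, f2, ← e1]; ring
  · intro hh; apply h3; rw [← f2 c, hh, f0]
  · have e1 : d - b = f (c - b) := by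
      rw [h2, ← neg_sub b c, f1]; ring
    rw [e1, f2, f2]; ring

theorem PF.neg {v : ℕ} {f : ZMod v → ZMod v} (f0 : f 0 = 0)
    (f1 : ∀ d, f (-d) = f d - d) (f2 : ∀ d, f (f d) = d) {b : ZMod v} (h : PF f b) :
    PF f (-b) := by
  intro c' d' h1 h2 h3 h4 h5
  rw [f1] at h1 h2
  have f3 : ∀ d, f d = 0 → d = 0 := by
    intro d hd
    have := f2 d
    rw [hd, f0] at this
    exact this.symm
  refine h (d' + b) (c' + b) ?_ ?_ ?_ ?_ ?_
  · intro hh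
    have e1 : f (f b - b - c') = f b - b - c' := by
      have h2' : d' = c' + f (f b - b - c') := h2
      linear_combination hh - h2'
    have e2 : f (-(f b - b - c')) = 0 := by rw [f1, e1]; ring
    apply h1
    linear_combination f3 _ e2
  · have e1 : f b - (d' + b) = -(f (f b - b - c') - (f b - b - c')) := by rw [h2]; ring
    rw [e1, ← f1, f1, f2, f1, h2]; ring
  · intro hh
    have e1 : -b - d' = 0 := by linear_combination -hh
    have e2 : f (d' - -b) = 0 := by rw [← f0]; congr 1; linear_combination -e1
    rw [e2] at h5
    apply h1
    rw [← f1, ← sub_eq_zero, ← f2 c', ← h5]; ring_nf; 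
  · intro hh
    apply h4
    have e1 : c' = -b := by linear_combination hh
    rw [h2, e1]
    have e2 : f b - b - -b = f b := by ring
    rw [e2, f2]; ring
  · have e1 : c' + b - b = c' := by ring
    have e2 : d' - -b = d' + b := by ring
    rw [e1, ← h5, e2]; ring

theorem PF.mul {v : ℕ} {f : ZMod v → ZMod v} {t t' : ZMod v} (ht : t * t' = 1)
    (f3 : ∀ d, f (t * d) = t * f d) {b : ZMod v} (h : PF f b) : PF f (t * b) := by
  have f3' : ∀ d, f (t' * d) = t' * f d := by
    intro d
    have := f3 (t' * d)
    rw [← mul_assoc, ht, one_mul] at this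
    rw [this, ← mul_assoc, mul_comm t' t, ht, one_mul]
  intro c d h1 h2 h3 h4 h5
  have cancel : ∀ x, t' * x = 0 → x = 0 := by
    intro x hx
    have : t * (t' * x) = 0 := by rw [hx, mul_zero]
    rwa [← mul_assoc, ht, one_mul] at this
  refine h (t' * c) (t' * d) ?_ ?_ ?_ ?_ ?_
  · intro hh
    apply h1
    rw [f3, ← hh, ← mul_assoc, ht, one_mul]
  · have e : f b - t' * c = t' * (f (t * b) - c) := by
      rw [f3]; linear_combination (-f b) * ht
    rw [e, f3', h2]; ring
  · intro hh; exact h3 (cancel _ hh)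
  · intro hh; exact h4 (cancel _ hh)
  · have e : t' * d - b = t' * (d - t * b) := by linear_combination b * ht
    rw [e, f3', f3', ← h5]; linear_combination (-b) * ht

theorem cyc_aps {v h o T : ℕ} {reps : List ℕ} (hc : cycChk v h o T reps = true) :
    APS (ZMod v) := by
  simp only [cycChk, Bool.and_eq_true, Nat.ble_eq, Nat.beq_eq, List.all_eq_true, force_eq] at hc
  obtain ⟨⟨⟨⟨⟨hv, hg⟩, hT0⟩, hA⟩, hR⟩, hM⟩ := hc
  have : NeZero v := ⟨by omega⟩
  have hA1 := allB_spec hA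
  simp only [cycChk1, force_eq, Bool.and_eq_true, Bool.or_eq_true, Nat.ble_eq, Nat.beq_eq] at hA1
  let f : ZMod v → ZMod v := fun d => (tget T d.val : ZMod v)
  have fn : ∀ k : ℕ, f (k : ZMod v) = (tget T (k % v) : ZMod v) := by
    intro k; simp only [f, ZMod.val_natCast]
  have fl : ∀ k : ℕ, k < v → f (k : ZMod v) = (tget T k : ZMod v) := by
    intro k hk; rw [fn, Nat.mod_eq_of_lt hk]
  have rep : ∀ d : ZMod v, ∃ k < v, d = (k : ZMod v) := fun d =>
    ⟨d.val, ZMod.val_lt d, (ZMod.natCast_zmod_val d).symm⟩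
  have vz : ((v : ℕ) : ZMod v) = 0 := ZMod.natCast_self v
  have subc : ∀ a b : ℕ, b ≤ v → ((a + v - b : ℕ) : ZMod v) = a - b := by
    intro a b hb
    rw [Nat.cast_sub (by omega), Nat.cast_add, vz, add_zero]
  have f0 : f 0 = 0 := by
    have := fl 0 (by omega)
    rw [hT0] at this
    simpa using this
  have f1 : ∀ d, f (-d) = f d - d := by
    intro d
    obtain ⟨k, hk, rfl⟩ := rep d
    rcases Nat.eq_zero_or_pos k with rfl | hk0
    · simp [f0]
    · have h1 := (hA1 k hk).1.1.2
      have e : -(k : ZMod v) = ((v - k : ℕ) : ZMod v) := by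
        rw [Nat.cast_sub hk.le, vz, zero_sub]
      rw [e, fl _ (by omega), fl _ hk]
      rcases h1 with h1 | h1
      · rw [h1, ZMod.natCast_mod, subc _ _ hk.le]
      · omega
  have f2 : ∀ d, f (f d) = d := by
    intro d
    obtain ⟨k, hk, rfl⟩ := rep d
    have h1 := (hA1 k hk)
    rw [fl k hk, fl _ (by omega), h1.1.2]
  have f3 : ∀ d, f ((h : ZMod v) * d) = h * f d := by
    intro d
    obtain ⟨k, hk, rfl⟩ := rep d
    rw [← Nat.cast_mul, fn, (hA1 k hk).2, fl k hk, ZMod.natCast_mod, Nat.cast_mul]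
  have hu : (h : ZMod v) * (h : ZMod v)⁻¹ = 1 := ZMod.coe_mul_inv_eq_one h hg
  have pfneg : ∀ k : ℕ, k ≤ v → PF f k → PF f ((v - k : ℕ) : ZMod v) := by
    intro k hk hp
    rw [Nat.cast_sub hk, vz, zero_sub]
    exact PF.neg f0 f1 f2 hp
  have pff : ∀ k : ℕ, k < v → PF f k → PF f (tget T k : ZMod v) := by
    intro k hk hp
    rw [← fl k hk]
    exact PF.f f0 f1 f2 hp
  have tp : ∀ k : ℕ, 0 < k → k < v → 0 < tget T k := by
    intro k hk hk'
    rcases Nat.eq_zero_or_pos (tget T k) with h0 | h0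
    · have := (hA1 k hk').1.2
      rw [h0, hT0] at this
      omega
    · exact h0
  have orb : ∀ k x m, 0 < x → x < v → PF f (x : ZMod v) →
      ∀ d, (cycOrb v h T k x m).testBit d = true → m.testBit d = true ∨ PF f (d : ZMod v) := by
    intro k
    induction k with
    | zero => intro x m _ _ _ d hd; exact Or.inl hd
    | succ k ih =>
      intro x m hx0 hx hp d hd
      simp only [cycOrb, force_eq] at hd
      have hx' : 0 < h * x % v := by
        rcases Nat.eq_zero_or_pos (h * x % v) with h0 | h0
        · have h1 : v ∣ h * x := Nat.dvd_of_mod_eq_zero h0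
          have h2 : v ∣ x := (Nat.Coprime.symm hg).dvd_of_dvd_mul_left h1
          exact absurd (Nat.le_of_dvd hx0 h2) (by omega)
        · exact h0
      have hp' : PF f ((h * x % v : ℕ) : ZMod v) := by
        rw [ZMod.natCast_mod, Nat.cast_mul]
        exact PF.mul hu f3 hp
      have q1 := pff x hx hp
      have q2 := pfneg x hx.le hp
      have q3 := pff (v - x) (by omega) q2
      have e1 : tget T x < v := by have := (hA1 x hx).1.1.1; omega
      have q4 := pfneg _ e1.le q1
      have q5 := pff (v - tget T x) (by have := tp x hx0 hx; omega) q4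
      rcases ih _ _ hx' (Nat.mod_lt _ (by omega)) hp' d hd with h1 | h1
      · simp only [Nat.testBit_or, Bool.or_eq_true, Nat.testBit_two_pow, decide_eq_true_eq] at h1
        rcases h1 with (((((h1 | rfl) | rfl) | rfl) | rfl) | rfl) | rfl
        · exact Or.inl h1
        all_goals right; assumption
      · exact Or.inr h1
  have msk : ∀ (l : List ℕ) m, (∀ b ∈ l, 0 < b ∧ b < v ∧ PF f (b : ZMod v)) →
      ∀ d, (cycMask v h o T l m).testBit d = true → m.testBit d = true ∨ PF f (d : ZMod v) := by
    intro l
    induction l with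
    | nil => intro m _ d hd; exact Or.inl hd
    | cons b l ih =>
      intro m hl d hd
      simp only [cycMask, force_eq] at hd
      rcases ih _ (fun b' hb' => hl b' (List.mem_cons_of_mem _ hb')) d hd with h1 | h1
      · obtain ⟨g1, g2, g3⟩ := hl b List.mem_cons_self
        exact orb _ _ _ g1 g2 g3 d h1
      · exact Or.inr h1
  apply cyc_aps_aux f f0 f1 f2
  intro b hb
  obtain ⟨k, hk, rfl⟩ := rep b
  have hfin := msk reps 1 ?_ k ?_
  · rcases hfin with h1 | h1
    · have : k = 0 := by
        have : (2 ^ 0).testBit k = true := by simpa using h1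
        rw [Nat.testBit_two_pow] at this
        simp only [decide_eq_true_eq] at this
        omega
      subst this
      simp at hb
    · exact h1
  · intro b hb
    obtain ⟨⟨g1, g2⟩, g3⟩ := hR b hb
    refine ⟨g1, g2, ?_⟩
    have g4 := allB_spec g3
    simp only [cycChk2, force_eq, Bool.or_eq_true, Nat.beq_eq, Bool.not_eq_true'] at g4
    intro c d h1 h2 h3 h4 h5
    obtain ⟨c, hcv, rfl⟩ := rep c
    have ev : tget T b < v := by have := (hA1 b g2).1.1.1; omega
    rw [fl b g2] at h1 h2
    have e1 : d = (((c + tget T ((tget T b + v - c) % v)) % v : ℕ) : ZMod v) := by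
      rw [h2, ZMod.natCast_mod, Nat.cast_add, ← fn, subc _ _ hcv.le]
    rcases g4 c hcv with (g | g) | g
    · rw [e1, g] at h4; simp at h4
    · rw [g] at h1; exact h1 rfl
    · rw [e1, fl c hcv] at h5
      rw [← subc _ _ (by omega), fn, ← Nat.cast_add] at h5
      have h6 := congrArg ZMod.val h5
      rw [ZMod.val_natCast, ZMod.val_cast_of_lt (by have := (hA1 c hcv).1.1.1; omega)] at h6
      rw [h6] at g
      simp at g
  · rw [hM, Nat.testBit_two_pow_sub_one]
    simpa using hk

theorem cyc_full {v h o : ℕ} {bl : List (ℕ × ℕ × ℕ)} (hc : cycFull v h o bl = true) :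
    APS (Fin v) := by
  simp only [cycFull, force_eq] at hc
  have h1 := cyc_aps hc
  cases v with
  | zero => simp [cycChk] at hc
  | succ n => exact h1

theorem aps_19 : APS (Fin 19) :=
  cyc_full (v := 19) (h := 4) (o := 9) (bl := [(1, 12, 3)])
    (by decide +kernel)

theorem aps_21 : APS (Fin 21) :=
  cyc_full (v := 21) (h := 1) (o := 1) (bl := [(1, 12, 1), (2, 6, 1), (3, 8, 1)])
    (by decide +kernel)

theorem aps_25 : APS (Fin 25) :=
  cyc_full (v := 25) (h := 1) (o := 1) (bl := [(1, 19, 1), (2, 12, 1), (3, 17, 1), (4, 9, 1)])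
    (by decide +kernel)

theorem aps_31 : APS (Fin 31) :=
  cyc_full (v := 31) (h := 5) (o := 3) (bl := [(1, 21, 3), (3, 18, 1), (8, 17, 1)])
    (by decide +kernel)

theorem aps_37 : APS (Fin 37) :=
  cyc_full (v := 37) (h := 10) (o := 3) (bl := [(1, 23, 3), (3, 19, 3)])
    (by decide +kernel)

theorem aps_43 : APS (Fin 43) :=
  cyc_full (v := 43) (h := 9) (o := 21) (bl := [(1, 7, 7)])
    (by decide +kernel)

theorem aps_49 : APS (Fin 49) :=
  cyc_full (v := 49) (h := 18) (o := 3) (bl := [(1, 19, 1), (2, 43, 3), (4, 28, 3), (12, 29, 1)])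
    (by decide +kernel)

theorem aps_55 : APS (Fin 55) :=
  cyc_full (v := 55) (h := 1) (o := 1) (bl := [(1, 11, 1), (2, 36, 1), (3, 51, 1), (5, 42, 1), (6, 30, 1), (8, 41, 1), (9, 29, 1), (12, 28, 1), (15, 38, 1)])
    (by decide +kernel)

theorem aps_61 : APS (Fin 61) :=
  cyc_full (v := 61) (h := 9) (o := 5) (bl := [(1, 8, 5), (4, 39, 5)])
    (by decide +kernel)

theorem aps_67 : APS (Fin 67) :=
  cyc_full (v := 67) (h := 4) (o := 33) (bl := [(1, 30, 11)])
    (by decide +kernel)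

theorem aps_73 : APS (Fin 73) :=
  cyc_full (v := 73) (h := 8) (o := 3) (bl := [(1, 16, 3), (3, 48, 3), (4, 36, 1), (7, 29, 3), (12, 50, 1), (14, 34, 1)])
    (by decide +kernel)

theorem aps_79 : APS (Fin 79) :=
  cyc_full (v := 79) (h := 8) (o := 13) (bl := [(1, 29, 13)])
    (by decide +kernel)

theorem aps_85 : APS (Fin 85) :=
  cyc_full (v := 85) (h := 1) (o := 1) (bl := [(1, 44, 1), (2, 74, 1), (3, 31, 1), (4, 77, 1), (5, 58, 1), (6, 24, 1), (7, 59, 1), (9, 39, 1), (10, 35, 1), (14, 65, 1), (15, 64, 1), (16, 38, 1), (17, 40, 1), (19, 56, 1)])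
    (by decide +kernel)

theorem aps_91 : APS (Fin 91) :=
  cyc_full (v := 91) (h := 9) (o := 3) (bl := [(1, 65, 3), (2, 87, 3), (5, 21, 3), (8, 74, 3), (14, 47, 3)])
    (by decide +kernel)

theorem aps_97 : APS (Fin 97) :=
  cyc_full (v := 97) (h := 35) (o := 3) (bl := [(1, 65, 3), (2, 49, 3), (3, 40, 3), (5, 21, 3), (7, 74, 3), (10, 69, 1)])
    (by decide +kernel)

theorem aps_103 : APS (Fin 103) :=
  cyc_full (v := 103) (h := 8) (o := 17) (bl := [(1, 59, 17)])
    (by decide +kernel)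

theorem aps_105 : APS (Fin 105) :=
  cyc_full (v := 105) (h := 16) (o := 3) (bl := [(1, 54, 3), (2, 87, 3), (3, 43, 3), (4, 15, 3), (6, 37, 3), (7, 84, 1), (14, 56, 1)])
    (by decide +kernel)

theorem aps_109 : APS (Fin 109) :=
  cyc_full (v := 109) (h := 16) (o := 9) (bl := [(1, 13, 9), (2, 37, 9)])
    (by decide +kernel)

theorem aps_115 : APS (Fin 115) :=
  cyc_full (v := 115) (h := 1) (o := 1) (bl := [(1, 39, 1), (2, 18, 1), (3, 89, 1), (4, 62, 1), (5, 108, 1), (6, 73, 1), (8, 92, 1), (9, 45, 1), (10, 85, 1), (11, 83, 1), (13, 59, 1), (14, 68, 1), (15, 96, 1), (17, 82, 1), (20, 94, 1), (22, 66, 1), (24, 52, 1), (25, 80, 1), (27, 78, 1)])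
    (by decide +kernel)

theorem aps_121 : APS (Fin 121) :=
  cyc_full (v := 121) (h := 3) (o := 5) (bl := [(1, 101, 5), (2, 48, 5), (4, 14, 5), (8, 110, 5)])
    (by decide +kernel)

theorem aps_127 : APS (Fin 127) :=
  cyc_full (v := 127) (h := 22) (o := 9) (bl := [(1, 50, 9), (2, 114, 9), (10, 64, 3)])
    (by decide +kernel)

theorem aps_133 : APS (Fin 133) :=
  cyc_full (v := 133) (h := 11) (o := 3) (bl := [(1, 60, 3), (2, 39, 3), (3, 71, 3), (4, 114, 3), (6, 92, 3), (7, 42, 3), (9, 108, 1), (20, 46, 1), (27, 58, 1), (29, 82, 1)])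
    (by decide +kernel)

theorem aps_139 : APS (Fin 139) :=
  cyc_full (v := 139) (h := 4) (o := 69) (bl := [(1, 43, 23)])
    (by decide +kernel)

theorem aps_151 : APS (Fin 151) :=
  cyc_full (v := 151) (h := 9) (o := 25) (bl := [(1, 104, 25)])
    (by decide +kernel)

theorem aps_157 : APS (Fin 157) :=
  cyc_full (v := 157) (h := 14) (o := 13) (bl := [(1, 140, 13), (2, 73, 13)])
    (by decide +kernel)

theorem aps_169 : APS (Fin 169) :=
  cyc_full (v := 169) (h := 22) (o := 3) (bl := [(1, 58, 3), (2, 88, 3), (3, 127, 3), (5, 43, 3), (6, 102, 3), (7, 142, 3), (10, 36, 3), (12, 107, 1), (13, 150, 3), (14, 49, 3)])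
    (by decide +kernel)

theorem aps_175 : APS (Fin 175) :=
  cyc_full (v := 175) (h := 1) (o := 1) (bl := [(1, 60, 1), (2, 7, 1), (3, 120, 1), (4, 156, 1), (6, 125, 1), (8, 89, 1), (9, 138, 1), (10, 85, 1), (11, 151, 1), (12, 65, 1), (13, 148, 1), (14, 88, 1), (15, 143, 1), (16, 146, 1), (17, 108, 1), (18, 82, 1), (20, 51, 1), (21, 127, 1), (22, 63, 1), (25, 102, 1), (26, 123, 1), (28, 107, 1), (30, 139, 1), (33, 71, 1), (34, 114, 1), (39, 131, 1), (42, 99, 1), (43, 105, 1), (49, 103, 1)])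
    (by decide +kernel)

theorem aps_181 : APS (Fin 181) :=
  cyc_full (v := 181) (h := 5) (o := 15) (bl := [(1, 55, 15), (6, 18, 15)])
    (by decide +kernel)

theorem aps_187 : APS (Fin 187) :=
  cyc_full (v := 187) (h := 1) (o := 1) (bl := [(1, 48, 1), (2, 108, 1), (3, 145, 1), (4, 76, 1), (5, 95, 1), (6, 80, 1), (7, 21, 1), (8, 128, 1), (9, 162, 1), (10, 174, 1), (11, 57, 1), (12, 149, 1), (15, 52, 1), (16, 101, 1), (17, 36, 1), (18, 112, 1), (20, 82, 1), (22, 100, 1), (24, 146, 1), (26, 69, 1), (27, 123, 1), (28, 127, 1), (29, 73, 1), (30, 63, 1), (31, 70, 1), (32, 83, 1), (35, 138, 1), (40, 129, 1), (53, 121, 1), (54, 110, 1), (55, 116, 1)])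
    (by decide +kernel)

theorem aps_193 : APS (Fin 193) :=
  cyc_full (v := 193) (h := 84) (o := 3) (bl := [(1, 94, 3), (2, 152, 3), (3, 167, 3), (4, 49, 3), (5, 74, 3), (7, 146, 3), (10, 38, 3), (13, 136, 3), (14, 121, 3), (15, 82, 3), (19, 141, 1), (21, 166, 1)])
    (by decide +kernel)

theorem aps_205 : APS (Fin 205) :=
  cyc_full (v := 205) (h := 1) (o := 1) (bl := [(1, 174, 1), (2, 51, 1), (3, 97, 1), (4, 185, 1), (5, 164, 1), (6, 138, 1), (7, 40, 1), (8, 122, 1), (9, 135, 1), (10, 103, 1), (11, 48, 1), (12, 136, 1), (13, 131, 1), (14, 96, 1), (15, 59, 1), (16, 101, 1), (17, 62, 1), (18, 98, 1), (19, 55, 1), (21, 60, 1), (22, 152, 1), (23, 170, 1), (25, 52, 1), (26, 116, 1), (28, 134, 1), (29, 72, 1), (30, 68, 1), (34, 110, 1), (42, 142, 1), (47, 113, 1), (50, 128, 1), (54, 119, 1), (56, 144, 1), (57, 141, 1)])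
    (by decide +kernel)

theorem aps_211 : APS (Fin 211) :=
  cyc_full (v := 211) (h := 4) (o := 105) (bl := [(1, 197, 35)])
    (by decide +kernel)

theorem aps_217 : APS (Fin 217) :=
  cyc_full (v := 217) (h := 25) (o := 3) (bl := [(1, 21, 3), (2, 150, 3), (3, 135, 3), (4, 207, 3), (5, 18, 3), (7, 129, 3), (8, 194, 3), (15, 64, 3), (19, 48, 3), (22, 68, 3), (24, 161, 3), (37, 110, 3)])
    (by decide +kernel)

theorem aps_223 : APS (Fin 223) :=
  cyc_full (v := 223) (h := 39) (o := 3) (bl := [(1, 68, 3), (2, 28, 3), (3, 175, 3), (6, 187, 3), (7, 54, 3), (8, 45, 3), (9, 159, 3), (10, 25, 3), (12, 123, 3), (13, 151, 3), (27, 65, 3), (31, 164, 3), (53, 163, 1)])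
    (by decide +kernel)

theorem aps_229 : APS (Fin 229) :=
  cyc_full (v := 229) (h := 16) (o := 19) (bl := [(1, 25, 19), (2, 9, 19)])
    (by decide +kernel)

theorem aps_231 : APS (Fin 231) :=
  cyc_full (v := 231) (h := 64) (o := 5) (bl := [(1, 117, 5), (2, 71, 5), (3, 24, 5), (4, 10, 5), (5, 156, 5), (7, 104, 5), (11, 33, 1), (16, 35, 5), (44, 143, 1), (55, 165, 1)])
    (by decide +kernel)

theorem aps_247 : APS (Fin 247) :=
  cyc_full (v := 247) (h := 68) (o := 3) (bl := [(1, 131, 3), (2, 226, 3), (3, 20, 3), (4, 41, 3), (5, 202, 3), (6, 163, 3), (7, 19, 3), (9, 162, 3), (10, 143, 3), (14, 208, 3), (15, 134, 3), (24, 97, 1), (28, 205, 3), (34, 155, 3), (56, 144, 1)])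
    (by decide +kernel)

theorem aps_259 : APS (Fin 259) :=
  cyc_full (v := 259) (h := 100) (o := 3) (bl := [(1, 5, 3), (2, 133, 3), (3, 11, 3), (6, 45, 3), (7, 56, 3), (9, 69, 3), (10, 71, 3), (12, 169, 3), (14, 125, 3), (16, 225, 3), (17, 170, 3), (20, 144, 3), (27, 208, 3), (38, 212, 1), (48, 186, 1), (53, 173, 1), (63, 175, 1)])
    (by decide +kernel)

theorem aps_265 : APS (Fin 265) :=
  cyc_full (v := 265) (h := 1) (o := 1) (bl := [(1, 43, 1), (2, 253, 1), (3, 236, 1), (4, 191, 1), (5, 216, 1), (6, 39, 1), (7, 204, 1), (8, 165, 1), (9, 40, 1), (10, 152, 1), (11, 57, 1), (13, 189, 1), (15, 207, 1), (16, 104, 1), (17, 122, 1), (18, 63, 1), (19, 194, 1), (20, 164, 1), (21, 127, 1), (22, 154, 1), (23, 228, 1), (24, 134, 1), (25, 91, 1), (26, 212, 1), (27, 139, 1), (28, 125, 1), (30, 171, 1), (34, 200, 1), (35, 180, 1), (36, 182, 1), (38, 107, 1), (41, 190, 1), (44, 162, 1), (47, 203, 1), (48, 215, 1), (51, 201, 1),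 (52, 188, 1), (55, 185, 1), (56, 128, 1), (59, 173, 1), (67, 148, 1), (70, 172, 1), (82, 169, 1), (84, 170, 1)])
    (by decide +kernel)

theorem aps_277 : APS (Fin 277) :=
  cyc_full (v := 277) (h := 16) (o := 23) (bl := [(1, 89, 23), (2, 97, 23)])
    (by decide +kernel)

theorem aps_283 : APS (Fin 283) :=
  cyc_full (v := 283) (h := 6) (o := 141) (bl := [(1, 45, 47)])
    (by decide +kernel)

theorem aps_295 : APS (Fin 295) :=
  cyc_full (v := 295) (h := 1) (o := 1) (bl := [(1, 117, 1), (2, 214, 1), (3, 123, 1), (4, 131, 1), (5, 143, 1), (6, 141, 1), (7, 18, 1), (8, 230, 1), (9, 209, 1), (10, 33, 1), (12, 66, 1), (13, 72, 1), (14, 188, 1), (15, 252, 1), (16, 207, 1), (17, 232, 1), (19, 167, 1), (20, 55, 1), (21, 220, 1), (22, 217, 1), (24, 125, 1), (25, 133, 1), (26, 97, 1), (27, 74, 1), (28, 233, 1), (29, 210, 1), (30, 231, 1), (31, 153, 1), (32, 82, 1), (34, 137, 1), (36, 84, 1), (37, 208, 1), (38, 115, 1), (39, 216, 1), (40, 129,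 1), (41, 151, 1), (42, 134, 1), (44, 228, 1), (45, 190, 1), (46, 243, 1), (49, 119, 1), (51, 163, 1), (53, 193, 1), (56, 149, 1), (57, 156, 1), (60, 169, 1), (61, 130, 1), (68, 204, 1), (76, 182, 1)])
    (by decide +kernel)

theorem aps_301 : APS (Fin 301) :=
  cyc_full (v := 301) (h := 79) (o := 3) (bl := [(1, 271, 3), (2, 278, 3), (3, 190, 3), (4, 128, 3), (5, 196, 3), (7, 238, 3), (9, 82, 3), (10, 146, 3), (12, 138, 3), (14, 156, 3), (16, 201, 3), (18, 184, 3), (20, 274, 3), (22, 215, 3), (32, 210, 3), (33, 247, 3), (55, 170, 1), (58, 125, 1)])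
    (by decide +kernel)

theorem aps_307 : APS (Fin 307) :=
  cyc_full (v := 307) (h := 7) (o := 153) (bl := [(1, 290, 51)])
    (by decide +kernel)

theorem aps_319 : APS (Fin 319) :=
  cyc_full (v := 319) (h := 1) (o := 1) (bl := [(1, 270, 1), (2, 262, 1), (3, 295, 1), (4, 115, 1), (5, 217, 1), (6, 40, 1), (7, 160, 1), (8, 90, 1), (9, 298, 1), (10, 232, 1), (11, 71, 1), (12, 25, 1), (14, 108, 1), (15, 218, 1), (16, 77, 1), (17, 122, 1), (18, 145, 1), (19, 155, 1), (20, 284, 1), (22, 216, 1), (23, 109, 1), (26, 149, 1), (28, 185, 1), (29, 275, 1), (31, 89, 1), (32, 193, 1), (33, 202, 1), (36, 100, 1), (37, 184, 1), (38, 273, 1), (39, 163, 1), (41, 88, 1), (42, 220, 1), (43, 119, 1), (45, 189, 1), (48, 140, 1), (51, 118, 1), (52, 165, 1), (53, 148, 1), (54, 137, 1), (56, 254, 1), (62, 132, 1), (63, 244, 1), (66, 205, 1), (68, 199, 1), (69, 173, 1), (72, 168, 1), (74, 167, 1), (78, 207, 1), (79, 177, 1), (80, 186, 1), (81, 209, 1),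 (85, 228, 1)])
    (by decide +kernel)

theorem aps_331 : APS (Fin 331) :=
  cyc_full (v := 331) (h := 5) (o := 165) (bl := [(1, 32, 55)])
    (by decide +kernel)

theorem aps_355 : APS (Fin 355) :=
  cyc_full (v := 355) (h := 1) (o := 1) (bl := [(1, 281, 1), (2, 346, 1), (3, 273, 1), (4, 142, 1), (5, 120, 1), (6, 185, 1), (7, 154, 1), (8, 191, 1), (10, 132, 1), (12, 72, 1), (13, 271, 1), (14, 317, 1), (15, 239, 1), (16, 153, 1), (17, 215, 1), (18, 146, 1), (19, 41, 1), (20, 250, 1), (21, 189, 1), (23, 150, 1), (24, 165, 1), (25, 282, 1), (26, 65, 1), (27, 291, 1), (28, 238, 1), (29, 207, 1), (30, 192, 1), (31, 78, 1), (32, 268, 1), (33, 300, 1), (34, 152, 1), (35, 103, 1), (36, 299, 1), (37, 77, 1), (42, 156, 1), (43, 294, 1), (44, 143, 1), (45, 306, 1), (46, 272, 1), (48, 245, 1), (50, 108, 1), (51, 225, 1), (53, 124, 1), (54, 144, 1), (57, 289, 1), (59, 253, 1), (62, 169, 1), (63, 243, 1), (67, 206, 1), (69, 195, 1), (70, 204,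 1), (76, 276, 1), (80, 262, 1), (81, 167, 1), (89, 260, 1), (96, 255, 1), (101, 222, 1), (106, 219, 1), (109, 220, 1)])
    (by decide +kernel)

theorem aps_373 : APS (Fin 373) :=
  cyc_full (v := 373) (h := 12) (o := 31) (bl := [(1, 122, 31), (2, 8, 31)])
    (by decide +kernel)

theorem aps_385 : APS (Fin 385) :=
  cyc_full (v := 385) (h := 1) (o := 1) (bl := [(1, 260, 1), (2, 326, 1), (3, 211, 1), (4, 210, 1), (5, 93, 1), (6, 160, 1), (7, 265, 1), (8, 308, 1), (9, 141, 1), (10, 293, 1), (11, 212, 1), (12, 359, 1), (13, 358, 1), (14, 118, 1), (15, 187, 1), (16, 197, 1), (17, 136, 1), (18, 176, 1), (19, 341, 1), (20, 100, 1), (21, 97, 1), (22, 96, 1), (23, 79, 1), (24, 137, 1), (25, 83, 1), (28, 69, 1), (29, 219, 1), (30, 117, 1), (31, 278, 1), (32, 143, 1), (33, 202, 1), (34, 133, 1), (35, 240, 1), (36, 287, 1), (37, 105, 1), (39, 335, 1), (42, 276, 1), (43, 155, 1), (45, 110, 1), (46, 186, 1), (47, 193, 1), (48, 312, 1), (49,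 164, 1), (51, 301, 1), (52, 295, 1), (53, 310, 1), (54, 271, 1), (55, 284, 1), (57, 148, 1), (60, 238, 1), (62, 233, 1), (64, 226, 1), (66, 215, 1), (67, 153, 1), (70, 235, 1), (71, 262, 1), (72, 203, 1), (78, 222, 1), (81, 277, 1), (82, 282, 1), (94, 218, 1), (95, 256, 1), (106, 228, 1), (116, 255, 1)])
    (by decide +kernel)

theorem aps_397 : APS (Fin 397) :=
  cyc_full (v := 397) (h := 106) (o := 33) (bl := [(1, 116, 33), (5, 209, 33)])
    (by decide +kernel)

theorem aps_409 : APS (Fin 409) :=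
  cyc_full (v := 409) (h := 16) (o := 51) (bl := [(1, 52, 51), (7, 378, 17)])
    (by decide +kernel)

theorem aps_421 : APS (Fin 421) :=
  cyc_full (v := 421) (h := 27) (o := 35) (bl := [(1, 404, 35), (2, 257, 35)])
    (by decide +kernel)

theorem aps_427 : APS (Fin 427) :=
  cyc_full (v := 427) (h := 74) (o := 3) (bl := [(1, 157, 3), (2, 360, 3), (3, 27, 3), (4, 57, 3), (6, 106, 3), (7, 43, 3), (8, 103, 3), (9, 342, 3), (10, 76, 3), (11, 146, 3), (12, 197, 3), (13, 195, 3), (16, 249, 3), (19, 161, 3), (20, 140, 3), (21, 377, 3), (22, 366, 3), (28, 238, 3), (31, 72, 3), (37, 155, 3), (38, 147, 3), (44, 145, 3), (48, 126, 3), (54, 274, 1), (82, 337, 1)])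
    (by decide +kernel)

theorem aps_433 : APS (Fin 433) :=
  cyc_full (v := 433) (h := 3) (o := 27) (bl := [(1, 348, 27), (2, 398, 9), (4, 426, 27), (14, 259, 9)])
    (by decide +kernel)

theorem aps_463 : APS (Fin 463) :=
  cyc_full (v := 463) (h := 8) (o := 77) (bl := [(1, 157, 77)])
    (by decide +kernel)

theorem aps_481 : APS (Fin 481) :=
  cyc_full (v := 481) (h := 100) (o := 3) (bl := [(1, 182, 3), (2, 297, 3), (4, 210, 3), (5, 392, 3), (6, 149, 3), (7, 245, 3), (8, 153, 3), (9, 58, 3), (10, 384, 3), (14, 364, 3), (15, 224, 3), (16, 248, 3), (18, 120, 3), (20, 393, 3), (21, 458, 3), (22, 298, 1), (26, 416, 3), (30, 158, 3), (32, 180, 3), (33, 193, 3), (35, 345, 3), (40, 347, 3), (41, 282, 3), (42, 246, 3), (47, 407, 3), (51, 341, 1), (54, 388, 3), (56, 172, 1), (141, 330, 1), (146, 311, 1)])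
    (by decide +kernel)

theorem aps_535 : APS (Fin 535) :=
  cyc_full (v := 535) (h := 1) (o := 1) (bl := [(1, 514, 1), (2, 283, 1), (3, 237, 1), (4, 521, 1), (5, 24, 1), (6, 81, 1), (7, 361, 1), (8, 497, 1), (9, 170, 1), (10, 172, 1), (11, 187, 1), (12, 143, 1), (13, 273, 1), (15, 97, 1), (16, 117, 1), (17, 240, 1), (20, 445, 1), (23, 200, 1), (25, 99, 1), (26, 420, 1), (27, 57, 1), (28, 79, 1), (29, 316, 1), (31, 409, 1), (32, 463, 1), (33, 184, 1), (34, 303, 1), (35, 372, 1), (36, 300, 1), (37, 495, 1), (39, 306, 1), (41, 346, 1), (42, 250, 1), (43, 188, 1), (44, 100, 1), (45, 195, 1), (47, 411, 1), (48, 294, 1), (49, 473, 1), (50, 382, 1), (52, 397, 1), (53, 465, 1), (54, 210, 1), (55, 272, 1), (58, 429, 1), (59, 191, 1), (60, 207, 1), (61, 428, 1), (63, 291, 1), (64, 402, 1), (65, 401, 1), (66, 249, 1), (67, 192, 1), (68, 423, 1), (69, 380, 1), (71, 158, 1), (73, 430, 1), (76, 321, 1), (78, 339, 1), (80, 319, 1),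 (83, 334, 1), (84, 440, 1), (85, 205, 1), (86, 419, 1), (88, 299, 1), (89, 368, 1), (91, 276, 1), (92, 231, 1), (93, 386, 1), (94, 221, 1), (96, 226, 1), (98, 406, 1), (102, 277, 1), (103, 400, 1), (108, 341, 1), (109, 278, 1), (113, 393, 1), (114, 329, 1), (118, 331, 1), (119, 362, 1), (121, 265, 1), (122, 342, 1), (128, 353, 1), (136, 389, 1), (137, 349, 1), (140, 288, 1), (152, 317, 1), (154, 376, 1), (160, 369, 1)])
    (by decide +kernel)

theorem aps_547 : APS (Fin 547) :=
  cyc_full (v := 547) (h := 4) (o := 273) (bl := [(1, 41, 91)])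
    (by decide +kernel)

theorem aps_553 : APS (Fin 553) :=
  cyc_full (v := 553) (h := 23) (o := 3) (bl := [(1, 120, 3), (2, 411, 3), (3, 263, 3), (4, 258, 3), (7, 337, 3), (8, 497, 3), (10, 388, 3), (11, 47, 3), (12, 532, 3), (14, 113, 3), (15, 261, 3), (16, 116, 3), (17, 71, 3), (18, 252, 3), (20, 147, 3), (27, 271, 3), (29, 402, 3), (30, 351, 3), (31, 348, 3), (32, 172, 3), (37, 285, 3), (39, 367, 3), (41, 107, 3), (43, 280, 3), (44, 203, 3), (51, 492, 3), (58, 400, 3), (59, 340, 3), (60, 279, 1), (62, 382, 1), (83, 377, 3), (101, 212, 1), (106, 332, 1), (110, 428, 1)])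
    (by decide +kernel)

theorem aps_643 : APS (Fin 643) :=
  cyc_full (v := 643) (h := 7) (o := 321) (bl := [(1, 178, 107)])
    (by decide +kernel)

theorem aps_661 : APS (Fin 661) :=
  cyc_full (v := 661) (h := 56) (o := 55) (bl := [(1, 111, 55), (4, 148, 55)])
    (by decide +kernel)

theorem aps_673 : APS (Fin 673) :=
  cyc_full (v := 673) (h := 108) (o := 21) (bl := [(1, 534, 21), (2, 143, 21), (3, 586, 21), (5, 67, 21), (6, 401, 21), (9, 285, 7)])
    (by decide +kernel)

theorem aps_787 : APS (Fin 787) :=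
  cyc_full (v := 787) (h := 4) (o := 393) (bl := [(1, 408, 131)])
    (by decide +kernel)

theorem aps_799 : APS (Fin 799) :=
  cyc_full (v := 799) (h := 1) (o := 1) (bl := [(1, 252, 1), (2, 760, 1), (3, 706, 1), (4, 620, 1), (5, 750, 1), (6, 479, 1), (7, 246, 1), (8, 66, 1), (9, 327, 1), (10, 444, 1), (11, 513, 1), (12, 411, 1), (13, 762, 1), (14, 324, 1), (15, 681, 1), (16, 606, 1), (17, 707, 1), (18, 172, 1), (19, 336, 1), (20, 755, 1), (21, 525, 1), (22, 633, 1), (23, 759, 1), (24, 309, 1), (25, 187, 1), (26, 307, 1), (27, 445, 1), (28, 401, 1), (29, 500, 1), (30, 205, 1), (31, 394, 1), (32, 543, 1), (33, 700, 1), (34, 699, 1), (35, 202, 1), (36, 412, 1), (38, 322, 1), (42, 119, 1), (43, 435, 1), (45, 615, 1), (46, 216, 1), (47, 721, 1), (48, 535, 1), (51, 625, 1), (52, 501, 1), (53, 266, 1), (55, 346, 1), (56, 584, 1), (57, 178, 1), (59, 331, 1), (60, 698, 1), (61, 278, 1), (62, 325, 1), (65, 709, 1), (67, 470, 1), (68,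 438, 1), (69, 191, 1), (70, 662, 1), (71, 198, 1), (72, 505, 1), (73, 660, 1), (74, 186, 1), (75, 715, 1), (76, 280, 1), (79, 341, 1), (80, 323, 1), (81, 437, 1), (82, 218, 1), (83, 646, 1), (85, 571, 1), (86, 510, 1), (87, 268, 1), (88, 270, 1), (89, 520, 1), (91, 267, 1), (94, 478, 1), (95, 578, 1), (97, 254, 1), (98, 694, 1), (102, 495, 1), (103, 358, 1), (104, 446, 1), (106, 679, 1), (107, 603, 1), (108, 491, 1), (110, 410, 1), (111, 359, 1), (113, 526, 1), (114, 451, 1), (115, 676, 1), (116, 351, 1), (117, 651, 1), (124, 301, 1), (126, 367, 1), (128, 275, 1), (129, 421, 1), (130, 639, 1), (131, 277, 1), (135, 602, 1), (138, 452, 1), (140, 480, 1), (141, 568, 1), (142, 636, 1), (143, 338, 1), (144, 377, 1), (145, 600, 1), (149, 614, 1), (150, 397, 1), (151, 404, 1), (152, 599, 1), (156, 541, 1), (158, 575, 1), (164, 497, 1), (165, 379, 1), (168, 542, 1), (169, 409, 1), (171, 430, 1), (173, 484, 1), (180, 523, 1), (189, 439, 1), (190, 391, 1), (192, 419, 1),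 (194, 454, 1), (206, 450, 1), (208, 428, 1), (210, 516, 1), (211, 460, 1), (219, 442, 1), (222, 464, 1), (230, 512, 1), (232, 469, 1), (234, 530, 1), (245, 506, 1)])
    (by decide +kernel)

theorem aps_811 : APS (Fin 811) :=
  cyc_full (v := 811) (h := 5) (o := 405) (bl := [(1, 681, 135)])
    (by decide +kernel)

theorem aps_1039 : APS (Fin 1039) :=
  cyc_full (v := 1039) (h := 5) (o := 173) (bl := [(1, 335, 173)])
    (by decide +kernel)



/-! ### Nonexistence for orders 7 and 13 -/

def tix (x y z : ℕ) : ℕ := 256 * x + 16 * y + z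

def tb (T i : ℕ) : Bool := Nat.beq (T / 2 ^ i % 2) 1

theorem tb_eq (T i : ℕ) : tb T i = T.testBit i := by
  rw [Nat.testBit_eq_decide_div_mod_eq, tb, Bool.eq_iff_iff, decide_eq_true_eq, Nat.beq_eq]

def tz (T x y : ℕ) : ℕ := Nat.log2 (T / 2 ^ (256 * x + 16 * y) % 65536)

def tconf (T m x k y : ℕ) : Bool :=
  force (tz T x k) fun w => tb T (tix x k w) && Nat.ble (w + 1) m && !(Nat.beq w y)

def tpasch (T m x y k : ℕ) : Bool :=
  !(allB (fun a => force (tz T a x) fun p => force (tz T a y) fun q =>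
    !(tb T (tix a x p) && tb T (tix a y q) && tb T (tix p q k) && Nat.ble (p + 1) 16 &&
      Nat.ble (q + 1) 16 && !(Nat.beq a k))) m)

def tput (T x y k : ℕ) : ℕ :=
  T ||| 2 ^ tix x y k ||| 2 ^ tix x k y ||| 2 ^ tix y x k ||| 2 ^ tix y k x ||| 2 ^ tix k x y |||
    2 ^ tix k y x

/-- Exhaustive search; `true` means that no system exists. -/
def dfs (v : ℕ) : List (ℕ × ℕ) → ℕ → ℕ → Bool
  | [], _, _ => false
  | (x, y) :: l, m, T =>
    bif tb T (tix x y (tz T x y)) then dfs v l m T else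
    Nat.ble (x + 1) v && Nat.ble (y + 1) v && !(Nat.beq x y) &&
    force (max m (max (x + 1) (y + 1))) fun m =>
      allB (fun k => Nat.beq k x || Nat.beq k y || tconf T m x k y || tconf T m y k x ||
        tpasch T m x y k || force (tput T x y k) fun T' => force (max m (k + 1)) fun m' =>
          dfs v l m' T') (bif Nat.ble v m then m else m + 1)

structure TInv {V : Type*} (R : V → V → V → Prop) (φ : ℕ → V) (m T : ℕ) : Prop where
  inj : ∀ i < m, ∀ j < m, φ i = φ j → i = j
  blk : ∀ x < 16, ∀ y < 16, ∀ z < 16, tb T (tix x y z) = true →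
    x < m ∧ y < m ∧ z < m ∧ R (φ x) (φ y) (φ z)

theorem TInv.le {V : Type*} [Fintype V] {R : V → V → V → Prop} {φ : ℕ → V} {m T : ℕ}
    (h : TInv R φ m T) : m ≤ Fintype.card V := by
  have := Fintype.card_le_of_injective (fun i : Fin m => φ i)
    (fun i j hij => Fin.ext (h.inj _ i.2 _ j.2 hij))
  simpa using this

theorem TInv.update {V : Type*} {R : V → V → V → Prop} {φ : ℕ → V} {m T : ℕ}
    (h : TInv R φ m T) (z : V) (hz : ∀ i < m, φ i ≠ z) :
    TInv R (Function.update φ m z) (m + 1) T := by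
  have e : ∀ i, i < m → Function.update φ m z i = φ i := by
    intro i hi; rw [Function.update_of_ne (by omega)]
  constructor
  · intro i hi j hj hij
    rcases Nat.lt_succ_iff_lt_or_eq.1 hi with h1 | rfl <;>
      rcases Nat.lt_succ_iff_lt_or_eq.1 hj with h2 | rfl
    · rw [e i h1, e j h2] at hij
      exact h.inj i h1 j h2 hij
    · rw [e i h1, Function.update_self] at hij
      exact absurd hij (hz i h1)
    · rw [e j h2, Function.update_self] at hij
      exact absurd hij.symm (hz j h2)
    · rfl
  · intro x hx y hy w hw hb
    obtain ⟨h1, h2, h3, h4⟩ := h.blk x hx y hy w hw hb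
    refine ⟨by omega, by omega, by omega, ?_⟩
    rw [e x h1, e y h2, e w h3]
    exact h4

theorem TInv.extend {V : Type*} [Fintype V] {R : V → V → V → Prop} {m T : ℕ} (m' : ℕ)
    (hm : m' ≤ Fintype.card V) (h : ∃ φ : ℕ → V, TInv R φ m T) :
    ∃ φ : ℕ → V, TInv R φ (max m m') T := by
  induction m' with
  | zero => simpa using h
  | succ n ih =>
    obtain ⟨φ, hφ⟩ := ih (by omega)
    by_cases hmn : n + 1 ≤ m
    · rw [max_eq_left (by omega)] at hφ
      rw [max_eq_left hmn]
      exact ⟨φ, hφ⟩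
    · rw [max_eq_right (by omega)] at hφ
      rw [max_eq_right (by omega)]
      have : ∃ z, ∀ i < n, φ i ≠ z := by
        by_contra hcon
        push Not at hcon
        have := Fintype.card_le_of_surjective (fun i : Fin n => φ i) (by
          intro z
          obtain ⟨i, hi, hz⟩ := hcon z
          exact ⟨⟨i, hi⟩, hz⟩)
        simp at this
        omega
      obtain ⟨z, hz⟩ := this
      exact ⟨_, hφ.update z hz⟩

theorem TInv.put {V : Type*} {R : V → V → V → Prop} (hR : APR R) {φ : ℕ → V} {m T x y k : ℕ}
    (h : TInv R φ m T) (hm : m ≤ 16) (hx : x < m) (hy : y < m) (hk : k < m)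
    (hb : R (φ x) (φ y) (φ k)) : TInv R φ m (tput T x y k) := by
  refine ⟨h.inj, ?_⟩
  intro a ha b hb' c hc ht
  have b1 := hR.s12 _ _ _ hb
  have b2 := hR.s23 _ _ _ hb
  have b3 := hR.s12 _ _ _ b2
  have b4 := hR.s23 _ _ _ b1
  have b5 := hR.s12 _ _ _ b4
  have key : ∀ p q r, p < m → q < m → r < m → R (φ p) (φ q) (φ r) → tix p q r = tix a b c →
      a < m ∧ b < m ∧ c < m ∧ R (φ a) (φ b) (φ c) := by
    intro p q r hp hq hr hpqr hh
    simp only [tix] at hh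
    obtain rfl : p = a := by omega
    obtain rfl : q = b := by omega
    obtain rfl : r = c := by omega
    exact ⟨hp, hq, hr, hpqr⟩
  rw [tb_eq, tput] at ht
  simp only [Nat.testBit_or, Bool.or_eq_true, Nat.testBit_two_pow, decide_eq_true_eq] at ht
  rcases ht with (((((ht | ht) | ht) | ht) | ht) | ht) | ht
  · exact h.blk a ha b hb' c hc (by rw [tb_eq]; exact ht)
  · exact key _ _ _ hx hy hk hb ht
  · exact key _ _ _ hx hk hy b2 ht
  · exact key _ _ _ hy hx hk b1 ht
  · exact key _ _ _ hy hk hx b4 ht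
  · exact key _ _ _ hk hx hy b3 ht
  · exact key _ _ _ hk hy hx b5 ht

theorem dfs_sound {V : Type*} [Fintype V] {R : V → V → V → Prop} (hR : APR R) {v : ℕ}
    (hv : Fintype.card V = v) (hv16 : v ≤ 16) (l : List (ℕ × ℕ)) :
    ∀ m T, dfs v l m T = true → (∃ φ : ℕ → V, TInv R φ m T) → False := by
  induction l with
  | nil => intro m T h; simp [dfs] at h
  | cons p l ih =>
    obtain ⟨x, y⟩ := p
    intro m T h hφ
    simp only [dfs, force_eq] at h
    cases hc : tb T (tix x y (tz T x y)) with
    | true => rw [hc] at h; exact ih m T (by simpa using h) hφ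
    | false =>
      rw [hc] at h
      simp only [cond_false, Bool.and_eq_true, Nat.ble_eq, Bool.not_eq_true'] at h
      obtain ⟨⟨⟨h1, h2⟩, h3⟩, h4⟩ := h
      have h3 : x ≠ y := by
        intro hh
        have : Nat.beq x y = true := by rw [Nat.beq_eq]; exact hh
        rw [h3] at this
        exact absurd this (by decide)
      obtain ⟨φ, hφ⟩ := TInv.extend (max (x + 1) (y + 1)) (by omega) hφ
      generalize hM : max m (max (x + 1) (y + 1)) = M at h4 hφ
      have hxM : x < M := by omega
      have hyM : y < M := by omega
      have hMv : M ≤ v := by rw [← hv]; exact hφ.le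
      have h5 := allB_spec h4
      obtain ⟨z, hz⟩ := hR.ex (φ x) (φ y) (fun hh => h3 (hφ.inj x hxM y hyM hh))
      have hzx : z ≠ φ x := fun hh => hR.ne _ _ _ (hR.s12 _ _ _ (hR.s23 _ _ _ hz)) hh
      have hzy : z ≠ φ y := fun hh => hR.ne _ _ _
        (hR.s12 _ _ _ (hR.s23 _ _ _ (hR.s12 _ _ _ hz))) hh
      have fin : ∀ ψ : ℕ → V, ∀ k N, TInv R ψ N T → N = max M (k + 1) →
          k < (bif Nat.ble v M then M else M + 1) → R (ψ x) (ψ y) (ψ k) → False := by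
        intro ψ k N hψ hN hk hb
        have hNv : N ≤ v := by rw [← hv]; exact hψ.le
        have hkN : k < N := by omega
        have hxN : x < N := by omega
        have hyN : y < N := by omega
        have hkx : k ≠ x := by
          rintro rfl; exact hR.ne _ _ _ (hR.s23 _ _ _ hb) rfl
        have hky : k ≠ y := by
          rintro rfl; exact hR.ne _ _ _ (hR.s23 _ _ _ (hR.s12 _ _ _ hb)) rfl
        have conf : ∀ x y, x < N → y < N → R (ψ x) (ψ y) (ψ k) → tconf T M x k y = true →
            False := by
          intro x y hx hy hb ht
          simp only [tconf, force_eq, Bool.and_eq_true, Nat.ble_eq, Bool.not_eq_true'] at ht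
          obtain ⟨⟨t1, t2⟩, t3⟩ := ht
          obtain ⟨-, -, g3, g4⟩ := hψ.blk x (by omega) k (by omega) _ (by omega) t1
          have := hR.uq _ _ _ _ g4 (hR.s23 _ _ _ hb)
          have := hψ.inj _ g3 _ hy this
          have : Nat.beq (tz T x k) y = true := by rw [Nat.beq_eq]; exact this
          rw [t3] at this
          exact absurd this (by decide)
        have h6 := h5 k hk
        simp only [Bool.or_eq_true, Nat.beq_eq] at h6
        rcases h6 with ((((h6 | h6) | h6) | h6) | h6) | h6
        · exact hkx h6
        · exact hky h6
        · exact conf x y hxN hyN hb h6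
        · exact conf y x hyN hxN (hR.s12 _ _ _ hb) h6
        · simp only [tpasch, Bool.not_eq_true', force_eq] at h6
          have key : ∀ a < M, (!(tb T (tix a x (tz T a x)) && tb T (tix a y (tz T a y)) &&
              tb T (tix (tz T a x) (tz T a y) k) && Nat.ble (tz T a x + 1) 16 &&
              Nat.ble (tz T a y + 1) 16 && !(Nat.beq a k))) = true := by
            intro a ha
            by_contra hcon
            simp only [Bool.not_eq_true', Bool.not_eq_false, Bool.and_eq_true, Nat.ble_eq] at hcon
            obtain ⟨⟨⟨⟨⟨q1, q2⟩, q3⟩, q4⟩, q5⟩, q6⟩ := hcon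
            obtain ⟨ga, -, -, g1⟩ := hψ.blk a (by omega) x (by omega) _ (by omega) q1
            obtain ⟨-, -, -, g2⟩ := hψ.blk a (by omega) y (by omega) _ (by omega) q2
            obtain ⟨-, -, -, g3⟩ := hψ.blk _ (by omega) _ (by omega) k (by omega) q3
            have := hR.np (ψ k) (ψ y) (ψ (tz T a x)) (ψ a) (ψ x) (ψ (tz T a y))
              (hR.s12 _ _ _ (hR.s23 _ _ _ (hR.s12 _ _ _ hb)))
              (hR.s12 _ _ _ (hR.s23 _ _ _ g1))
              (hR.s12 _ _ _ (hR.s23 _ _ _ g3)) (hR.s12 _ _ _ g2)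
            have := hψ.inj _ hkN _ ga this
            have : Nat.beq a k = true := by rw [Nat.beq_eq]; exact this.symm
            rw [q6] at this
            exact absurd this (by decide)
          have : ∀ n ≤ M, allB (fun a => !(tb T (tix a x (tz T a x)) && tb T (tix a y (tz T a y)) &&
              tb T (tix (tz T a x) (tz T a y) k) && Nat.ble (tz T a x + 1) 16 &&
              Nat.ble (tz T a y + 1) 16 && !(Nat.beq a k))) n = true := by
            intro n
            induction n with
            | zero => intro _; rfl
            | succ n ihn =>
              intro hn
              have e := ihn (by omega)
              simp only [allB] at e ⊢
              rw [key n (by omega)]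
              exact e
          rw [this M le_rfl] at h6
          exact absurd h6 (by decide)
        · rw [← hN] at h6
          exact ih _ _ h6 ⟨ψ, hψ.put hR (by omega) hxN hyN hkN hb⟩
      by_cases hk : ∃ k < M, φ k = z
      · obtain ⟨k, hkM, rfl⟩ := hk
        refine fin φ k M hφ (by omega) ?_ hz
        cases Nat.ble v M <;> simp <;> omega
      · push Not at hk
        have hu := hφ.update z hk
        have hle : M + 1 ≤ v := by rw [← hv]; exact hu.le
        refine fin _ M (M + 1) hu (by omega) ?_ ?_
        · have : Nat.ble v M = false := by
            rw [← Bool.not_eq_true, Nat.ble_eq]; omega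
          rw [this]; simp
        · rw [Function.update_self, Function.update_of_ne (by omega), Function.update_of_ne (by omega)]
          exact hz

theorem dfs_none {v : ℕ} (hv : 0 < v) (hv16 : v ≤ 16) {l : List (ℕ × ℕ)}
    (h : dfs v l 0 0 = true) : ¬ APS (Fin v) := by
  rintro ⟨R, hR⟩
  refine dfs_sound hR (Fintype.card_fin v) hv16 l 0 0 h ⟨fun _ => ⟨0, hv⟩, ?_, ?_⟩
  · intro i hi; omega
  · intro x _ y _ z _ ht
    rw [tb_eq] at ht
    simp at ht

theorem not_aps_7 : ¬ APS (Fin 7) :=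
  dfs_none (l := [(0, 1), (0, 3), (1, 4), (0, 5), (1, 6), (0, 2), (1, 2), (0, 4), (1, 3), (2, 3),
    (2, 4), (3, 4), (1, 5), (2, 5), (3, 5), (4, 5), (0, 6), (2, 6), (3, 6), (4, 6), (5, 6)])
    (by decide) (by decide) (by decide +kernel)

theorem not_aps_13 : ¬ APS (Fin 13) :=
  dfs_none (l := [(0, 1), (0, 3), (1, 4), (0, 5), (1, 6), (0, 7), (1, 8), (0, 9), (1, 10), (0, 11),
    (1, 12), (2, 3), (2, 6), (2, 9), (2, 10), (2, 7), (2, 4), (2, 11), (2, 8), (2, 5), (3, 6),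
    (3, 10), (3, 8), (3, 7), (3, 11), (3, 5), (5, 11), (5, 9), (5, 7), (7, 11), (9, 11), (7, 9)])
    (by decide) (by decide) (by decide +kernel)


/-! ### The recursive construction -/

inductive L3 : Type
  | l0 | l1 | l2

namespace L3
/-- The multipliers attached to the three levels. -/
def c {F : Type*} [CommRing F] : L3 → F
  | l0 => 1
  | l1 => -5
  | l2 => 4
end L3

open L3

section construction

variable {F : Type*} [CommRing F]

/-- Bose type triple. -/
def bo (K : F → Prop) (c x y z : F) : Prop := x + y = 2 * z ∧ ∀ κ, K κ → x - z ≠ c * κ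

/-- Vertical triple. -/
def ve (K : F → Prop) (x y z : F) : Prop := ∃ κ, K κ ∧ y = x + κ ∧ z = x - 4 * κ

/-- Exceptional triple. -/
def ee (K : F → Prop) (c x y z : F) : Prop := x + y = 2 * z ∧ ∃ κ, K κ ∧ κ ≠ 0 ∧ x - z = c * κ

/-- Triples inside one half. -/
def SA (K : F → Prop) : L3 → F → L3 → F → L3 → F → Prop
  | l0, x, l0, y, l1, z => bo K 1 x y z
  | l0, x, l1, z, l0, y => bo K 1 x y z
  | l1, z, l0, x, l0, y => bo K 1 x y z
  | l1, x, l1, y, l2, z => bo K (-5) x y z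
  | l1, x, l2, z, l1, y => bo K (-5) x y z
  | l2, z, l1, x, l1, y => bo K (-5) x y z
  | l2, x, l2, y, l0, z => bo K 4 x y z
  | l2, x, l0, z, l2, y => bo K 4 x y z
  | l0, z, l2, x, l2, y => bo K 4 x y z
  | l0, x, l1, y, l2, z => ve K x y z
  | l0, x, l2, z, l1, y => ve K x y z
  | l1, y, l0, x, l2, z => ve K x y z
  | l1, y, l2, z, l0, x => ve K x y z
  | l2, z, l0, x, l1, y => ve K x y z
  | l2, z, l1, y, l0, x => ve K x y z
  | _, _, _, _, _, _ => False

def EE (K : F → Prop) : L3 → F → L3 → F → L3 → F → Prop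
  | l0, x, l0, y, l0, z => ee K 1 x y z
  | l1, x, l1, y, l2, z => ee K (-5) x y z
  | l2, x, l2, y, l1, z => ee K 4 x y z
  | _, _, _, _, _, _ => False

def TT {S : Type} (σ : L3 → S → F) : L3 → F → L3 → F → S ⊕ F ⊕ F → Prop
  | l0, x, l0, y, Sum.inl s => y = x + σ l0 s
  | l1, x, l2, y, Sum.inl s => y = x + σ l1 s
  | l2, x, l1, y, Sum.inl s => y = x + σ l2 s
  | l0, x, l2, y, Sum.inr (Sum.inl u) => 8 * x + y = u
  | l1, x, l1, y, Sum.inr (Sum.inl u) => 2 * x + y = u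
  | l2, x, l0, y, Sum.inr (Sum.inl u) => x + 2 * y = u
  | l0, x, l1, y, Sum.inr (Sum.inr u) => x + y = u
  | l1, x, l0, y, Sum.inr (Sum.inr u) => x + y = u
  | l2, x, l2, y, Sum.inr (Sum.inr u) => x + y = u
  | _, _, _, _, _ => False

/-- Hypotheses on the set of slopes. -/
structure GoodK (K : F → Prop) : Prop where
  zero : K 0
  neg : ∀ κ, K κ → K (-κ)
  k15 : ∀ κ, K κ → ∀ μ, K μ → 15 * (κ - μ) = 0 → κ = μ
  k25 : ∀ κ, K κ → ∀ μ, K μ → 25 * (κ - μ) = 0 → κ = μ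

structure GoodF (F : Type*) [CommRing F] : Prop where
  two : ∃ h : F, 2 * h = 1
  seven : ∃ h : F, 7 * h = 1

theorem GoodF.of2 (hF : GoodF F) {x : F} (h : 2 * x = 0) : x = 0 := by
  obtain ⟨k, hk⟩ := hF.two
  linear_combination k * h - x * hk

theorem GoodF.of7 (hF : GoodF F) {x : F} (h : 7 * x = 0) : x = 0 := by
  obtain ⟨k, hk⟩ := hF.seven
  linear_combination k * h - x * hk

theorem GoodF.can2 (hF : GoodF F) {x y : F} (h : 2 * x = 2 * y) : x = y :=
  sub_eq_zero.1 (hF.of2 (by linear_combination h))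

theorem GoodF.can7 (hF : GoodF F) {x y : F} (h : 7 * x = 7 * y) : x = y :=
  sub_eq_zero.1 (hF.of7 (by linear_combination h))

theorem GoodF.half (hF : GoodF F) (x : F) : ∃ y, x = 2 * y := by
  obtain ⟨k, hk⟩ := hF.two
  exact ⟨k * x, by linear_combination (-x) * hk⟩

theorem bo_swap {K : F → Prop} (hK : GoodK K) {c x y z : F} (h : bo K c x y z) :
    bo K c y x z := by
  refine ⟨by linear_combination h.1, fun κ hκ hh => h.2 _ (hK.neg κ hκ) ?_⟩
  linear_combination h.1 - hh

theorem ee_swap {K : F → Prop} (hK : GoodK K) {c x y z : F} (h : ee K c x y z) :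
    ee K c y x z := by
  obtain ⟨h1, κ, hκ, h0, h2⟩ := h
  refine ⟨by linear_combination h1, -κ, hK.neg κ hκ, neg_ne_zero.2 h0, ?_⟩
  linear_combination h1 - h2

theorem bo_ne (hF : GoodF F) {K : F → Prop} (hK : GoodK K) {c x y z : F} (h : bo K c x y z) :
    x ≠ y := by
  rintro rfl
  refine h.2 0 hK.zero ?_
  rw [mul_zero, sub_eq_zero]
  exact hF.can2 (by linear_combination h.1)

theorem SA_s12 {K : F → Prop} (hK : GoodK K) {i x j y k z} (h : SA K i x j y k z) :
    SA K j y i x k z := by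
  cases i <;> cases j <;> cases k <;> first | exact h | exact bo_swap hK h

theorem SA_s23 {K : F → Prop} (hK : GoodK K) {i x j y k z} (h : SA K i x j y k z) :
    SA K i x k z j y := by
  cases i <;> cases j <;> cases k <;> first | exact h | exact bo_swap hK h

theorem SA_ne (hF : GoodF F) {K : F → Prop} (hK : GoodK K) {i x y k z}
    (h : SA K i x i y k z) : x ≠ y := by
  cases i <;> cases k <;> first | exact h.elim | exact bo_ne hF hK h

theorem bo_ve0 {K : F → Prop} (hK : GoodK K) {x y z w : F} (h : bo K 1 x y z) :
    ¬ ve K x z w := by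
  rintro ⟨κ, hκ, h1, h2⟩
  exact h.2 _ (hK.neg κ hκ) (by linear_combination -h1)

theorem bo_ve1 {K : F → Prop} (hK : GoodK K) {x y z w : F} (h : bo K (-5) x y z) :
    ¬ ve K w x z := by
  rintro ⟨κ, hκ, h1, h2⟩
  exact h.2 _ (hK.neg κ hκ) (by linear_combination h1 - h2)

theorem bo_ve2 {K : F → Prop} (hK : GoodK K) {x y z w : F} (h : bo K 4 x y z) :
    ¬ ve K z w x := by
  rintro ⟨κ, hκ, h1, h2⟩
  exact h.2 _ (hK.neg κ hκ) (by linear_combination h2)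

theorem bo_u (hF : GoodF F) {K : F → Prop} {c x y z w : F} (h : bo K c x y z)
    (h' : bo K c x y w) : z = w := hF.can2 (by linear_combination h'.1 - h.1)

theorem bo_u' {K : F → Prop} {c x y z w : F} (h : bo K c x y z)
    (h' : bo K c x w z) : y = w := by linear_combination h.1 - h'.1

theorem bo_u'' {K : F → Prop} {c x y z w : F} (h : bo K c y x z)
    (h' : bo K c w x z) : y = w := by linear_combination h.1 - h'.1

theorem ve_u0 {K : F → Prop} {x y z w : F} (h : ve K x y z) (h' : ve K x y w) : z = w := by
  obtain ⟨κ, hκ, h1, h2⟩ := h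
  obtain ⟨μ, hμ, h3, h4⟩ := h'
  linear_combination h2 - h4 + 4 * h1 - 4 * h3

theorem ve_u1 (hF : GoodF F) {K : F → Prop} {x y z w : F} (h : ve K x y z) (h' : ve K x w z) :
    y = w := by
  obtain ⟨κ, hκ, h1, h2⟩ := h
  obtain ⟨μ, hμ, h3, h4⟩ := h'
  exact hF.can2 (hF.can2 (by linear_combination 4 * h1 - 4 * h3 + h2 - h4))

theorem ve_u2 {K : F → Prop} (hK : GoodK K) {x y z w : F} (h : ve K x y z) (h' : ve K w y z) :
    x = w := by
  obtain ⟨κ, hκ, h1, h2⟩ := h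
  obtain ⟨μ, hμ, h3, h4⟩ := h'
  have := hK.k15 κ hκ μ hμ (by linear_combination 3 * (-h1 + h3 + h2 - h4))
  subst this
  linear_combination h3 - h1

theorem SA_uq (hF : GoodF F) {K : F → Prop} (hK : GoodK K) {i x j y k z l w}
    (h : SA K i x j y k z) (h' : SA K i x j y l w) : k = l ∧ z = w := by
  cases i <;> cases j <;> cases k <;> first | exact h.elim | skip
  all_goals cases l <;> first | exact h'.elim | skip
  all_goals simp only [SA] at h h'
  all_goals first
    | exact ⟨rfl, bo_u hF h h'⟩
    | exact ⟨rfl, bo_u' h h'⟩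
    | exact ⟨rfl, bo_u'' h h'⟩
    | exact (bo_ve0 hK h h').elim
    | exact (bo_ve1 hK h h').elim
    | exact (bo_ve2 hK h h').elim
    | exact (bo_ve0 hK h' h).elim
    | exact (bo_ve1 hK h' h).elim
    | exact (bo_ve2 hK h' h).elim
    | exact (bo_ve0 hK (bo_swap hK h) h').elim
    | exact (bo_ve1 hK (bo_swap hK h) h').elim
    | exact (bo_ve2 hK (bo_swap hK h) h').elim
    | exact (bo_ve0 hK (bo_swap hK h') h).elim
    | exact (bo_ve1 hK (bo_swap hK h') h).elim
    | exact (bo_ve2 hK (bo_swap hK h') h).elim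
    | exact ⟨rfl, ve_u0 h h'⟩
    | exact ⟨rfl, ve_u1 hF h h'⟩
    | exact ⟨rfl, ve_u2 hK h h'⟩

theorem SA_same (hF : GoodF F) {K : F → Prop} (hK : GoodK K) (i : L3) {x y : F} (hxy : x ≠ y) :
    (∃ k z, SA K i x i y k z) ∨ ∃ z, ee K i.c x y z := by
  obtain ⟨z, hz⟩ := hF.half (x + y)
  by_cases h : ∃ κ, K κ ∧ x - z = i.c * κ
  · right
    obtain ⟨κ, h1, h2⟩ := h
    refine ⟨z, hz, κ, h1, ?_, h2⟩
    rintro rfl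
    apply hxy
    linear_combination -hz + 2 * h2
  · left
    push Not at h
    cases i
    · exact ⟨l1, z, hz, h⟩
    · exact ⟨l2, z, hz, h⟩
    · exact ⟨l0, z, hz, h⟩

theorem SA_next (hF : GoodF F) {K : F → Prop} (hK : GoodK K) (x y : F) :
    (∃ k z, SA K l0 x l1 y k z) ∧ (∃ k z, SA K l1 x l2 y k z) ∧ (∃ k z, SA K l2 x l0 y k z) := by
  refine ⟨?_, ?_, ?_⟩
  · by_cases h : ∃ κ, K κ ∧ x - y = 1 * κ
    · obtain ⟨κ, h1, h2⟩ := h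
      exact ⟨l2, x + 4 * κ, -κ, hK.neg κ h1, by linear_combination -h2, by ring⟩
    · push Not at h
      exact ⟨l0, 2 * y - x, by ring, h⟩
  · by_cases h : ∃ κ, K κ ∧ x - y = -5 * κ
    · obtain ⟨κ, h1, h2⟩ := h
      exact ⟨l0, x + κ, -κ, hK.neg κ h1, by ring, by linear_combination -h2⟩
    · push Not at h
      exact ⟨l1, 2 * y - x, by ring, h⟩
  · by_cases h : ∃ κ, K κ ∧ x - y = 4 * κ
    · obtain ⟨κ, h1, h2⟩ := h
      exact ⟨l1, y - κ, -κ, hK.neg κ h1, by ring, by linear_combination h2⟩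
    · push Not at h
      exact ⟨l2, 2 * y - x, by ring, h⟩

theorem SA_diff (hF : GoodF F) {K : F → Prop} (hK : GoodK K) {i j : L3} (hij : i ≠ j) (x y : F) :
    ∃ k z, SA K i x j y k z := by
  have h1 := SA_next hF hK x y
  have h2 : (∃ k z, SA K l1 x l0 y k z) ∧ (∃ k z, SA K l2 x l1 y k z) ∧
      (∃ k z, SA K l0 x l2 y k z) := by
    obtain ⟨⟨k1, z1, e1⟩, ⟨k2, z2, e2⟩, k3, z3, e3⟩ := SA_next hF hK y x
    exact ⟨⟨_, _, SA_s12 hK e1⟩, ⟨_, _, SA_s12 hK e2⟩, _, _, SA_s12 hK e3⟩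
  cases i <;> cases j
  · exact (hij rfl).elim
  · exact h1.1
  · exact h2.2.2
  · exact h2.1
  · exact (hij rfl).elim
  · exact h1.2.1
  · exact h1.2.2
  · exact h2.2.1
  · exact (hij rfl).elim

end construction

/-! ### Pasch configurations up to symmetry -/

structure Pasch {V : Type*} (R : V → V → V → Prop) (a b c d e f : V) : Prop where
  r1 : R a b e
  r2 : R c d e
  r3 : R a c f
  r4 : R b d f
  n1 : a ≠ d
  n2 : b ≠ c
  n3 : e ≠ f

abbrev Six (α : Type*) := α × α × α × α × α × α

def sixAct {α : Type*} : List (Fin 3) → Six α → Six α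
  | [], t => t
  | g :: w, (a, b, c, d, e, f) => sixAct w (match g with
    | 0 => (b, a, d, c, e, f)
    | 1 => (a, c, b, d, f, e)
    | 2 => (a, e, f, d, b, c))

theorem sixAct_map {α β : Type*} (l : α → β) (w : List (Fin 3)) (t : Six α) :
    sixAct w (t.map l (Prod.map l (Prod.map l (Prod.map l (Prod.map l l))))) =
      (sixAct w t).map l (Prod.map l (Prod.map l (Prod.map l (Prod.map l l)))) := by
  induction w generalizing t with
  | nil => rfl
  | cons g w ih =>
    obtain ⟨a, b, c, d, e, f⟩ := t
    fin_cases g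
    · exact ih (b, a, d, c, e, f)
    · exact ih (a, c, b, d, f, e)
    · exact ih (a, e, f, d, b, c)

def PaschT {V : Type*} (R : V → V → V → Prop) (t : Six V) : Prop :=
  Pasch R t.1 t.2.1 t.2.2.1 t.2.2.2.1 t.2.2.2.2.1 t.2.2.2.2.2

theorem sixAct_pasch {V : Type*} {R : V → V → V → Prop} (s12 : ∀ x y z, R x y z → R y x z)
    (s23 : ∀ x y z, R x y z → R x z y) (w : List (Fin 3)) (t : Six V) (h : PaschT R t) :
    PaschT R (sixAct w t) := by
  induction w generalizing t with
  | nil => exact h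
  | cons g w ih =>
    obtain ⟨a, b, c, d, e, f⟩ := t
    obtain ⟨h1, h2, h3, h4, n1, n2, n3⟩ := h
    simp only at h1 h2 h3 h4 n1 n2 n3
    fin_cases g
    · exact ih (b, a, d, c, e, f) ⟨s12 _ _ _ h1, s12 _ _ _ h2, h4, h3, n2, n1, n3⟩
    · exact ih (a, c, b, d, f, e) ⟨h3, h4, h1, h2, n1, n2.symm, n3.symm⟩
    · exact ih (a, e, f, d, b, c) ⟨s23 _ _ _ h1, s12 _ _ _ (s23 _ _ _ (s12 _ _ _ h4)),
        s23 _ _ _ h3, s12 _ _ _ (s23 _ _ _ (s12 _ _ _ h2)), n1, n3, n2⟩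

/-- Words for the 24 symmetries of a Pasch configuration. -/
def sixWords : List (List (Fin 3)) :=
  [[0], [1], [2], [0, 1], [0, 2], [1, 0], [1, 2], [2, 0], [0, 1, 0], [0, 1, 2], [0, 2, 0], [1, 0, 1], [1, 0, 2], [1, 2, 0], [2, 0, 1], [0, 1, 0, 1], [0, 1, 0, 2], [0, 1, 2, 0], [0, 2, 0, 1], [1, 0, 1, 2], [1, 0, 2, 0], [1, 2, 0, 1], [2, 0, 1, 0]]

/-- All valid labellings of Pasch configurations are equivalent to one of `reps`. -/
def sixChk (n : ℕ) (val : ℕ → ℕ → ℕ → Bool) (ok : Six ℕ → Bool) : Bool :=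
  allB (fun a => allB (fun b => allB (fun e => !(val a b e) ||
    allB (fun c => allB (fun f => !(val a c f) || allB (fun d => !(val c d e) || !(val b d f) ||
      ok (a, b, c, d, e, f) || sixWords.any (fun w => ok (sixAct w (a, b, c, d, e, f)))) n) n) n)
        n) n) n

theorem sixChk_spec {V : Type*} {R : V → V → V → Prop} (s12 : ∀ x y z, R x y z → R y x z)
    (s23 : ∀ x y z, R x y z → R x z y) (lab : V → ℕ) (n : ℕ) (hn : ∀ x, lab x < n)
    (val : ℕ → ℕ → ℕ → Bool) (hval : ∀ x y z, R x y z → val (lab x) (lab y) (lab z) = true)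
    (ok : Six ℕ → Bool) (hchk : sixChk n val ok = true)
    (hok : ∀ a b c d e f, ok (lab a, lab b, lab c, lab d, lab e, lab f) = true →
      ¬ Pasch R a b c d e f) (a b c d e f : V) : ¬ Pasch R a b c d e f := by
  intro h
  have h1 := allB_spec hchk _ (hn a)
  have h2 := allB_spec h1 _ (hn b)
  have h3 := allB_spec h2 _ (hn e)
  rw [hval _ _ _ h.r1, Bool.not_true, Bool.false_or] at h3
  have h4 := allB_spec h3 _ (hn c)
  have h5 := allB_spec h4 _ (hn f)
  rw [hval _ _ _ h.r3, Bool.not_true, Bool.false_or] at h5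
  have h6 := allB_spec h5 _ (hn d)
  rw [hval _ _ _ h.r2, hval _ _ _ h.r4, Bool.not_true, Bool.false_or, Bool.false_or,
    Bool.or_eq_true, List.any_eq_true] at h6
  rcases h6 with h6 | ⟨w, -, h6⟩
  · exact hok a b c d e f h6 h
  · have e1 := sixAct_map lab w (a, b, c, d, e, f)
    have e2 := sixAct_pasch s12 s23 w (a, b, c, d, e, f) h
    simp only [Prod.map] at e1
    rw [e1] at h6
    exact hok _ _ _ _ _ _ h6 e2


def L3.lv : L3 → ℕ
  | l0 => 0
  | l1 => 1
  | l2 => 2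

theorem L3.lv_lt (i : L3) : i.lv < 3 := by cases i <;> decide

theorem L3.lv0 {i : L3} : i.lv = 0 ↔ i = l0 := by cases i <;> simp [lv]
theorem L3.lv1 {i : L3} : i.lv = 1 ↔ i = l1 := by cases i <;> simp [lv]
theorem L3.lv2 {i : L3} : i.lv = 2 ↔ i = l2 := by cases i <;> simp [lv]

def valA (i j k : ℕ) : Bool := !(Nat.beq i j && Nat.beq j k) &&
  (!(Nat.beq i j) || Nat.beq k ((i + 1) % 3)) && (!(Nat.beq i k) || Nat.beq j ((i + 1) % 3)) &&
  (!(Nat.beq j k) || Nat.beq i ((j + 1) % 3))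

section construction
variable {F : Type*} [CommRing F]

theorem SA_val {K : F → Prop} {i x j y k z} (h : SA K i x j y k z) :
    valA i.lv j.lv k.lv = true := by
  cases i <;> cases j <;> cases k <;> first | rfl | exact h.elim

def repsA : List (Six ℕ) := [(0, 1, 1, 0, 2, 2), (0, 0, 0, 2, 1, 1), (0, 1, 1, 1, 2, 2),
  (0, 1, 2, 0, 2, 2), (0, 0, 1, 2, 1, 2), (0, 0, 0, 0, 1, 1), (0, 2, 2, 0, 2, 2),
  (1, 1, 1, 1, 2, 2)]

theorem lin4 (hF : GoodF F) {a b c d e f : F} (h1 : a + b = 2 * e) (h2 : c + d = 2 * e)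
    (h3 : a + c = 2 * f) (h4 : b + d = 2 * f) : a = d :=
  hF.can2 (by linear_combination h1 - h2 + h3 - h4)

theorem SA_np (hF : GoodF F) {K : F → Prop} (hK : GoodK K) (a b c d e f : L3 × F) :
    ¬ Pasch (fun p q r : L3 × F => SA K p.1 p.2 q.1 q.2 r.1 r.2) a b c d e f := by
  refine sixChk_spec (R := fun p q r : L3 × F => SA K p.1 p.2 q.1 q.2 r.1 r.2)
    (fun x y z h => SA_s12 hK h) (fun x y z h => SA_s23 hK h)
    (fun p => p.1.lv) 3 (fun p => p.1.lv_lt) valA (fun x y z h => SA_val (K := K) (x := x.2) (y := y.2) (z := z.2) h)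
    (fun t => repsA.contains t) (by decide +kernel) ?_ a b c d e f
  rintro ⟨la, a⟩ ⟨lb, b⟩ ⟨lc, c⟩ ⟨ld, d⟩ ⟨le, e⟩ ⟨lf, f⟩ hok ⟨h1, h2, h3, h4, n1, n2, n3⟩
  simp only [repsA, List.contains_eq_mem, decide_eq_true_eq, List.mem_cons, Prod.mk.injEq,
    List.not_mem_nil, or_false, lv0, lv1, lv2] at hok
  rcases hok with hok | hok | hok | hok | hok | hok | hok | hok <;>
    (obtain ⟨rfl, rfl, rfl, rfl, rfl, rfl⟩ := hok
     simp only [SA] at h1 h2 h3 h4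
     simp only [ne_eq, Prod.mk.injEq, true_and, reduceCtorEq, false_and, not_false_eq_true]
       at n1 n2 n3)
  · obtain ⟨κ₁, k1, h1, h1'⟩ := h1
    obtain ⟨κ₂, k2, h2, h2'⟩ := h2
    obtain ⟨κ₃, k3, h3, h3'⟩ := h3
    obtain ⟨κ₄, k4, h4, h4'⟩ := h4
    have := hK.k15 _ k2 _ k3 (hF.of2 (by grind))
    grind
  · obtain ⟨κ₂, k2, h2, h2'⟩ := h2
    obtain ⟨κ₄, k4, h4, h4'⟩ := h4
    have e1 := h1.1
    have e3 := h3.1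
    have : κ₂ = κ₄ := hF.can7 (hF.can2
      (by linear_combination -e1 + e3 - 2 * h2 + 2 * h4 + 3 * h2' - 3 * h4'))
    grind
  · obtain ⟨κ₁, k1, h1, h1'⟩ := h1
    obtain ⟨κ₃, k3, h3, h3'⟩ := h3
    have e2 := h2.1
    have e4 := h4.1
    have : κ₁ = κ₃ := hF.can7 (by grind)
    grind
  · obtain ⟨κ₁, k1, h1, h1'⟩ := h1
    obtain ⟨κ₄, k4, h4, h4'⟩ := h4
    have e2 := h2.1
    have e3 := h3.1
    have : κ₁ = κ₄ := hF.can7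
      (by linear_combination -(e2 - e3 - h1' + h4' + 3 * h1 - 3 * h4))
    grind
  · obtain ⟨κ, k3, h3, h3'⟩ := h3
    refine h1.2 κ k3 (hF.can7 ?_)
    have := h1.1
    have := h2.1
    have := h4.1
    grind
  · exact n1 (lin4 hF h1.1 h2.1 h3.1 h4.1)
  · exact n2 (lin4 hF (a := b) (b := e) (c := f) (d := c) (e := a) (f := d) h1.1
      (by linear_combination h3.1) (by linear_combination h4.1) (by linear_combination h2.1))
  · exact n1 (lin4 hF h1.1 h2.1 h3.1 h4.1)

end construction


section construction
variable {F : Type*} [CommRing F]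

/-- The doubled set of slopes. -/
def dbl (K : F → Prop) (κ : F) : Prop := ∃ μ, K μ ∧ κ = 2 * μ

theorem GoodK.dbl (hF : GoodF F) {K : F → Prop} (hK : GoodK K) : GoodK (dbl K) := by
  refine ⟨⟨0, hK.zero, by ring⟩, ?_, ?_, ?_⟩
  · rintro _ ⟨μ, hμ, rfl⟩
    exact ⟨-μ, hK.neg μ hμ, by ring⟩
  · rintro _ ⟨κ, hκ, rfl⟩ _ ⟨μ, hμ, rfl⟩ h
    rw [hK.k15 κ hκ μ hμ (hF.of2 (by linear_combination h))]
  · rintro _ ⟨κ, hκ, rfl⟩ _ ⟨μ, hμ, rfl⟩ h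
    rw [hK.k25 κ hκ μ hμ (hF.of2 (by linear_combination h))]

theorem GoodK.c5 (hF : GoodF F) {K : F → Prop} (hK : GoodK K) (i : L3) {κ μ : F} (h1 : K κ)
    (h2 : K μ) (h : 5 * (i.c * (κ - μ)) = 0) : κ = μ := by
  cases i <;> simp only [L3.c] at h
  · exact hK.k15 _ h1 _ h2 (by linear_combination 3 * h)
  · exact hK.k25 _ h1 _ h2 (by linear_combination -h)
  · exact hK.k15 _ h1 _ h2 (hF.of2 (hF.of2 (by linear_combination 3 * h)))

theorem GoodK.c3 (hF : GoodF F) {K : F → Prop} (hK : GoodK K) (i : L3) {κ μ : F} (h1 : K κ)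
    (h2 : K μ) (h : 3 * (i.c * (κ - μ)) = 0) : κ = μ := by
  cases i <;> simp only [L3.c] at h
  · exact hK.k15 _ h1 _ h2 (by linear_combination 5 * h)
  · exact hK.k15 _ h1 _ h2 (by linear_combination -h)
  · exact hK.k15 _ h1 _ h2 (hF.of2 (hF.of2 (by linear_combination 5 * h)))

theorem leaf_EFEF (hF : GoodF F) {K K' : F → Prop} (hK : GoodK K) (i : L3) {k' a b c d e f : F}
    (h1 : ee K i.c a b e) (h2 : ee K' k' d e c) (h3 : ee K i.c a c f) (h4 : ee K' k' d f b) :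
    e = f := by
  obtain ⟨h1, κ, k1, -, e1⟩ := h1
  obtain ⟨h3, μ, k3, -, e3⟩ := h3
  have := hK.c5 hF i k1 k3 (by linear_combination (-5) * e1 + 5 * e3 + 2 * h1 - 2 * h3 +
    h4.1 - h2.1)
  subst this
  linear_combination e3 - e1

theorem leaf_ETET (hF : GoodF F) {K : F → Prop} (hK : GoodK K) (i : L3) {a b c s e f : F}
    (h1 : ee K i.c a b e) (h2 : e = c + s) (h3 : ee K i.c a c f) (h4 : f = b + s) :
    e = f := by
  obtain ⟨h1, κ, k1, -, e1⟩ := h1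
  obtain ⟨h3, μ, k3, -, e3⟩ := h3
  have := hK.c3 hF i k1 k3 (by linear_combination (-3) * e1 + 3 * e3 + h1 - h3 + h4 - h2)
  subst this
  linear_combination e3 - e1

theorem leaf_FFTT (hF : GoodF F) {K : F → Prop} (hK : GoodK K) (i : L3) {a b c d e s : F}
    (h1 : ee K i.c b e a) (h2 : ee K i.c c e d) (h3 : c = a + s) (h4 : b = d + s) :
    a = d := by
  obtain ⟨h1, κ, k1, -, e1⟩ := ee_swap hK h1
  obtain ⟨h2, μ, k2, -, e2⟩ := ee_swap hK h2
  have := hK.c3 hF i k1 k2 (by linear_combination (-3) * e1 + 3 * e2 + h1 - h2 + h3 - h4)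
  subst this
  linear_combination e2 - e1

theorem leaf_FFFF (hF : GoodF F) {K : F → Prop} {k a b c d e f : F}
    (h1 : ee K k b e a) (h2 : ee K k c e d) (h3 : ee K k c f a) (h4 : ee K k b f d) :
    b = c := hF.can2 (by linear_combination h1.1 - h2.1 - h3.1 + h4.1)

theorem leaf_FbFb (hF : GoodF F) {K : F → Prop} {k k' a b c d e f : F}
    (h1 : ee K k b e a) (h2 : bo K k' c e d) (h3 : ee K k c f a) (h4 : bo K k' b f d) :
    b = c := hF.can2 (by linear_combination h1.1 - h2.1 - h3.1 + h4.1)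

theorem leaf_TTp0 (hF : GoodF F) {a b c d e f : F}
    (h1 : 8 * a + b = e) (h2 : 8 * d + c = e) (h3 : 8 * a + c = f) (h4 : 8 * d + b = f) :
    a = d := hF.can2 (hF.can2 (hF.can2 (hF.can2 (by linear_combination h1 - h2 + h3 - h4))))

theorem leaf_TTp1 (hF : GoodF F) {a b c d e f : F}
    (h1 : 2 * a + b = e) (h2 : 2 * d + c = e) (h3 : 2 * a + c = f) (h4 : 2 * d + b = f) :
    a = d := hF.can2 (hF.can2 (by linear_combination h1 - h2 + h3 - h4))

theorem leaf_TTp2 (hF : GoodF F) {a b c d e f : F}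
    (h1 : a + 2 * b = e) (h2 : d + 2 * c = e) (h3 : a + 2 * c = f) (h4 : d + 2 * b = f) :
    a = d := hF.can2 (by linear_combination h1 - h2 + h3 - h4)

theorem leaf_EbTT0 (hF : GoodF F) {K : F → Prop} (hK : GoodK K) {a b c d e f : F}
    (h1 : ee K 1 a b e) (h2 : bo (dbl K) 4 c d e) (h3 : 8 * a + c = f)
    (h4 : 8 * b + d = f) : False := by
  obtain ⟨h1, κ, k1, -, e1⟩ := h1
  refine h2.2 (2 * (-κ)) ⟨-κ, hK.neg κ k1, rfl⟩ (hF.can2 (?_))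
  linear_combination h3 - h4 + 8 * h1 + h2.1 - 16 * e1

theorem leaf_bFTT0 (hF : GoodF F) {K : F → Prop} (hK : GoodK K) {a b c d e f : F}
    (h1 : bo K 1 a b e) (h2 : ee (dbl K) 4 c d e) (h3 : 8 * a + c = f)
    (h4 : 8 * b + d = f) : False := by
  obtain ⟨h2, _, ⟨κ, k1, rfl⟩, -, e1⟩ := h2
  refine h1.2 (-κ) (hK.neg κ k1) (hF.can2 (hF.can2 (hF.can2 (hF.can2 (?_)))))
  linear_combination h3 - h4 + 8 * h1.1 + h2 - 2 * e1

theorem leaf_EbTT1 (hF : GoodF F) {K : F → Prop} (hK : GoodK K) {a b c d e f : F}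
    (h1 : ee K (-5) a b e) (h2 : bo (dbl K) (-5) c d e) (h3 : 2 * a + c = f)
    (h4 : 2 * b + d = f) : False := by
  obtain ⟨h1, κ, k1, -, e1⟩ := h1
  refine h2.2 (2 * (-κ)) ⟨-κ, hK.neg κ k1, rfl⟩ (hF.can2 (?_))
  linear_combination h3 - h4 + 2 * h1 + h2.1 - 4 * e1

theorem leaf_bFTT1 (hF : GoodF F) {K : F → Prop} (hK : GoodK K) {a b c d e f : F}
    (h1 : bo K (-5) a b e) (h2 : ee (dbl K) (-5) c d e) (h3 : 2 * a + c = f)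
    (h4 : 2 * b + d = f) : False := by
  obtain ⟨h2, _, ⟨κ, k1, rfl⟩, -, e1⟩ := h2
  refine h1.2 (-κ) (hK.neg κ k1) (hF.can2 (hF.can2 (?_)))
  linear_combination h3 - h4 + 2 * h1.1 + h2 - 2 * e1

theorem leaf_EbTT2 (hF : GoodF F) {K : F → Prop} (hK : GoodK K) {a b c d e f : F}
    (h1 : ee K 4 a b e) (h2 : bo (dbl K) 1 c d e) (h3 : a + 2 * c = f)
    (h4 : b + 2 * d = f) : False := by
  obtain ⟨h1, κ, k1, -, e1⟩ := h1
  refine h2.2 (2 * (-κ)) ⟨-κ, hK.neg κ k1, rfl⟩ (hF.can2 (hF.can2 (?_)))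
  linear_combination h3 - h4 + h1 + 2 * h2.1 - 2 * e1

theorem leaf_bFTT2 (hF : GoodF F) {K : F → Prop} (hK : GoodK K) {a b c d e f : F}
    (h1 : bo K 4 a b e) (h2 : ee (dbl K) 1 c d e) (h3 : a + 2 * c = f)
    (h4 : b + 2 * d = f) : False := by
  obtain ⟨h2, _, ⟨κ, k1, rfl⟩, -, e1⟩ := h2
  refine h1.2 (-κ) (hK.neg κ k1) (hF.can2 (?_))
  linear_combination h3 - h4 + h1.1 + 2 * h2 - 4 * e1

/-- Points of the big system. -/
inductive Pt (F S : Type) : Type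
  | A (i : L3) (x : F)
  | B (i : L3) (x : F)
  | U (u : S ⊕ F ⊕ F)

end construction

section big
variable {F S : Type} [CommRing F]

open Pt

/-- The blocks of the big system. -/
def RR (K : F → Prop) (σ : L3 → S → F) (RU : S ⊕ F ⊕ F → S ⊕ F ⊕ F → S ⊕ F ⊕ F → Prop) :
    Pt F S → Pt F S → Pt F S → Prop
  | A i x, A j y, A k z => SA K i x j y k z
  | A i x, A j y, B k z => EE K i x j y k z
  | A i x, B k z, A j y => EE K i x j y k z
  | B k z, A i x, A j y => EE K i x j y k z
  | B i x, B j y, B k z => SA (dbl K) i x j y k z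
  | B i x, B j y, A k z => EE (dbl K) i x j y k z
  | B i x, A k z, B j y => EE (dbl K) i x j y k z
  | A k z, B i x, B j y => EE (dbl K) i x j y k z
  | A i x, B j y, U u => TT σ i x j y u
  | A i x, U u, B j y => TT σ i x j y u
  | B j y, A i x, U u => TT σ i x j y u
  | B j y, U u, A i x => TT σ i x j y u
  | U u, A i x, B j y => TT σ i x j y u
  | U u, B j y, A i x => TT σ i x j y u
  | U u, U v, U w => RU u v w
  | _, _, _ => False

def L3.ng : L3 → L3
  | l0 => l0
  | l1 => l2
  | l2 => l1

structure GoodS (K : F → Prop) (σ : L3 → S → F) : Prop where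
  inj : ∀ (i : L3) (s t : S), σ i s = σ i t → s = t
  cov : ∀ (i : L3) (d : F), (∃ s, σ i s = d) ∨ (∃ κ, K κ ∧ κ ≠ 0 ∧ d = i.c * κ) ∨
    ∃ κ, dbl K κ ∧ κ ≠ 0 ∧ d = i.ng.c * κ
  d1 : ∀ (i : L3) (s : S) (κ : F), K κ → κ ≠ 0 → σ i s ≠ i.c * κ
  d2 : ∀ (i : L3) (s : S) (κ : F), dbl K κ → κ ≠ 0 → σ i s ≠ i.ng.c * κ
  d3 : ∀ (i : L3) (κ μ : F), K κ → dbl K μ → κ ≠ 0 → i.c * κ ≠ i.ng.c * μ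

theorem EE_swap {K : F → Prop} (hK : GoodK K) {i x j y k z} (h : EE K i x j y k z) :
    EE K j y i x k z := by
  cases i <;> cases j <;> cases k <;> first
    | exact h.elim
    | exact ee_swap hK h

theorem EE_ne (hF : GoodF F) {K : F → Prop} (hK : GoodK K) {i x y k z} (h : EE K i x i y k z) :
    x ≠ y := by
  have key : ∀ l : L3, ∀ z, ee K l.c x y z → x ≠ y := by
    rintro l z ⟨h1, κ, k1, k2, h2⟩ rfl
    have h3 : x = z := hF.can2 (by linear_combination h1)
    apply k2
    apply hK.c3 hF l k1 hK.zero
    linear_combination 3 * h3 - 3 * h2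
  cases i <;> cases k <;> first
    | exact False.elim h
    | exact key l0 _ h | exact key l1 _ h
    | exact key l2 _ h

variable {K : F → Prop} {σ : L3 → S → F} {RU : S ⊕ F ⊕ F → S ⊕ F ⊕ F → S ⊕ F ⊕ F → Prop}

theorem RR_s12 (hF : GoodF F) (hK : GoodK K) (hU : APR RU) (p q r : Pt F S)
    (h : RR K σ RU p q r) : RR K σ RU q p r := by
  have hK2 := hK.dbl hF
  cases p <;> cases q <;> cases r <;> first
    | exact h
    | exact SA_s12 hK h | exact SA_s12 hK2 h
    | exact EE_swap hK h | exact EE_swap hK2 h | exact hU.s12 _ _ _ h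

theorem RR_s23 (hF : GoodF F) (hK : GoodK K) (hU : APR RU) (p q r : Pt F S)
    (h : RR K σ RU p q r) : RR K σ RU p r q := by
  have hK2 := hK.dbl hF
  cases p <;> cases q <;> cases r <;> first
    | exact h
    | exact SA_s23 hK h | exact SA_s23 hK2 h
    | exact EE_swap hK h | exact EE_swap hK2 h | exact hU.s23 _ _ _ h

theorem RR_ne (hF : GoodF F) (hK : GoodK K) (hU : APR RU) (p q r : Pt F S)
    (h : RR K σ RU p q r) : p ≠ q := by
  have hK2 := hK.dbl hF
  rintro rfl
  cases p <;> cases r <;> first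
    | exact h.elim
    | exact SA_ne hF hK h rfl
    | exact SA_ne hF hK2 h rfl | exact EE_ne hF hK h rfl | exact EE_ne hF hK2 h rfl
    | exact hU.ne _ _ _ h rfl

def Pt.lab : Pt F S → ℕ
  | A i _ => i.lv
  | B i _ => 3 + i.lv
  | U (Sum.inl _) => 6
  | U (Sum.inr (Sum.inl _)) => 7
  | U (Sum.inr (Sum.inr _)) => 8

theorem Pt.lab_lt (p : Pt F S) : p.lab < 9 := by
  rcases p with i | i | u | u | u
  · have := i.lv_lt; simp only [lab]; omega
  · have := i.lv_lt; simp only [lab]; omega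
  all_goals simp only [lab]; omega

theorem Pt.labA (p : Pt F S) (h : p.lab < 3) : ∃ i x, p = A i x := by
  rcases p with ⟨i, x⟩ | ⟨i, x⟩ | u | u | u <;> simp only [lab] at h <;> first | exact ⟨i, x, rfl⟩ | omega

theorem Pt.labB (p : Pt F S) (h : 3 ≤ p.lab ∧ p.lab < 6) : ∃ i x, p = B i x := by
  rcases p with ⟨i, x⟩ | ⟨i, x⟩ | u | u | u <;> simp only [lab] at h <;>
    first | (have := i.lv_lt; omega) | exact ⟨i, x, rfl⟩ | omega

theorem Pt.labU (p : Pt F S) (h : 6 ≤ p.lab) : ∃ u, p = U u := by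
  rcases p with ⟨i, x⟩ | ⟨i, x⟩ | u <;> simp only [lab] at h <;>
    first | (have := i.lv_lt; omega) | exact ⟨u, rfl⟩

theorem Pt.lab0 {p : Pt F S} : p.lab = 0 ↔ ∃ x, p = A l0 x := by
  rcases p with ⟨i | i | i, x⟩ | ⟨i | i | i, x⟩ | u | u | u <;> simp [lab, lv]
theorem Pt.lab1 {p : Pt F S} : p.lab = 1 ↔ ∃ x, p = A l1 x := by
  rcases p with ⟨i | i | i, x⟩ | ⟨i | i | i, x⟩ | u | u | u <;> simp [lab, lv]
theorem Pt.lab2 {p : Pt F S} : p.lab = 2 ↔ ∃ x, p = A l2 x := by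
  rcases p with ⟨i | i | i, x⟩ | ⟨i | i | i, x⟩ | u | u | u <;> simp [lab, lv]
theorem Pt.lab3 {p : Pt F S} : p.lab = 3 ↔ ∃ x, p = B l0 x := by
  rcases p with ⟨i | i | i, x⟩ | ⟨i | i | i, x⟩ | u | u | u <;> simp [lab, lv]
theorem Pt.lab4 {p : Pt F S} : p.lab = 4 ↔ ∃ x, p = B l1 x := by
  rcases p with ⟨i | i | i, x⟩ | ⟨i | i | i, x⟩ | u | u | u <;> simp [lab, lv]
theorem Pt.lab5 {p : Pt F S} : p.lab = 5 ↔ ∃ x, p = B l2 x := by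
  rcases p with ⟨i | i | i, x⟩ | ⟨i | i | i, x⟩ | u | u | u <;> simp [lab, lv]
theorem Pt.lab6 {p : Pt F S} : p.lab = 6 ↔ ∃ x, p = U (Sum.inl x) := by
  rcases p with ⟨i | i | i, x⟩ | ⟨i | i | i, x⟩ | u | u | u <;> simp [lab, lv]
theorem Pt.lab7 {p : Pt F S} : p.lab = 7 ↔ ∃ x, p = U (Sum.inr (Sum.inl x)) := by
  rcases p with ⟨i | i | i, x⟩ | ⟨i | i | i, x⟩ | u | u | u <;> simp [lab, lv]
theorem Pt.lab8 {p : Pt F S} : p.lab = 8 ↔ ∃ x, p = U (Sum.inr (Sum.inr x)) := by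
  rcases p with ⟨i | i | i, x⟩ | ⟨i | i | i, x⟩ | u | u | u <;> simp [lab, lv]

def valE (i j k : ℕ) : Bool := Nat.beq i j && Nat.beq ((i + k) % 3) 0

def valT (i j u : ℕ) : Bool := Nat.beq ((i + j + u) % 3) 0

def val9 (a b c : ℕ) : Bool :=
  match a / 3, b / 3, c / 3 with
  | 0, 0, 0 => valA a b c
  | 0, 0, 1 => valE a b c
  | 0, 1, 0 => valE a c b
  | 1, 0, 0 => valE b c a
  | 1, 1, 1 => valA (a % 3) (b % 3) (c % 3)
  | 1, 1, 0 => valE a b c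
  | 1, 0, 1 => valE a c b
  | 0, 1, 1 => valE b c a
  | 0, 1, 2 => valT a b c
  | 0, 2, 1 => valT a c b
  | 1, 0, 2 => valT a b c
  | 1, 2, 0 => valT a c b
  | 2, 0, 1 => valT b c a
  | 2, 1, 0 => valT b c a
  | 2, 2, 2 => true
  | _, _, _ => false

theorem RR_val (p q r : Pt F S) (h : RR K σ RU p q r) : val9 p.lab q.lab r.lab = true := by
  rcases p with i | i | u | u | u <;> rcases q with j | j | v | v | v <;>
    rcases r with k | k | w | w | w <;> (try exact False.elim h) <;> (try rfl) <;>
    (try cases i) <;> (try cases j) <;> (try cases k) <;> first | exact False.elim h | (simp only [Pt.lab, L3.lv]; decide)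

def repsM : List (Six ℕ) := [(0, 0, 0, 0, 3, 3), (1, 1, 1, 1, 5, 5), (2, 2, 2, 2, 4, 4), (0, 0, 0, 3, 3, 3), (1, 1, 1, 5, 5, 5), (2, 2, 2, 4, 4, 4), (0, 0, 0, 6, 3, 3), (1, 1, 1, 6, 5, 5), (2, 2, 2, 6, 4, 4), (0, 0, 5, 5, 3, 7), (1, 1, 4, 4, 5, 7), (2, 2, 3, 3, 4, 7), (0, 3, 3, 0, 3, 3), (1, 5, 5, 1, 5, 5), (2, 4, 4, 2, 4, 4), (0, 3, 3, 0, 3, 6), (1, 5, 5, 1, 5, 6), (2, 4, 4, 2, 4, 6), (0, 3, 3, 4, 3, 3), (1, 5, 5, 3, 5, 5), (2, 4, 4, 5, 4, 4), (0, 3, 3, 0, 6, 6), (1, 5, 5, 1, 6, 6), (2, 4, 4, 2, 6, 6), (0, 5, 5, 0, 7, 7), (1, 4, 4, 1, 7, 7), (2, 3, 3, 2, 7, 7), (0, 4, 4, 0, 8, 8), (1, 3, 3, 1, 8, 8), (2, 5, 5, 2, 8, 8), (0, 0, 5, 5, 1, 7), (1, 1, 4, 4, 2, 7), (2, 2, 3,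 3, 0, 7), (0, 0, 0, 0, 1, 3), (1, 1, 1, 1, 2, 5), (2, 2, 2, 2, 0, 4)]

def ok9 : Six ℕ → Bool
  | (a, b, c, d, e, f) => [a, b, c, d, e, f].all (fun x => Nat.ble (x + 1) 3) ||
    [a, b, c, d, e, f].all (fun x => Nat.ble 3 x && Nat.ble (x + 1) 6) ||
    [a, b, c, d, e, f].all (fun x => Nat.ble 6 x) || repsM.contains (a, b, c, d, e, f)

theorem RR_chk : sixChk 9 val9 ok9 = true := by decide +kernel

set_option maxHeartbeats 2000000 in
theorem RR_np (hF : GoodF F) (hK : GoodK K) (hU : APR RU) (a b c d e f : Pt F S) :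
    ¬ Pasch (RR K σ RU) a b c d e f := by
  have hK2 := hK.dbl hF
  refine sixChk_spec (RR_s12 hF hK hU) (RR_s23 hF hK hU) Pt.lab 9 Pt.lab_lt val9 RR_val ok9
    RR_chk ?_ a b c d e f
  clear a b c d e f
  intro a b c d e f hok
  simp only [ok9, Bool.or_eq_true, List.all_cons, List.all_nil, Bool.and_eq_true, Nat.ble_eq,
    and_true] at hok
  rcases hok with ((⟨h1, h2, h3, h4, h5, h6⟩ | ⟨h1, h2, h3, h4, h5, h6⟩) |
    ⟨h1, h2, h3, h4, h5, h6⟩) | hok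
  · obtain ⟨i1, x1, rfl⟩ := a.labA h1
    obtain ⟨i2, x2, rfl⟩ := b.labA h2
    obtain ⟨i3, x3, rfl⟩ := c.labA h3
    obtain ⟨i4, x4, rfl⟩ := d.labA h4
    obtain ⟨i5, x5, rfl⟩ := e.labA h5
    obtain ⟨i6, x6, rfl⟩ := f.labA h6
    rintro ⟨h1, h2, h3, h4, n1, n2, n3⟩
    refine SA_np hF hK (i1, x1) (i2, x2) (i3, x3) (i4, x4) (i5, x5) (i6, x6)
      ⟨h1, h2, h3, h4, ?_, ?_, ?_⟩
    · simpa using n1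
    · simpa using n2
    · simpa using n3
  · obtain ⟨i1, x1, rfl⟩ := a.labB h1
    obtain ⟨i2, x2, rfl⟩ := b.labB h2
    obtain ⟨i3, x3, rfl⟩ := c.labB h3
    obtain ⟨i4, x4, rfl⟩ := d.labB h4
    obtain ⟨i5, x5, rfl⟩ := e.labB h5
    obtain ⟨i6, x6, rfl⟩ := f.labB h6
    rintro ⟨h1, h2, h3, h4, n1, n2, n3⟩
    refine SA_np hF hK2 (i1, x1) (i2, x2) (i3, x3) (i4, x4) (i5, x5) (i6, x6)
      ⟨h1, h2, h3, h4, ?_, ?_, ?_⟩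
    · simpa using n1
    · simpa using n2
    · simpa using n3
  · obtain ⟨u1, rfl⟩ := a.labU h1
    obtain ⟨u2, rfl⟩ := b.labU h2
    obtain ⟨u3, rfl⟩ := c.labU h3
    obtain ⟨u4, rfl⟩ := d.labU h4
    obtain ⟨u5, rfl⟩ := e.labU h5
    obtain ⟨u6, rfl⟩ := f.labU h6
    rintro ⟨h1, h2, h3, h4, n1, n2, n3⟩
    exact n1 (by rw [hU.np u1 u2 u3 u4 u5 u6 h1 h2 h3 h4])
  simp only [repsM, List.contains_eq_mem, decide_eq_true_eq, List.mem_cons, Prod.mk.injEq,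
    List.not_mem_nil, or_false, lab0, lab1, lab2, lab3, lab4, lab5, lab6, lab7, lab8] at hok
  rcases hok with hok | hok | hok | hok | hok | hok | hok | hok | hok | hok | hok | hok | hok | hok | hok | hok | hok | hok | hok | hok | hok | hok | hok | hok | hok | hok | hok | hok | hok | hok | hok | hok | hok | hok | hok | hok <;>
    (obtain ⟨⟨a, rfl⟩, ⟨b, rfl⟩, ⟨c, rfl⟩, ⟨d, rfl⟩, ⟨e, rfl⟩, ⟨f, rfl⟩⟩ := hok
     rintro ⟨h1, h2, h3, h4, n1, n2, n3⟩
     simp only [RR, SA, EE, TT] at h1 h2 h3 h4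
     simp only [ne_eq, Pt.A.injEq, Pt.B.injEq, true_and, reduceCtorEq, false_and,
       not_false_eq_true] at n1 n2 n3)
  · exact n1 (lin4 hF h1.1 h2.1 h3.1 h4.1)
  · exact n1 (lin4 hF h1.1 h2.1 h3.1 h4.1)
  · exact n1 (lin4 hF h1.1 h2.1 h3.1 h4.1)
  · exact n3 (leaf_EFEF hF hK l0 h1 h2 h3 h4)
  · exact n3 (leaf_EFEF hF hK l1 h1 h2 h3 h4)
  · exact n3 (leaf_EFEF hF hK l2 h1 h2 h3 h4)
  · exact n3 (leaf_ETET hF hK l0 h1 h2 h3 h4)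
  · exact n3 (leaf_ETET hF hK l1 h1 h2 h3 h4)
  · exact n3 (leaf_ETET hF hK l2 h1 h2 h3 h4)
  · exact leaf_EbTT0 hF hK h1 h2 h3 h4
  · exact leaf_EbTT1 hF hK h1 h2 h3 h4
  · exact leaf_EbTT2 hF hK h1 h2 h3 h4
  · exact n2 (leaf_FFFF hF h1 h2 h3 h4)
  · exact n2 (leaf_FFFF hF h1 h2 h3 h4)
  · exact n2 (leaf_FFFF hF h1 h2 h3 h4)
  · exact n1 (leaf_FFTT hF hK2 l0 h1 h2 h3 h4)
  · exact n1 (leaf_FFTT hF hK2 l2 h1 h2 h3 h4)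
  · exact n1 (leaf_FFTT hF hK2 l1 h1 h2 h3 h4)
  · exact n2 (leaf_FbFb hF h1 h2 h3 h4)
  · exact n2 (leaf_FbFb hF h1 h2 h3 h4)
  · exact n2 (leaf_FbFb hF h1 h2 h3 h4)
  · exact n1 (hF.can2 (by linear_combination h2 + h4 - h1 - h3))
  · exact n1 (hF.can2 (by linear_combination h2 + h4 - h1 - h3))
  · exact n1 (hF.can2 (by linear_combination h2 + h4 - h1 - h3))
  · exact n1 (leaf_TTp0 hF h1 h2 h3 h4)
  · exact n1 (leaf_TTp1 hF h1 h2 h3 h4)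
  · exact n1 (leaf_TTp2 hF h1 h2 h3 h4)
  · exact n1 (hF.can2 (by linear_combination h1 - h2 + h3 - h4))
  · exact n1 (hF.can2 (by linear_combination h1 - h2 + h3 - h4))
  · exact n1 (hF.can2 (by linear_combination h1 - h2 + h3 - h4))
  · exact leaf_bFTT0 hF hK h1 h2 h3 h4
  · exact leaf_bFTT1 hF hK h1 h2 h3 h4
  · exact leaf_bFTT2 hF hK h1 h2 h3 h4
  · exact n1 (lin4 hF h1.1 h2.1 h3.1 h4.1)
  · exact n1 (lin4 hF h1.1 h2.1 h3.1 h4.1)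
  · exact n1 (lin4 hF h1.1 h2.1 h3.1 h4.1)

end big


section big
variable {F S : Type} [CommRing F]

open Pt

variable {K : F → Prop} {σ : L3 → S → F} {RU : S ⊕ F ⊕ F → S ⊕ F ⊕ F → S ⊕ F ⊕ F → Prop}

theorem bo_ee {c x y z w : F} (hF : GoodF F) (h : bo K c x y z) (h' : ee K c x y w) : False := by
  obtain ⟨h1, κ, k1, -, h2⟩ := h'
  have : z = w := hF.can2 (by linear_combination h1 - h.1)
  subst this
  exact h.2 κ k1 h2

theorem SA_EE (hF : GoodF F) {i x j y k z l w} (h : SA K i x j y k z) (h' : EE K i x j y l w) :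
    False := by
  cases i <;> cases j <;> cases l <;> first
    | exact False.elim h'
    | (cases k <;> first
      | exact False.elim h
      | exact bo_ee hF h h')

theorem EE_uqz (hF : GoodF F) {i x j y k z l w} (h : EE K i x j y k z) (h' : EE K i x j y l w) :
    k = l ∧ z = w := by
  cases i <;> cases j <;> cases l <;> first
    | exact False.elim h'
    | (cases k <;> first
      | exact False.elim h
      | (simp only [EE] at h h'
         exact ⟨rfl, hF.can2 (by linear_combination h'.1 - h.1)⟩))

theorem EE_uqy {i x j y k z l w} (h : EE K i x j y k z) (h' : EE K i x l w k z) :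
    j = l ∧ y = w := by
  cases i <;> cases j <;> cases k <;> first
    | exact False.elim h
    | (cases l <;> first
      | exact False.elim h'
      | (simp only [EE] at h h'
         exact ⟨rfl, by linear_combination h.1 - h'.1⟩))

theorem EE_form {i x j y k z} (h : EE K i x j y k z) :
    k = i.ng ∧ ∃ κ, K κ ∧ κ ≠ 0 ∧ x - z = i.c * κ := by
  cases i <;> cases j <;> cases k <;> first
    | exact False.elim h
    | exact ⟨rfl, h.2⟩

theorem TTs_form {i x k z s} (h : TT σ i x k z (Sum.inl s)) : k = i.ng ∧ z = x + σ i s := by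
  cases i <;> cases k <;> first
    | exact False.elim h
    | exact ⟨rfl, h⟩

theorem ng_ng (i : L3) : i.ng.ng = i := by cases i <;> rfl

theorem EE_EE (hK : GoodK K) (hS : GoodS K σ) {i x j y k z l w} (h : EE K i x j y k z)
    (h' : EE (dbl K) k z l w i x) : False := by
  obtain ⟨rfl, κ, k1, k2, h1⟩ := EE_form h
  obtain ⟨-, μ, k3, k4, h2⟩ := EE_form h'
  refine hS.d3 i (-κ) μ (hK.neg κ k1) k3 (neg_ne_zero.2 k2) ?_
  linear_combination h2 + h1

theorem TT_nEs (i : L3) (x : F) (z : F) (u : F ⊕ F) : ¬ TT σ i x i.ng z (Sum.inr u) := by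
  rcases u with u | u <;> cases i <;> exact fun h => h

theorem EE_TT (hK : GoodK K) (hS : GoodS K σ) {i x j y k z u} (h : EE K i x j y k z)
    (h' : TT σ i x k z u) : False := by
  obtain ⟨rfl, κ, k1, k2, h1⟩ := EE_form h
  rcases u with s | u
  · obtain ⟨-, h2⟩ := TTs_form h'
    refine hS.d1 i s (-κ) (hK.neg κ k1) (neg_ne_zero.2 k2) ?_
    linear_combination -h2 - h1
  · exact TT_nEs _ _ _ _ h'

theorem FF_TT (hS : GoodS K σ) {i x j y k z u} (h : EE (dbl K) k z j y i x)
    (h' : TT σ i x k z u) : False := by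
  obtain ⟨rfl, κ, k1, k2, h1⟩ := EE_form h
  rcases u with s | u
  · have h2 := (TTs_form h').2
    refine hS.d2 k.ng s κ k1 k2 ?_
    rw [ng_ng]
    linear_combination -h2 + h1
  · rcases u with u | u <;> cases k <;> exact h'

theorem TT_uqu (hS : GoodS K σ) {i x k z u v} (h : TT σ i x k z u) (h' : TT σ i x k z v) :
    u = v := by
  have key : ∀ i s t, z = x + σ i s → z = x + σ i t → s = t := fun i s t h1 h2 =>
    hS.inj i s t (by linear_combination h2 - h1)
  rcases u with u | u | u <;> rcases v with v | v | v <;> cases i <;> cases k <;> first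
    | exact False.elim h
    | exact False.elim h'
    | (exact congrArg Sum.inl (key _ _ _ h h'))
    | (simp only [TT] at h h'; rw [← h, ← h'])

theorem TT_uqB (hF : GoodF F) {i x k z u l w} (h : TT σ i x k z u) (h' : TT σ i x l w u) :
    k = l ∧ z = w := by
  rcases u with u | u | u <;> cases i <;> cases k <;> first
    | exact False.elim h
    | (cases l <;> first
       | exact False.elim h'
       | (simp only [TT] at h h'
          refine ⟨rfl, ?_⟩
          first
            | linear_combination h - h'
            | exact hF.can2 (by linear_combination h - h')))

theorem TT_uqA (hF : GoodF F) {i x k z u l w} (h : TT σ k z i x u) (h' : TT σ l w i x u) :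
    k = l ∧ z = w := by
  rcases u with u | u | u <;> cases i <;> cases k <;> first
    | exact False.elim h
    | (cases l <;> first
       | exact False.elim h'
       | (simp only [TT] at h h'
          refine ⟨rfl, ?_⟩
          first
            | linear_combination h - h'
            | linear_combination h' - h
            | exact hF.can2 (by linear_combination h - h')
            | exact hF.can2 (hF.can2 (hF.can2 (by linear_combination h - h')))))

theorem RR_uq (hF : GoodF F) (hK : GoodK K) (hS : GoodS K σ) (hU : APR RU) (p q r s : Pt F S)
    (h : RR K σ RU p q r) (h' : RR K σ RU p q s) : r = s := by
  have hK2 := hK.dbl hF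
  have e1 : ∀ i x j y (_ : (i : L3) = j ∧ (x : F) = y), (A i x : Pt F S) = A j y := by
    rintro i x j y ⟨rfl, rfl⟩; rfl
  have e2 : ∀ i x j y (_ : (i : L3) = j ∧ (x : F) = y), (B i x : Pt F S) = B j y := by
    rintro i x j y ⟨rfl, rfl⟩; rfl
  cases p <;> cases q <;> cases r <;> first
    | exact False.elim h
    | (cases s <;> first
      | exact False.elim h'
      | (simp only [RR] at h h'
         first
          | exact (SA_EE hF h h').elim
          | exact (SA_EE hF h' h).elim
          | exact (EE_EE hK hS h h').elim
          | exact (EE_EE hK hS h' h).elim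
          | exact (EE_TT hK hS h h').elim
          | exact (EE_TT hK hS h' h).elim
          | exact (FF_TT hS h h').elim
          | exact (FF_TT hS h' h).elim
          | exact congrArg U (hU.uq _ _ _ _ h h')
          | exact congrArg U (TT_uqu hS h h')
          | (refine e1 _ _ _ _ ?_; first
            | exact SA_uq hF hK h h'
            | exact EE_uqz hF h h'
            | exact EE_uqy h h'
            | exact TT_uqA hF h h')
          | (refine e2 _ _ _ _ ?_; first
            | exact SA_uq hF hK2 h h'
            | exact EE_uqz hF h h'
            | exact EE_uqy h h'
            | exact TT_uqB hF h h')))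

theorem RR_exAB (hK : GoodK K) (hS : GoodS K σ) (i : L3) (x : F) (k : L3)
    (z : F) : ∃ r, RR K σ RU (A i x) (B k z) r := by
  have key : ∀ i : L3, (∃ s, z = x + σ i s) ∨
      (∃ κ, K κ ∧ κ ≠ 0 ∧ x - z = i.c * κ) ∨ ∃ κ, dbl K κ ∧ κ ≠ 0 ∧ z - x = i.ng.c * κ := by
    intro i
    rcases hS.cov i (z - x) with ⟨s, h⟩ | ⟨κ, k1, k2, h⟩ | h
    · exact Or.inl ⟨s, by linear_combination -h⟩
    · exact Or.inr (Or.inl ⟨-κ, hK.neg κ k1, neg_ne_zero.2 k2, by linear_combination -h⟩)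
    · exact Or.inr (Or.inr h)
  have ki := key i
  cases i <;> cases k
  case l0.l0 =>
    rcases ki with ⟨s, h⟩ | h | h
    · exact ⟨U (Sum.inl s), h⟩
    · exact ⟨A l0 (2 * z - x), by ring, h⟩
    · exact ⟨B l0 (2 * x - z), by ring, h⟩
  case l1.l2 =>
    rcases ki with ⟨s, h⟩ | h | h
    · exact ⟨U (Sum.inl s), h⟩
    · exact ⟨A l1 (2 * z - x), by ring, h⟩
    · exact ⟨B l2 (2 * x - z), by ring, h⟩
  case l2.l1 =>
    rcases ki with ⟨s, h⟩ | h | h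
    · exact ⟨U (Sum.inl s), h⟩
    · exact ⟨A l2 (2 * z - x), by ring, h⟩
    · exact ⟨B l1 (2 * x - z), by ring, h⟩
  all_goals first
    | exact ⟨U (Sum.inr (Sum.inl _)), rfl⟩
    | exact ⟨U (Sum.inr (Sum.inr _)), rfl⟩

theorem TT_exB (hF : GoodF F) (i : L3) (x : F) (u : S ⊕ F ⊕ F) : ∃ k z, TT σ i x k z u := by
  rcases u with s | u | u <;> cases i
  · exact ⟨l0, _, rfl⟩
  · exact ⟨l2, _, rfl⟩
  · exact ⟨l1, _, rfl⟩
  · exact ⟨l2, u - 8 * x, by simp only [TT]; ring⟩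
  · exact ⟨l1, u - 2 * x, by simp only [TT]; ring⟩
  · obtain ⟨w, h⟩ := hF.half (u - x)
    exact ⟨l0, w, by simp only [TT]; linear_combination -h⟩
  · exact ⟨l1, u - x, by simp only [TT]; ring⟩
  · exact ⟨l0, u - x, by simp only [TT]; ring⟩
  · exact ⟨l2, u - x, by simp only [TT]; ring⟩

theorem TT_exA (hF : GoodF F) (i : L3) (x : F) (u : S ⊕ F ⊕ F) : ∃ k z, TT σ k z i x u := by
  rcases u with s | u | u <;> cases i
  · exact ⟨l0, x - σ l0 s, by simp only [TT]; ring⟩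
  · exact ⟨l2, x - σ l2 s, by simp only [TT]; ring⟩
  · exact ⟨l1, x - σ l1 s, by simp only [TT]; ring⟩
  · exact ⟨l2, u - 2 * x, by simp only [TT]; ring⟩
  · obtain ⟨w, h⟩ := hF.half (u - x)
    exact ⟨l1, w, by simp only [TT]; linear_combination -h⟩
  · obtain ⟨w, h⟩ := hF.half (u - x)
    obtain ⟨w', h'⟩ := hF.half w
    obtain ⟨w'', h''⟩ := hF.half w'
    exact ⟨l0, w'', by simp only [TT]; linear_combination -h - 2 * h' - 4 * h''⟩
  · exact ⟨l1, u - x, by simp only [TT]; ring⟩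
  · exact ⟨l0, u - x, by simp only [TT]; ring⟩
  · exact ⟨l2, u - x, by simp only [TT]; ring⟩

theorem half_ex (hF : GoodF F) (hK : GoodK K) (i : L3) (x : F) (j : L3) (y : F)
    (h : ¬ (i = j ∧ x = y)) : (∃ k z, SA K i x j y k z) ∨ ∃ k z, EE K i x j y k z := by
  by_cases hij : i = j
  · subst hij
    rcases SA_same hF hK i (x := x) (y := y) (fun hh => h ⟨rfl, hh⟩) with h | ⟨z, h⟩
    · exact Or.inl h
    · right
      cases i
      · exact ⟨l0, z, h⟩
      · exact ⟨l2, z, h⟩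
      · exact ⟨l1, z, h⟩
  · exact Or.inl (SA_diff hF hK hij x y)

theorem RR_ex (hF : GoodF F) (hK : GoodK K) (hS : GoodS K σ) (hU : APR RU) (p q : Pt F S)
    (h : p ≠ q) : ∃ r, RR K σ RU p q r := by
  have hK2 := hK.dbl hF
  rcases p with ⟨i, x⟩ | ⟨i, x⟩ | u <;> rcases q with ⟨j, y⟩ | ⟨j, y⟩ | v
  · rcases half_ex hF hK i x j y (by rintro ⟨rfl, rfl⟩; exact h rfl) with ⟨k, z, h⟩ | ⟨k, z, h⟩
    · exact ⟨A k z, h⟩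
    · exact ⟨B k z, h⟩
  · exact RR_exAB hK hS i x j y
  · obtain ⟨k, z, h⟩ := TT_exB (σ := σ) hF i x v
    exact ⟨B k z, h⟩
  · obtain ⟨r, h⟩ := RR_exAB (RU := RU) hK hS j y i x
    exact ⟨r, RR_s12 hF hK hU _ _ _ h⟩
  · rcases half_ex hF hK2 i x j y (by rintro ⟨rfl, rfl⟩; exact h rfl) with ⟨k, z, h⟩ | ⟨k, z, h⟩
    · exact ⟨B k z, h⟩
    · exact ⟨A k z, h⟩
  · obtain ⟨k, z, h⟩ := TT_exA (σ := σ) hF i x v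
    exact ⟨A k z, h⟩
  · obtain ⟨k, z, h⟩ := TT_exB (σ := σ) hF j y u
    exact ⟨B k z, h⟩
  · obtain ⟨k, z, h⟩ := TT_exA (σ := σ) hF j y u
    exact ⟨A k z, h⟩
  · obtain ⟨w, h⟩ := hU.ex u v (fun hh => h (congrArg U hh))
    exact ⟨U w, h⟩

theorem APR.ofNp {V : Type*} {R : V → V → V → Prop} (s12 : ∀ x y z, R x y z → R y x z)
    (s23 : ∀ x y z, R x y z → R x z y) (ne : ∀ x y z, R x y z → x ≠ y)
    (ex : ∀ x y, x ≠ y → ∃ z, R x y z) (uq : ∀ x y z w, R x y z → R x y w → z = w)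
    (np : ∀ a b c d e f, ¬ Pasch R a b c d e f) : APR R := by
  refine ⟨s12, s23, ne, ex, uq, ?_⟩
  intro a b c d e f h1 h2 h3 h4
  by_contra h
  refine np a b c d e f ⟨h1, h2, h3, h4, h, ?_, ?_⟩
  · rintro rfl
    exact h (uq b e a d (s23 _ _ _ (s12 _ _ _ h1)) (s23 _ _ _ h2))
  · rintro rfl
    have := uq a e b c (s23 _ _ _ h1) (s23 _ _ _ h3)
    subst this
    exact h (uq b e a d (s23 _ _ _ (s12 _ _ _ h1)) (s23 _ _ _ h2))

theorem aps_big (hF : GoodF F) (hK : GoodK K) (hS : GoodS K σ) (h : APS (S ⊕ F ⊕ F)) :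
    APS (Pt F S) := by
  obtain ⟨RU, hU⟩ := h
  exact ⟨RR K σ RU, APR.ofNp (RR_s12 hF hK hU) (RR_s23 hF hK hU) (RR_ne hF hK hU)
    (RR_ex hF hK hS hU) (RR_uq hF hK hS hU) (RR_np hF hK hU)⟩

theorem aps_bose (hF : GoodF F) : APS (L3 × F) := by
  have hK : GoodK (fun κ : F => κ = 0) := by
    refine ⟨rfl, ?_, ?_, ?_⟩
    · rintro κ rfl; exact neg_zero
    · rintro _ rfl _ rfl _; rfl
    · rintro _ rfl _ rfl _; rfl
  refine ⟨fun p q r : L3 × F => SA (fun κ : F => κ = 0) p.1 p.2 q.1 q.2 r.1 r.2,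
    APR.ofNp (fun x y z h => SA_s12 hK h) (fun x y z h => SA_s23 hK h) ?_ ?_ ?_
    (SA_np hF hK)⟩
  · rintro ⟨i, x⟩ ⟨j, y⟩ ⟨k, z⟩ h heq
    obtain ⟨rfl, rfl⟩ := Prod.mk.injEq .. ▸ heq
    exact SA_ne hF hK h rfl
  · rintro ⟨i, x⟩ ⟨j, y⟩ hne
    by_cases hij : i = j
    · subst hij
      rcases SA_same hF hK i (x := x) (y := y) (fun hh => hne (by rw [hh])) with
        ⟨k, z, h⟩ | ⟨z, -, κ, rfl, h2, -⟩
      · exact ⟨(k, z), h⟩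
      · exact (h2 rfl).elim
    · obtain ⟨k, z, h⟩ := SA_diff hF hK hij x y
      exact ⟨(k, z), h⟩
  · rintro ⟨i, x⟩ ⟨j, y⟩ ⟨k, z⟩ ⟨l, w⟩ h h'
    obtain ⟨h1, h2⟩ := SA_uq hF hK h h'
    simp only at h1 h2
    rw [h1, h2]

end big


section recursion

theorem card_core {F : Type} [CommRing F] [Fintype F] [DecidableEq F] (hF : GoodF F)
    (T : Finset F) (h0 : 0 ∉ T) (hK : GoodK (fun κ : F => κ = 0 ∨ κ ∈ T))
    (hd : ∀ (i : L3) (κ μ : F), κ ∈ T → (μ = 0 ∨ μ ∈ T) → i.c * κ ≠ i.ng.c * (2 * μ))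
    (i : L3) : ∃ C : Finset F, C.card = Fintype.card F - 2 * T.card ∧
      2 * T.card ≤ Fintype.card F ∧
      ∀ d, (d ∈ C ↔ ¬ ((∃ κ ∈ T, d = i.c * κ) ∨ ∃ κ ∈ T, d = i.ng.c * (2 * κ))) := by
  set X := T.image (fun κ => i.c * κ)
  set Y := T.image (fun κ => i.ng.c * (2 * κ))
  have hX : X.card = T.card := by
    apply Finset.card_image_of_injOn
    intro a ha b hb hab
    simp only at hab
    exact hK.c5 hF i (Or.inr ha) (Or.inr hb) (by linear_combination 5 * hab)
  have hY : Y.card = T.card := by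
    apply Finset.card_image_of_injOn
    intro a ha b hb hab
    simp only at hab
    have hab : i.ng.c * a = i.ng.c * b := hF.can2 (by linear_combination hab)
    exact hK.c5 hF i.ng (Or.inr ha) (Or.inr hb) (by linear_combination 5 * hab)
  have hXY : Disjoint X Y := by
    rw [Finset.disjoint_left]
    intro d hd1 hd2
    obtain ⟨κ, k1, k2⟩ := Finset.mem_image.1 hd1
    obtain ⟨μ, m1, m2⟩ := Finset.mem_image.1 hd2
    exact hd i κ μ k1 (Or.inr m1) (by rw [k2, m2])
  have hcard : (X ∪ Y).card = 2 * T.card := by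
    rw [Finset.card_union_of_disjoint hXY, hX, hY, two_mul]
  refine ⟨(X ∪ Y)ᶜ, by rw [Finset.card_compl, hcard], hcard ▸ Finset.card_le_univ _, ?_⟩
  intro d
  simp only [Finset.mem_compl, Finset.mem_union, X, Y, Finset.mem_image, eq_comm]

def L3.equiv : L3 ≃ Fin 3 where
  toFun | l0 => 0 | l1 => 1 | l2 => 2
  invFun | 0 => l0 | 1 => l1 | 2 => l2
  left_inv i := by cases i <;> rfl
  right_inv i := by fin_cases i <;> rfl

def Pt.equiv (F S : Type) : Pt F S ≃ (L3 × F) ⊕ (L3 × F) ⊕ (S ⊕ F ⊕ F) where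
  toFun
    | .A i x => Sum.inl (i, x)
    | .B i x => Sum.inr (Sum.inl (i, x))
    | .U u => Sum.inr (Sum.inr u)
  invFun
    | Sum.inl (i, x) => .A i x
    | Sum.inr (Sum.inl (i, x)) => .B i x
    | Sum.inr (Sum.inr u) => .U u
  left_inv p := by cases p <;> rfl
  right_inv p := by rcases p with ⟨i, x⟩ | ⟨i, x⟩ | u <;> rfl

theorem APS.card {V W : Type*} [Fintype V] [Fintype W] (h : Fintype.card V = Fintype.card W)
    (hV : APS V) : APS W := hV.equiv (Fintype.equivOfCardEq h)

theorem rec_core {F : Type} [CommRing F] [Fintype F] [DecidableEq F] (hF : GoodF F)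
    (T : Finset F) (h0 : 0 ∉ T) (hK : GoodK (fun κ : F => κ = 0 ∨ κ ∈ T))
    (hd : ∀ (i : L3) (κ μ : F), κ ∈ T → (μ = 0 ∨ μ ∈ T) → i.c * κ ≠ i.ng.c * (2 * μ))
    (u v : ℕ) (hu : u + 2 * T.card = 3 * Fintype.card F)
    (hv : v + 2 * T.card = 9 * Fintype.card F) (h : APS (Fin u)) : APS (Fin v) := by
  classical
  choose C hC hle hmem using card_core hF T h0 hK hd
  have hle := hle l0
  set m := Fintype.card F - 2 * T.card with hm
  let σ : L3 → Fin m → F := fun i s => ((C i).equivFinOfCardEq (hC i)).symm s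
  have hσ : ∀ i s, σ i s ∈ C i := fun i s => ((C i).equivFinOfCardEq (hC i)).symm s |>.2
  have hS : GoodS (fun κ : F => κ = 0 ∨ κ ∈ T) σ := by
    refine ⟨?_, ?_, ?_, ?_, ?_⟩
    · intro i s t h
      exact ((C i).equivFinOfCardEq (hC i)).symm.injective (Subtype.ext h)
    · intro i d
      by_cases hdC : d ∈ C i
      · left
        refine ⟨(C i).equivFinOfCardEq (hC i) ⟨d, hdC⟩, ?_⟩
        simp [σ]
      · right
        rw [hmem, not_not] at hdC
        rcases hdC with ⟨κ, k1, k2⟩ | ⟨κ, k1, k2⟩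
        · left
          exact ⟨κ, Or.inr k1, fun h => h0 (h ▸ k1), k2⟩
        · right
          refine ⟨2 * κ, ⟨κ, Or.inr k1, rfl⟩, fun h => h0 (hF.of2 h ▸ k1), k2⟩
    · intro i s κ k1 k2 h
      refine ((hmem i _).1 (hσ i s)) (Or.inl ⟨κ, k1.resolve_left k2, h⟩)
    · rintro i s _ ⟨κ, k1, rfl⟩ k2 h
      refine ((hmem i _).1 (hσ i s)) (Or.inr ⟨κ, k1.resolve_left ?_, h⟩)
      rintro rfl
      exact k2 (mul_zero _)
    · rintro i κ _ k1 ⟨μ, k2, rfl⟩ k3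
      exact hd i κ μ (k1.resolve_left k3) k2
  have hU : APS (Fin m ⊕ F ⊕ F) := by
    refine APS.card ?_ h
    simp only [Fintype.card_sum, Fintype.card_fin]
    omega
  have := (aps_big hF hK hS hU).equiv ((Pt.equiv F (Fin m)).trans
    (Equiv.sumCongr (Equiv.prodCongr L3.equiv (Equiv.refl F))
      (Equiv.sumCongr (Equiv.prodCongr L3.equiv (Equiv.refl F)) (Equiv.refl _))))
  refine APS.card ?_ this
  simp only [Fintype.card_sum, Fintype.card_fin, Fintype.card_prod]
  omega

theorem goodF_zmod {n : ℕ} (h2 : n % 2 = 1) (h7 : n % 7 ≠ 0) : GoodF (ZMod n) := by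
  have e2 : Nat.Coprime 2 n := (Nat.Prime.coprime_iff_not_dvd (by norm_num)).2 (by omega)
  have e7 : Nat.Coprime 7 n := (Nat.Prime.coprime_iff_not_dvd (by norm_num)).2 (by omega)
  exact ⟨⟨_, by exact_mod_cast ZMod.coe_mul_inv_eq_one 2 e2⟩,
    ⟨_, by exact_mod_cast ZMod.coe_mul_inv_eq_one 7 e7⟩⟩

/-- Conditions on the list of positive slopes. -/
structure KOK (n : ℕ) (l : List ℕ) : Prop where
  nd : l.Nodup
  pos : ∀ x ∈ l, 0 < x
  lt : ∀ x ∈ 0 :: l, x < n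
  a15 : ∀ x ∈ 0 :: l, ∀ y ∈ 0 :: l, n ∣ 15 * (x + y) → x = 0 ∧ y = 0
  s15 : ∀ x ∈ 0 :: l, ∀ y ∈ 0 :: l, n ∣ 15 * (x + (n - y)) → x = y
  a25 : ∀ x ∈ 0 :: l, ∀ y ∈ 0 :: l, n ∣ 25 * (x + y) → x = 0 ∧ y = 0
  s25 : ∀ x ∈ 0 :: l, ∀ y ∈ 0 :: l, n ∣ 25 * (x + (n - y)) → x = y
  a12 : ∀ x ∈ 0 :: l, ∀ y ∈ 0 :: l, n ∣ x + 2 * y → x = 0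
  s12 : ∀ x ∈ 0 :: l, ∀ y ∈ 0 :: l, n ∣ x + 2 * (n - y) → x = 0
  a58 : ∀ x ∈ 0 :: l, ∀ y ∈ 0 :: l, n ∣ 5 * x + 8 * y → x = 0
  s58 : ∀ x ∈ 0 :: l, ∀ y ∈ 0 :: l, n ∣ 5 * x + 8 * (n - y) → x = 0
  a25' : ∀ x ∈ 0 :: l, ∀ y ∈ 0 :: l, n ∣ 2 * x + 5 * y → x = 0
  s25' : ∀ x ∈ 0 :: l, ∀ y ∈ 0 :: l, n ∣ 2 * x + 5 * (n - y) → x = 0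

theorem rec_num {n : ℕ} {l : List ℕ} (h2 : n % 2 = 1) (h7 : n % 7 ≠ 0) (hl : KOK n l)
    {u v : ℕ} (hu : u + 4 * l.length = 3 * n) (hv : v + 4 * l.length = 9 * n)
    (h : APS (Fin u)) : APS (Fin v) := by
  have : NeZero n := ⟨by omega⟩
  have hF := goodF_zmod h2 h7
  have dv : ∀ m : ℕ, (m : ZMod n) = 0 → n ∣ m := fun m => (ZMod.natCast_eq_zero_iff m n).1
  have sb : ∀ y ∈ 0 :: l, ((n - y : ℕ) : ZMod n) = -(y : ZMod n) := by
    intro y hy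
    rw [Nat.cast_sub (hl.lt y hy).le]
    simp
  let P := l.toFinset.image (fun x : ℕ => (x : ZMod n))
  let N := l.toFinset.image (fun x : ℕ => -(x : ZMod n))
  have mP : ∀ κ, κ ∈ P ↔ ∃ x ∈ l, κ = x := by simp [P, eq_comm]
  have mN : ∀ κ, κ ∈ N ↔ ∃ x ∈ l, κ = -(x : ZMod n) := by simp [N, eq_comm]
  have inj : ∀ x ∈ 0 :: l, ∀ y ∈ 0 :: l, (x : ZMod n) = y → x = y := by
    intro x hx y hy h
    refine hl.s15 x hx y hy (dv _ ?_)
    push_cast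
    rw [sb y hy, h]
    ring
  have hz : ∀ x ∈ l, (x : ZMod n) ≠ 0 := by
    intro x hx h
    have := inj x (List.mem_cons_of_mem _ hx) 0 List.mem_cons_self (by simpa using h)
    have := hl.pos x hx
    omega
  have cP : P.card = l.length := by
    rw [Finset.card_image_of_injOn, List.toFinset_card_of_nodup hl.nd]
    intro x hx y hy h
    simp only [List.coe_toFinset, Set.mem_setOf_eq] at hx hy
    exact inj x (List.mem_cons_of_mem _ hx) y (List.mem_cons_of_mem _ hy) h
  have cN : N.card = l.length := by
    rw [Finset.card_image_of_injOn, List.toFinset_card_of_nodup hl.nd]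
    intro x hx y hy h
    simp only [List.coe_toFinset, Set.mem_setOf_eq] at hx hy
    exact inj x (List.mem_cons_of_mem _ hx) y (List.mem_cons_of_mem _ hy) (neg_injective h)
  have dis : Disjoint P N := by
    rw [Finset.disjoint_left]
    intro κ h1 h2
    obtain ⟨x, hx, rfl⟩ := (mP κ).1 h1
    obtain ⟨y, hy, h⟩ := (mN _).1 h2
    have := hl.a15 x (List.mem_cons_of_mem _ hx) y (List.mem_cons_of_mem _ hy) (dv _ (by
      push_cast
      rw [h]
      ring))
    have := hl.pos x hx
    omega
  have cT : (P ∪ N).card = 2 * l.length := by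
    rw [Finset.card_union_of_disjoint dis, cP, cN, two_mul]
  have mT : ∀ κ, (κ = 0 ∨ κ ∈ P ∪ N) ↔ ∃ x ∈ 0 :: l, κ = x ∨ κ = -(x : ZMod n) := by
    intro κ
    rw [Finset.mem_union, mP, mN]
    constructor
    · rintro (rfl | ⟨x, hx, h⟩ | ⟨x, hx, h⟩)
      · exact ⟨0, List.mem_cons_self, by simp⟩
      · exact ⟨x, List.mem_cons_of_mem _ hx, Or.inl h⟩
      · exact ⟨x, List.mem_cons_of_mem _ hx, Or.inr h⟩
    · rintro ⟨x, hx, h⟩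
      rcases List.mem_cons.1 hx with rfl | hx
      · left
        simpa using h
      · rcases h with h | h
        · exact Or.inr (Or.inl ⟨x, hx, h⟩)
        · exact Or.inr (Or.inr ⟨x, hx, h⟩)
  have zT : (0 : ZMod n) ∉ P ∪ N := by
    rw [Finset.mem_union, mP, mN]
    rintro (⟨x, hx, h⟩ | ⟨x, hx, h⟩)
    · exact hz x hx h.symm
    · exact hz x hx (by linear_combination h)
  have key : ∀ p q : ℕ, (∀ x ∈ 0 :: l, ∀ y ∈ 0 :: l, n ∣ p * x + q * y → x = 0) →
      (∀ x ∈ 0 :: l, ∀ y ∈ 0 :: l, n ∣ p * x + q * (n - y) → x = 0) →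
      ∀ κ μ : ZMod n, κ ∈ P ∪ N → (μ = 0 ∨ μ ∈ P ∪ N) → (p : ZMod n) * κ + q * μ ≠ 0 := by
    intro p q ha hs κ μ hκ hμ h
    obtain ⟨y, hy, h2⟩ := (mT μ).1 hμ
    have fin : ∀ x ∈ l, x = 0 → False := fun x hx h => by
      have := hl.pos x hx
      omega
    rw [Finset.mem_union, mP, mN] at hκ
    rcases hκ with ⟨x, hx, rfl⟩ | ⟨x, hx, rfl⟩ <;> rcases h2 with rfl | rfl <;>
      refine fin x hx ?_ <;> have hx' := List.mem_cons_of_mem 0 hx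
    · exact ha x hx' y hy (dv _ (by push_cast; exact h))
    · exact hs x hx' y hy (dv _ (by push_cast; rw [sb y hy]; exact h))
    · exact hs x hx' y hy (dv _ (by push_cast; rw [sb y hy]; linear_combination -h))
    · exact ha x hx' y hy (dv _ (by push_cast; linear_combination -h))
  have key2 : ∀ p : ℕ, (∀ x ∈ 0 :: l, ∀ y ∈ 0 :: l, n ∣ p * (x + y) → x = 0 ∧ y = 0) →
      (∀ x ∈ 0 :: l, ∀ y ∈ 0 :: l, n ∣ p * (x + (n - y)) → x = y) →
      ∀ κ : ZMod n, (κ = 0 ∨ κ ∈ P ∪ N) → ∀ μ, (μ = 0 ∨ μ ∈ P ∪ N) →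
        (p : ZMod n) * (κ - μ) = 0 → κ = μ := by
    intro p ha hs κ hκ μ hμ h
    obtain ⟨x, hx, h1⟩ := (mT κ).1 hκ
    obtain ⟨y, hy, h2⟩ := (mT μ).1 hμ
    rcases h1 with rfl | rfl <;> rcases h2 with rfl | rfl
    · rw [hs x hx y hy (dv _ (by push_cast; rw [sb y hy]; linear_combination h))]
    · obtain ⟨rfl, rfl⟩ := ha x hx y hy (dv _ (by push_cast; linear_combination h))
      simp
    · obtain ⟨rfl, rfl⟩ := ha x hx y hy (dv _ (by push_cast; linear_combination -h))
      simp
    · rw [hs x hx y hy (dv _ (by push_cast; rw [sb y hy]; linear_combination -h))]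
  have neg : ∀ κ : ZMod n, (κ = 0 ∨ κ ∈ P ∪ N) → (-κ = 0 ∨ -κ ∈ P ∪ N) := by
    intro κ hκ
    obtain ⟨x, hx, h⟩ := (mT κ).1 hκ
    refine (mT _).2 ⟨x, hx, ?_⟩
    rcases h with rfl | rfl
    · exact Or.inr rfl
    · exact Or.inl (neg_neg _)
  have hK : GoodK (fun κ : ZMod n => κ = 0 ∨ κ ∈ P ∪ N) :=
    ⟨Or.inl rfl, neg, key2 15 hl.a15 hl.s15, key2 25 hl.a25 hl.s25⟩
  refine rec_core hF (P ∪ N) zT hK ?_ u v ?_ ?_ h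
  · intro i κ μ hκ hμ h
    cases i <;> simp only [L3.c, L3.ng] at h
    · refine key 1 2 (by simpa using hl.a12) (by simpa using hl.s12) κ (-μ) hκ (neg μ hμ) ?_
      push_cast
      linear_combination h
    · refine key 5 8 hl.a58 hl.s58 κ μ hκ hμ ?_
      push_cast
      linear_combination -h
    · refine key 2 5 hl.a25' hl.s25' κ μ hκ hμ (hF.of2 ?_)
      push_cast
      linear_combination h
  · rw [cT, ZMod.card]; omega
  · rw [cT, ZMod.card]; omega

theorem bose_num {v : ℕ} (h : v % 6 = 3) (h7 : v % 7 ≠ 0) : APS (Fin v) := by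
  have hF := goodF_zmod (n := v / 3) (by omega) (by omega)
  have : NeZero (v / 3) := ⟨by omega⟩
  refine APS.card ?_ ((aps_bose hF).equiv (Equiv.prodCongr L3.equiv (Equiv.refl _)))
  simp only [Fintype.card_prod, Fintype.card_fin, ZMod.card]
  omega

/-- A slope set without forbidden ratios. -/
def defK : List ℕ := [1, 3, 4, 5, 7, 9, 11, 12, 13, 15, 16, 17, 19, 20, 21, 23, 25]

theorem dvd_small {n p d M : ℕ} (hn : 0 < n) (hM : M < n / n.gcd p) (hd : n ∣ p * d)
    (h : d ≤ M) : d = 0 := by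
  have h1 : n / n.gcd p ∣ d := by
    have hg : 0 < n.gcd p := Nat.gcd_pos_of_pos_left _ hn
    have h2 : n / n.gcd p ∣ (p / n.gcd p) * d := by
      apply Nat.dvd_of_mul_dvd_mul_left hg
      rw [← mul_assoc, Nat.mul_div_cancel' (Nat.gcd_dvd_left n p),
        Nat.mul_div_cancel' (Nat.gcd_dvd_right n p)]
      exact hd
    exact (Nat.coprime_div_gcd_div_gcd hg).dvd_of_dvd_mul_left h2
  by_contra h0
  have := Nat.le_of_dvd (Nat.pos_of_ne_zero h0) h1
  omega

theorem KOK_gen {n M : ℕ} {l : List ℕ} (hl : l.Sublist defK) (hM : ∀ x ∈ l, x ≤ M)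
    (h1 : 13 * M < n) (h15 : 2 * M < n / n.gcd 15) (h25 : 2 * M < n / n.gcd 25) : KOK n l := by
  have hn : 0 < n := by omega
  have hM' : ∀ x ∈ 0 :: l, x ≤ M := by
    intro x hx
    rcases List.mem_cons.1 hx with rfl | hx
    · omega
    · exact hM x hx
  have hl' : ∀ x ∈ 0 :: l, x ∈ 0 :: defK := by
    intro x hx
    rcases List.mem_cons.1 hx with rfl | hx
    · exact List.mem_cons_self
    · exact List.mem_cons_of_mem _ (hl.subset hx)
  have q : ∀ x ∈ 0 :: defK, ∀ y ∈ 0 :: defK, (x = 2 * y → x = 0) ∧ (5 * x = 8 * y → x = 0) ∧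
      (2 * x = 5 * y → x = 0) := by decide +kernel
  -- two integers congruent modulo `n` and close to each other are equal
  have cong : ∀ a b w : ℕ, n ∣ a + (w * n - b) → b ≤ w * n → a < n → b < n → a = b := by
    intro a b w h1 h2 ha hb
    have : ((a : ℤ) - b) % n = 0 := by
      have h3 : (n : ℤ) ∣ (a + (w * n - b : ℤ)) := by
        have : ((a + (w * n - b) : ℕ) : ℤ) = a + (w * n - b : ℤ) := by
          push_cast [Nat.cast_sub h2]
          ring
        rw [← this]
        exact_mod_cast h1
      apply Int.emod_eq_zero_of_dvd
      have h4 : (a : ℤ) - b = (a + (w * n - b : ℤ)) - w * n := by ring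
      rw [h4]
      exact dvd_sub h3 (Dvd.intro_left _ rfl)
    have h5 := Int.emod_eq_emod_iff_emod_sub_eq_zero.2 this
    rw [Int.emod_eq_of_lt (by omega) (by omega), Int.emod_eq_of_lt (by omega) (by omega)] at h5
    exact_mod_cast h5
  have sub : ∀ p, 2 * M < n / n.gcd p → ∀ x ≤ M, ∀ y ≤ M, n ∣ p * (x + (n - y)) → x = y := by
    intro p hp x hx y hy h
    rcases le_total y x with hxy | hxy
    · have : n ∣ p * (x - y) := by
        have e : p * (x + (n - y)) = p * (x - y) + n * p := by
          obtain ⟨d, rfl⟩ := Nat.exists_eq_add_of_le hxy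
          obtain ⟨m, rfl⟩ := Nat.exists_eq_add_of_le (show y ≤ n by omega)
          simp only [Nat.add_sub_cancel_left]
          ring
        rw [e] at h
        exact (Nat.dvd_add_left (Dvd.intro _ rfl)).1 h
      have := dvd_small hn hp this (by omega)
      omega
    · have : n ∣ p * (y - x) := by
        have e : p * (x + (n - y)) + p * (y - x) = n * p := by
          obtain ⟨d, rfl⟩ := Nat.exists_eq_add_of_le hxy
          obtain ⟨m, rfl⟩ := Nat.exists_eq_add_of_le (show x + d ≤ n by omega)
          simp only [Nat.add_sub_cancel_left]
          ring
        exact (Nat.dvd_add_right h).1 (e ▸ Dvd.intro _ rfl)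
      have := dvd_small hn hp this (by omega)
      omega
  have zer : ∀ a : ℕ, n ∣ a → a < n → a = 0 := fun a h1 h2 => Nat.eq_zero_of_dvd_of_lt h1 h2
  refine ⟨hl.nodup (by decide), ?_, ?_, ?_, ?_, ?_, ?_, ?_, ?_, ?_, ?_, ?_, ?_⟩
  · intro x hx
    have : ∀ x ∈ defK, 0 < x := by decide
    exact this x (hl.subset hx)
  · intro x hx
    have := hM' x hx
    omega
  all_goals
    intro x hx y hy h
    have bx := hM' x hx
    have bY := hM' y hy
    have qq := q x (hl' x hx) y (hl' y hy)
  · have := dvd_small hn h15 h (by omega)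
    omega
  · exact sub 15 h15 x bx y bY h
  · have := dvd_small hn h25 h (by omega)
    omega
  · exact sub 25 h25 x bx y bY h
  · have := zer _ h (by omega)
    omega
  · exact qq.1 (cong x (2 * y) 2 (by rwa [Nat.mul_sub] at h) (by omega) (by omega) (by omega))
  · have := zer _ h (by omega)
    omega
  · exact qq.2.1 (cong (5 * x) (8 * y) 8 (by rwa [Nat.mul_sub] at h) (by omega) (by omega)
      (by omega))
  · have := zer _ h (by omega)
    omega
  · exact qq.2.2 (cong (2 * x) (5 * y) 5 (by rwa [Nat.mul_sub] at h) (by omega) (by omega)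
      (by omega))

end recursion


section table

def baseL : List ℕ := [
  19, 21, 25, 31, 37, 43, 49, 55, 61, 67, 73, 79, 85, 91, 97, 103, 105, 109, 115, 121, 127,
  133, 139, 151, 157, 169, 175, 181, 187, 193, 205, 211, 217, 223, 229, 231, 247, 259, 265,
  277, 283, 295, 301, 307, 319, 331, 355, 373, 385, 397, 409, 421, 427, 433, 463, 481, 535,
  547, 553, 643, 661, 673, 787, 799, 811, 1039]

theorem baseL_aps (v : ℕ) (h : baseL.any (Nat.beq v) = true) : APS (Fin v) := by
  rw [List.any_eq_true] at h
  obtain ⟨w, h, e⟩ := h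
  have e := Nat.eq_of_beq_eq_true e
  subst e
  simp only [baseL, List.mem_cons, List.not_mem_nil, or_false] at h
  rcases h with rfl | rfl | rfl | rfl | rfl | rfl | rfl | rfl | rfl | rfl | rfl | rfl | rfl | rfl | rfl | rfl | rfl | rfl | rfl | rfl | rfl | rfl | rfl | rfl | rfl | rfl | rfl | rfl | rfl | rfl | rfl | rfl | rfl | rfl | rfl | rfl | rfl | rfl | rfl | rfl | rfl | rfl | rfl | rfl | rfl | rfl | rfl | rfl | rfl | rfl | rfl | rfl | rfl | rfl | rfl | rfl | rfl | rfl | rfl | rfl | rfl | rfl | rfl | rfl | rfl | rfl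
  · exact aps_19
  · exact aps_21
  · exact aps_25
  · exact aps_31
  · exact aps_37
  · exact aps_43
  · exact aps_49
  · exact aps_55
  · exact aps_61
  · exact aps_67
  · exact aps_73
  · exact aps_79
  · exact aps_85
  · exact aps_91
  · exact aps_97
  · exact aps_103
  · exact aps_105
  · exact aps_109
  · exact aps_115
  · exact aps_121
  · exact aps_127
  · exact aps_133
  · exact aps_139
  · exact aps_151
  · exact aps_157
  · exact aps_169
  · exact aps_175
  · exact aps_181
  · exact aps_187
  · exact aps_193
  · exact aps_205
  · exact aps_211
  · exact aps_217
  · exact aps_223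
  · exact aps_229
  · exact aps_231
  · exact aps_247
  · exact aps_259
  · exact aps_265
  · exact aps_277
  · exact aps_283
  · exact aps_295
  · exact aps_301
  · exact aps_307
  · exact aps_319
  · exact aps_331
  · exact aps_355
  · exact aps_373
  · exact aps_385
  · exact aps_397
  · exact aps_409
  · exact aps_421
  · exact aps_427
  · exact aps_433
  · exact aps_463
  · exact aps_481
  · exact aps_535
  · exact aps_547
  · exact aps_553
  · exact aps_643
  · exact aps_661
  · exact aps_673
  · exact aps_787
  · exact aps_799
  · exact aps_811
  · exact aps_1039

/-- Small orders with an explicit slope set: order, modulus, slopes. -/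
def spec : List (ℕ × ℕ × List ℕ) := [
  (145, 17, [1, 4]), (163, 19, [1, 4]), (199, 23, [1, 4]), (235, 27, [1, 3]),
  (241, 29, [1, 4, 5, 6, 7]), (253, 29, [1, 4]), (271, 31, [1, 3]), (289, 33, [1, 3]),
  (313, 37, [3, 4, 5, 7, 13]), (325, 37, [1, 3]), (337, 41, [1, 3, 4, 5, 9, 11, 14, 17]),
  (343, 39, [1, 4]), (349, 41, [1, 3, 4, 5, 9]), (357, 41, [1, 3, 4]),
  (367, 43, [1, 3, 4, 5, 11]), (391, 47, [1, 3, 5, 7, 12, 13, 15, 18]),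
  (403, 47, [1, 3, 5, 7, 12]), (439, 51, [1, 3, 4, 5, 11]),
  (445, 53, [1, 3, 4, 5, 7, 12, 13, 15]), (457, 53, [1, 3, 4, 5, 7]),
  (493, 57, [5, 9, 20, 21, 22]), (499, 59, [1, 3, 4, 5, 9, 11, 12, 14]),
  (511, 59, [1, 3, 4, 5, 9]), (517, 61, [1, 3, 4, 5, 9, 12, 13, 14]),
  (529, 61, [1, 3, 4, 5, 9]), (559, 67, [1, 3, 4, 5, 11, 12, 14, 16, 17, 18, 23]),
  (565, 65, [1, 3, 4, 7, 11]), (571, 67, [1, 3, 4, 5, 11, 12, 14, 16]),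
  (583, 67, [1, 3, 4, 5, 11]), (601, 69, [1, 3, 4, 5, 7]),
  (607, 71, [1, 3, 4, 5, 9, 11, 15, 16]), (619, 71, [1, 3, 4, 5, 9]),
  (637, 73, [1, 3, 4, 5, 7]), (655, 79, [1, 3, 4, 5, 7, 9, 12, 15, 16, 19, 20, 21, 25, 26]),
  (667, 79, [1, 3, 4, 5, 7, 9, 12, 15, 16, 19, 20]), (679, 79, [1, 3, 4, 5, 7, 9, 12, 15]),
  (685, 81, [1, 3, 4, 5, 9, 11, 14, 19, 20, 25, 37]), (691, 79, [1, 3, 4, 5, 7]),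
  (697, 81, [1, 3, 4, 5, 9, 11, 14, 19]), (709, 81, [1, 3, 4, 5, 9]),
  (715, 83, [1, 3, 4, 5, 7, 9, 12, 20]), (727, 83, [1, 3, 4, 5, 7]),
  (733, 85, [4, 16, 19, 22, 23, 26, 27, 37]), (745, 85, [1, 3, 4, 5, 7]),
  (751, 87, [1, 3, 4, 5, 7, 12, 13, 15]), (763, 87, [1, 3, 4, 5, 7]),
  (769, 89, [1, 3, 4, 5, 7, 9, 11, 12]), (781, 89, [1, 3, 4, 5, 7]),
  (805, 93, [1, 3, 4, 5, 7, 9, 12, 13]), (823, 95, [2, 7, 22, 32, 34, 43, 46, 47]),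
  (841, 97, [1, 3, 4, 5, 7, 11, 12, 16]), (859, 99, [1, 3, 4, 5, 7, 9, 11, 12]),
  (877, 101, [1, 3, 4, 5, 7, 11, 13, 16]), (895, 103, [1, 3, 4, 5, 7, 9, 12, 13]),
  (913, 109, [1, 3, 4, 5, 7, 9, 11, 12, 15, 16, 20, 21, 25, 28, 29, 31, 35]),
  (937, 109, [1, 3, 4, 5, 7, 9, 11, 12, 15, 16, 20]), (949, 109, [1, 3, 4, 5, 7, 9, 11, 12]),
  (967, 111, [1, 3, 4, 5, 7, 9, 13, 15]), (985, 113, [1, 3, 4, 5, 7, 9, 12, 13]),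
  (1003, 115, [1, 3, 4, 5, 7, 9, 11, 13]), (1021, 117, [1, 3, 4, 5, 7, 11, 12, 13]),
  (1051, 123, [1, 3, 4, 5, 7, 9, 12, 13, 15, 17, 20, 27, 33, 35]),
  (1057, 121, [1, 3, 4, 5, 7, 9, 11, 15]), (1063, 123, [1, 3, 4, 5, 7, 9, 12, 13, 15, 17, 20]),
  (1093, 129, [1, 3, 4, 5, 7, 9, 11, 12, 15, 16, 17, 20, 25, 29, 33, 35, 41]),
  (1105, 129, [1, 3, 4, 5, 7, 9, 11, 12, 15, 16, 17, 20, 25, 29]),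
  (1111, 127, [1, 3, 4, 5, 7, 9, 12, 13]),
  (1113, 129, [1, 3, 4, 5, 7, 9, 11, 12, 15, 16, 17, 20]), (1117, 125, [1, 3]),
  (1129, 129, [1, 3, 4, 5, 7, 9, 11, 12]),
  (1165, 137, [1, 3, 4, 5, 7, 9, 11, 12, 15, 16, 17, 20, 25, 28, 33, 35, 36]),
  (1177, 137, [1, 3, 4, 5, 7, 9, 11, 12, 15, 16, 17, 20, 25, 28]),
  (1183, 139, [1, 3, 4, 5, 7, 9, 11, 12, 15, 16, 17, 19, 20, 26, 31, 33, 35]),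
  (1189, 137, [1, 3, 4, 5, 7, 9, 11, 12, 15, 16, 17]),
  (1195, 139, [1, 3, 4, 5, 7, 9, 11, 12, 15, 16, 17, 19, 20, 26]),
  (1201, 137, [1, 3, 4, 5, 7, 9, 11, 12]), (1219, 139, [1, 3, 4, 5, 7, 9, 11, 12]),
  (1237, 141, [1, 3, 4, 5, 7, 9, 11, 13]), (1255, 143, [1, 3, 4, 5, 7, 9, 12, 13]),
  (1291, 151, [1, 3, 4, 5, 7, 9, 11, 13, 15, 16, 20, 21, 28, 31, 34, 36, 37]),
  (1303, 151, [1, 3, 4, 5, 7, 9, 11, 13, 15, 16, 20, 21, 28, 31]),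
  (1309, 149, [1, 3, 4, 5, 7, 9, 11, 12]), (1315, 151, [1, 3, 4, 5, 7, 9, 11, 13, 15, 16, 20]),
  (1327, 151, [1, 3, 4, 5, 7, 9, 11, 13]), (1345, 153, [1, 3, 4, 5, 7, 9, 11, 12]),
  (1363, 155, [1, 3, 4, 5, 7, 9, 11, 12]),
  (1417, 169, [1, 3, 4, 5, 7, 9, 11, 12, 15, 16, 17, 19, 20, 21, 25, 36, 41, 43, 44, 46, 49, 55, 56, 58, 70, 73]),
  (1429, 169, [1, 3, 4, 5, 7, 9, 11, 12, 15, 16, 17, 19, 20, 21, 25, 36, 41, 43, 44, 46, 49, 55, 56]),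
  (1441, 169, [1, 3, 4, 5, 7, 9, 11, 12, 15, 16, 17, 19, 20, 21, 25, 36, 41, 43, 44, 46]),
  (1453, 169, [1, 3, 4, 5, 7, 9, 11, 12, 15, 16, 17, 19, 20, 21, 25, 36, 41]),
  (1465, 165, [1, 3, 4, 5, 9]),
  (1543, 179, [1, 3, 4, 5, 7, 9, 11, 12, 13, 16, 17, 19, 20, 21, 25, 35, 36]),
  (1555, 179, [1, 3, 4, 5, 7, 9, 11, 12, 13, 16, 17, 19, 20, 21]),
  (1567, 179, [1, 3, 4, 5, 7, 9, 11, 12, 13, 16, 17]),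
  (1669, 193, [1, 3, 4, 5, 7, 9, 11, 12, 13, 15, 17, 19, 20, 23, 25, 27, 28]),
  (1681, 193, [1, 3, 4, 5, 7, 9, 11, 12, 13, 15, 17, 19, 20, 23]),
  (1693, 193, [1, 3, 4, 5, 7, 9, 11, 12, 13, 15, 17]),
  (1723, 199, [1, 3, 4, 5, 7, 9, 11, 12, 13, 15, 16, 17, 20, 21, 25, 27, 31]),
  (1735, 195, [1, 3, 4, 5, 7]),
  (1795, 207, [1, 3, 4, 5, 7, 9, 11, 12, 13, 15, 16, 17, 20, 21, 23, 25, 28]),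
  (1807, 207, [1, 3, 4, 5, 7, 9, 11, 12, 13, 15, 16, 17, 20, 21]),
  (1819, 207, [1, 3, 4, 5, 7, 9, 11, 12, 13, 15, 16]),
  (1921, 221, [1, 3, 4, 5, 7, 9, 11, 12, 13, 15, 16, 19, 20, 21, 23, 28, 29]),
  (1933, 221, [1, 3, 4, 5, 7, 9, 11, 12, 13, 15, 16, 19, 20, 21]),
  (1993, 229, [1, 3, 4, 5, 7, 9, 11, 12, 13, 15, 16, 17, 19, 20, 21, 27, 29]),
  (2005, 229, [1, 3, 4, 5, 7, 9, 11, 12, 13, 15, 16, 17, 19, 20]),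
  (2047, 235, [1, 3, 4, 5, 7, 9, 11, 12, 13, 15, 16, 17, 19, 21, 27, 29, 33]),
  (2059, 235, [1, 3, 4, 5, 7, 9, 11, 12, 13, 15, 16, 17, 19, 21]),
  (2173, 249, [1, 3, 4, 5, 7, 9, 11, 12, 13, 15, 16, 17, 19, 20, 21, 25, 27]),
  (2443, 279, [1, 3, 4, 5, 7, 9, 11, 12, 13, 15, 16, 17, 19, 20, 21, 25, 27]),
  (2533, 285, [1, 3, 4, 5, 7, 9, 11, 13]),
  (2551, 291, [1, 3, 4, 5, 7, 9, 11, 12, 13, 15, 16, 17, 19, 20, 21, 23, 25]),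
  (2677, 305, [1, 3, 4, 5, 7, 9, 11, 12, 13, 15, 16, 17, 19, 20, 21, 23, 27]),
  (2803, 319, [1, 3, 4, 5, 7, 9, 11, 12, 13, 15, 16, 17, 19, 20, 21, 23, 25]),
  (2893, 333, [1, 3, 4, 5, 7, 9, 11, 12, 13, 15, 16, 17, 19, 20, 21, 23, 25, 27, 28, 29, 35, 37, 39, 43, 44, 45]),
  (2905, 325, [1, 3, 4, 5, 7]),
  (3307, 379, [1, 3, 4, 5, 7, 9, 11, 12, 13, 15, 16, 17, 19, 20, 21, 23, 25, 27, 28, 29, 35, 36, 37, 41, 44, 45]),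
  (3319, 379, [1, 3, 4, 5, 7, 9, 11, 12, 13, 15, 16, 17, 19, 20, 21, 23, 25, 27, 28, 29, 35, 36, 37]),
  (3331, 379, [1, 3, 4, 5, 7, 9, 11, 12, 13, 15, 16, 17, 19, 20, 21, 23, 25, 27, 28, 29]),
  (5197, 585, [1, 3, 4, 5, 7, 9, 11, 12, 13, 15, 16, 17, 19, 21, 25, 29, 31]),
  (5209, 585, [1, 3, 4, 5, 7, 9, 11, 12, 13, 15, 16, 17, 19, 21]),
  (6457, 729, [1, 3, 4, 5, 7, 9, 11, 12, 13, 15, 16, 17, 19, 20, 21, 23, 25, 27, 28, 29, 31, 33, 35, 36, 37, 39]),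
  (6469, 725, [1, 3, 4, 5, 7, 9, 11, 12, 13, 15, 19, 21, 23, 27]),
  (6481, 725, [1, 3, 4, 5, 7, 9, 11, 12, 13, 15, 19]),
  (9607, 1075, [1, 3, 4, 5, 7, 9, 11, 12, 13, 15, 16, 17, 19, 20, 21, 25, 29])]

/-- `n` divides `a` -/
def dvB (n a : ℕ) : Bool := Nat.beq (a % n) 0

theorem dvB_eq {n a : ℕ} (h : n ∣ a) : dvB n a = true := by
  simp [dvB, Nat.mod_eq_zero_of_dvd h]

def isZ : ℕ → Bool
  | 0 => true
  | _ => false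

def pairChk (n x y : ℕ) : Bool :=
  force (x + y) (fun s => force (x + (n - y)) (fun t => force (n - y) (fun z =>
    (isZ s || !(dvB n (15 * s)) && !(dvB n (25 * s))) &&
    (Nat.beq x y || !(dvB n (15 * t)) && !(dvB n (25 * t))) &&
    (isZ x || !(dvB n (x + 2 * y)) && !(dvB n (x + 2 * z)) && !(dvB n (5 * x + 8 * y)) &&
      !(dvB n (5 * x + 8 * z)) && !(dvB n (2 * x + 5 * y)) && !(dvB n (2 * x + 5 * z))))))

def ndChk : List ℕ → Bool
  | [] => true
  | x :: l => l.all (fun y => !(Nat.beq x y)) && ndChk l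

theorem ndChk_spec {l : List ℕ} (h : ndChk l = true) : l.Nodup := by
  induction l with
  | nil => exact List.nodup_nil
  | cons x l ih =>
    simp only [ndChk, Bool.and_eq_true, List.all_eq_true] at h
    refine List.nodup_cons.2 ⟨fun hx => ?_, ih h.2⟩
    have := h.1 x hx
    simp at this

def listChk (n : ℕ) (l : List ℕ) : Bool :=
  ndChk l && l.all (fun x => Nat.ble 1 x && Nat.ble (x + 1) n) &&
    (0 :: l).all (fun x => (0 :: l).all (fun y => pairChk n x y))

theorem listChk_spec {n : ℕ} (hn : 0 < n) {l : List ℕ} (h : listChk n l = true) : KOK n l := by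
  simp only [listChk, Bool.and_eq_true, List.all_eq_true (l := l), Nat.ble_eq] at h
  obtain ⟨⟨h1, h2⟩, h3⟩ := h
  rw [List.all_eq_true] at h3
  have h4 : ∀ x ∈ 0 :: l, ∀ y ∈ 0 :: l, pairChk n x y = true := by
    intro x hx
    have := h3 x hx
    rwa [List.all_eq_true] at this
  simp only [pairChk, force_eq, Bool.and_eq_true, Bool.or_eq_true, Bool.not_eq_true'] at h4
  have z : ∀ x, isZ x = true → x = 0 := by
    intro x hx
    cases x
    · rfl
    · cases hx
  have d : ∀ {a}, n ∣ a → dvB n a = false → False := by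
    intro a h1 h2
    rw [dvB_eq h1] at h2
    cases h2
  refine ⟨ndChk_spec h1, fun x hx => (h2 x hx).1, ?_, ?_, ?_, ?_, ?_, ?_, ?_, ?_, ?_, ?_, ?_⟩
  · intro x hx
    rcases List.mem_cons.1 hx with rfl | hx
    · exact hn
    · exact (h2 x hx).2
  all_goals
    intro x hx y hy hd
    obtain ⟨⟨k1, k2⟩, k3⟩ := h4 x hx y hy
  · rcases k1 with k1 | k1
    · have := z _ k1
      omega
    · exact (d hd k1.1).elim
  · rcases k2 with k2 | k2
    · exact Nat.eq_of_beq_eq_true k2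
    · exact (d hd k2.1).elim
  · rcases k1 with k1 | k1
    · have := z _ k1
      omega
    · exact (d hd k1.2).elim
  · rcases k2 with k2 | k2
    · exact Nat.eq_of_beq_eq_true k2
    · exact (d hd k2.2).elim
  all_goals
    rcases k3 with k3 | k3
    · exact z _ k3
  · exact (d hd k3.1.1.1.1.1).elim
  · exact (d hd k3.1.1.1.1.2).elim
  · exact (d hd k3.1.1.1.2).elim
  · exact (d hd k3.1.1.2).elim
  · exact (d hd k3.1.2).elim
  · exact (d hd k3.2).elim

theorem beqT {a b : ℕ} : Nat.beq a b = true ↔ a = b :=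
  ⟨Nat.eq_of_beq_eq_true, fun h => h ▸ Nat.beq_refl a⟩

theorem beqF {a b : ℕ} : Nat.beq a b = false ↔ a ≠ b := by
  rw [← Bool.not_eq_true, beqT]

/-- admissible orders -/
def Adm (v : ℕ) : Prop := (v % 6 = 1 ∨ v % 6 = 3) ∧ v ≠ 7 ∧ v ≠ 13

def admB (v : ℕ) : Bool :=
  (Nat.beq (v % 6) 1 || Nat.beq (v % 6) 3) && !(Nat.beq v 7) && !(Nat.beq v 13)

theorem admB_iff {v : ℕ} : admB v = true ↔ Adm v := by
  simp only [admB, Adm, Bool.and_eq_true, Bool.or_eq_true, Bool.not_eq_true', beqT, beqF, and_assoc]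

/-- arithmetic part of the recursion -/
def arith (v n g : ℕ) : Bool :=
  Nat.beq (v + 4 * g) (9 * n) && !(Nat.beq (n % 7) 0) && Nat.ble (4 * g) (3 * n) &&
    admB (3 * n - 4 * g)

theorem arith_spec {v n g : ℕ} (h : arith v n g = true) (hv : Adm v) : v + 4 * g = 9 * n ∧
    n % 7 ≠ 0 ∧ n % 2 = 1 ∧ ∃ u, u < v ∧ Adm u ∧ u + 4 * g = 3 * n := by
  simp only [arith, Bool.and_eq_true, beqT, Bool.not_eq_true', Nat.ble_eq,
    admB_iff, beqF] at h
  obtain ⟨⟨⟨h1, h2⟩, h3⟩, h4⟩ := h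
  have := hv.1
  refine ⟨h1, h2, by omega, 3 * n - 4 * g, by omega, h4, by omega⟩

theorem spec_ok : spec.all (fun t => listChk t.2.1 t.2.2 && arith t.1 t.2.1 t.2.2.length) =
    true := by decide +kernel

def genChk (v g : ℕ) : Bool :=
  force ((v + 4 * g) / 9) (fun n => force ((defK.take g).getLastD 0) (fun M =>
    arith v n g && Nat.ble g 17 && (defK.take g).all (fun x => Nat.ble x M) &&
      Nat.ble (13 * M + 1) n && Nat.ble (2 * M + 1) (n / Nat.gcd n 15) &&
      Nat.ble (2 * M + 1) (n / Nat.gcd n 25)))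

theorem gen_step {v n g M : ℕ} (h1 : v + 4 * g = 9 * n) (h2 : n % 7 ≠ 0) (h3 : n % 2 = 1)
    (hg : g ≤ 17) (hM : ∀ x ∈ defK.take g, x ≤ M) (b1 : 13 * M < n)
    (b2 : 2 * M < n / n.gcd 15) (b3 : 2 * M < n / n.gcd 25) {u : ℕ} (hu : u + 4 * g = 3 * n)
    (h : APS (Fin u)) : APS (Fin v) := by
  have hl : (defK.take g).length = g := by
    rw [List.length_take]
    exact min_eq_left hg
  exact rec_num h3 h2 (KOK_gen (List.take_sublist g defK) hM b1 b2 b3) (by rw [hl]; exact hu)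
    (by rw [hl]; exact h1) h

theorem genChk_spec {v g : ℕ} (h : genChk v g = true) (hv : Adm v)
    (ih : ∀ u < v, Adm u → APS (Fin u)) : APS (Fin v) := by
  simp only [genChk, force_eq, Bool.and_eq_true, List.all_eq_true, Nat.ble_eq] at h
  obtain ⟨⟨⟨⟨⟨h1, h2⟩, h3⟩, h4⟩, h5⟩, h6⟩ := h
  obtain ⟨a1, a2, a3, u, a4, a5, a6⟩ := arith_spec h1 hv
  exact gen_step a1 a2 a3 h2 h3 (by omega) (by omega) (by omega) a6 (ih u a4 a5)

def prodChk (v d : ℕ) : Bool :=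
  Nat.beq (d * (v / d)) v && admB d && admB (v / d) && Nat.ble 2 d && Nat.ble 2 (v / d)

theorem APS.mul {a b : ℕ} (ha : APS (Fin a)) (hb : APS (Fin b)) : APS (Fin (a * b)) :=
  APS.card (by simp) (ha.prod hb)

theorem prodChk_spec {v d : ℕ} (h : prodChk v d = true) (ih : ∀ u < v, Adm u → APS (Fin u)) :
    APS (Fin v) := by
  simp only [prodChk, Bool.and_eq_true, beqT, admB_iff, Nat.ble_eq] at h
  obtain ⟨⟨⟨⟨h1, h2⟩, h3⟩, h4⟩, h5⟩ := h
  generalize v / d = e at *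
  subst h1
  have m1 := Nat.mul_le_mul_left d h5
  have m2 := Nat.mul_le_mul_right e h4
  exact APS.mul (ih d (by omega) h2) (ih e (by omega) h3)

def gOf (v : ℕ) : ℕ :=
  [0, 2, 0, 6, 0, 0, 0, 5, 0, 0, 0, 0, 0, 8, 0, 3, 0, 0].getD (v % 18) 0

def orderChk (v : ℕ) : Bool :=
  !(admB v) || Nat.beq v 1 || (Nat.beq (v % 6) 3 && !(Nat.beq (v % 7) 0)) ||
    force (gOf v) (fun g => genChk v g || genChk v (g + 9)) || baseL.any (Nat.beq v) ||
    spec.any (fun t => Nat.beq t.1 v) || [3, 19, 25, 31].any (prodChk v)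

theorem orderChk_all : allB orderChk 11500 = true := by decide +kernel

theorem aps_one : APS (Fin 1) :=
  ⟨fun _ _ _ => False, fun _ _ _ h => h, fun _ _ _ h => h, fun _ _ _ h => h.elim,
    fun x y h => (h (Subsingleton.elim x y)).elim, fun _ _ _ _ h => h.elim,
    fun _ _ _ _ _ _ h => h.elim⟩

theorem orderChk_spec {v : ℕ} (h : orderChk v = true) (hv : Adm v)
    (ih : ∀ u < v, Adm u → APS (Fin u)) : APS (Fin v) := by
  simp only [orderChk, force_eq, Bool.or_eq_true, Bool.and_eq_true, Bool.not_eq_true'] at h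
  rcases h with (((((h | h) | h) | h) | h) | h) | h
  · rw [admB_iff.2 hv] at h
    cases h
  · rw [Nat.eq_of_beq_eq_true h]
    exact aps_one
  · exact bose_num (Nat.eq_of_beq_eq_true h.1) (beqF.1 h.2)
  · rcases h with h | h
    · exact genChk_spec h hv ih
    · exact genChk_spec h hv ih
  · exact baseL_aps v h
  · rw [List.any_eq_true] at h
    obtain ⟨⟨w, n, l⟩, h1, h2⟩ := h
    have h2 := Nat.eq_of_beq_eq_true h2
    simp only at h2
    subst h2
    have h3 := spec_ok
    rw [List.all_eq_true] at h3
    have h3 := h3 _ h1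
    simp only [Bool.and_eq_true] at h3
    obtain ⟨a1, a2, a3, u, a4, a5, a6⟩ := arith_spec h3.2 hv
    exact rec_num a3 a2 (listChk_spec (by omega) h3.1) a6 a1 (ih u a4 a5)
  · rw [List.any_eq_true] at h
    obtain ⟨d, -, h⟩ := h
    exact prodChk_spec h ih

theorem large {v : ℕ} (hN : 11500 ≤ v) (hv : Adm v) (ih : ∀ u < v, Adm u → APS (Fin u)) :
    APS (Fin v) := by
  have key : ∀ g n, v + 4 * g = 9 * n → g ≤ 17 → n % 7 ≠ 0 → APS (Fin v) := by
    intro g n h1 h2 h3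
    have hm := hv.1
    have hn : 1275 ≤ n := by omega
    have hd : ∀ p, 0 < p → p ≤ 25 → 50 < n / n.gcd p := by
      intro p hp hp'
      have e1 : n.gcd p ≤ 25 := (Nat.gcd_le_right n hp).trans hp'
      have e2 : 0 < n.gcd p := Nat.gcd_pos_of_pos_right _ hp
      have e3 := Nat.div_le_div_left (a := n) e1 e2
      omega
    have hM : ∀ x ∈ defK.take g, x ≤ 25 := by
      intro x hx
      have : ∀ x ∈ defK, x ≤ 25 := by decide
      exact this x (List.mem_of_mem_take hx)
    refine gen_step (u := 3 * n - 4 * g) h1 h3 (by omega) h2 hM (by omega)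
      (hd 15 (by omega) (by omega)) (hd 25 (by omega) (by omega)) (by omega) (ih _ (by omega) ?_)
    exact ⟨by omega, by omega, by omega⟩
  have hg : ∃ g, g ≤ 8 ∧ (v + 4 * g) % 9 = 0 :=
    ⟨2 * v % 9, by omega, by omega⟩
  obtain ⟨g, hg, h9⟩ := hg
  by_cases h7 : (v + 4 * g) / 9 % 7 = 0
  · exact key (g + 9) ((v + 4 * (g + 9)) / 9) (by omega) (by omega) (by omega)
  · exact key g ((v + 4 * g) / 9) (by omega) (by omega) h7

theorem aps_adm (v : ℕ) (hv : Adm v) : APS (Fin v) := by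
  induction v using Nat.strong_induction_on with
  | _ v ih =>
    rcases Nat.lt_or_ge v 11500 with h | h
    · exact orderChk_spec (allB_spec orderChk_all v h) hv ih
    · exact large h hv ih

end table


/-- There exists a 4-sparse Steiner triple system of order `v` iff
`v ≡ 1, 3 (mod 6)` and `v ≠ 7, 13`. -/
theorem exists_four_sparse_STS_iff (v : ℕ) (hv : 0 < v) :
    (∃ B : Finset (Finset (Fin v)), IsSTS B ∧ STSSparse 4 B) ↔
      ((v % 6 = 1 ∨ v % 6 = 3) ∧ v ≠ 7 ∧ v ≠ 13) := by
  constructor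
  · rintro ⟨B, hB, hs⟩
    refine ⟨sts_mod hv hB, ?_, ?_⟩
    · rintro rfl
      exact not_aps_7 (STS.toAPS hB hs)
    · rintro rfl
      exact not_aps_13 (STS.toAPS hB hs)
  · intro h
    obtain ⟨R, hR⟩ := aps_adm v h
    exact hR.exists_finset
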